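/- arXiv:math/0405196 — 2 statements merged into one kernel-verified Lean document; each statement's English description precedes it below -/
import Mathlib

section
/- Let f be a nonconstant rational function on the Riemann sphere all of whose critical points are real, i.e. every point of the Riemann sphere at which f fails to be locally injective lies in ℝ. Then f is equivalent to a rational function with real coefficients: there exists a fractional-linear transformation ℓ(w) = (aw+b)/(cw+d) with a,b,c,d ∈ ℂ and ad−bc ≠ 0 such that ℓ∘f is (the extension to the Riemann sphere of) a ratio of two polynomials with real coefficients. -/
open Polynomial OnePoint

/-- The value of the rational function `f₁/f₀` at the point `∞` of the Riemann sphere. -/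
noncomputable def ratAtInf (f₁ f₀ : ℂ[X]) : OnePoint ℂ :=
  if f₀.degree < f₁.degree then ∞
  else ((f₁.coeff f₀.natDegree / f₀.leadingCoeff : ℂ) : OnePoint ℂ)

/-- The extension of the rational function `f₁/f₀` (ratio of two polynomials) to a self-map
of the Riemann sphere `ℂ̂ = ℂ ∪ {∞}`, realized as the one-point compactification of `ℂ`. -/
noncomputable def ratExt (f₁ f₀ : ℂ[X]) : OnePoint ℂ → OnePoint ℂ
  | ∞ => ratAtInf f₁ f₀
  | (z : ℂ) => if f₀.eval z = 0 then ∞ else ((f₁.eval z / f₀.eval z : ℂ) : OnePoint ℂ)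

/-- A point `p` of the Riemann sphere is a critical point of `f` if `f` fails to be
locally injective at `p`. -/
def IsCritPt (f : OnePoint ℂ → OnePoint ℂ) (p : OnePoint ℂ) : Prop :=
  ¬ ∃ U ∈ nhds p, Set.InjOn f U

theorem exists_ne_eval_mul_eq_of_derivative_eval_eq_zero {A B : ℂ[X]} {x₀ : ℂ}
    (hB : B.eval x₀ ≠ 0) (hA : A.eval x₀ = 0) (hA' : A.derivative.eval x₀ = 0)
    {V : Set ℂ} (hV : V ∈ nhds x₀) :
    ∃ z ∈ V, ∃ w ∈ V, z ≠ w ∧ z ≠ x₀ ∧ w ≠ x₀ ∧ A.eval z * B.eval w = A.eval w * B.eval z := by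
  by_cases hA0 : A = 0
  · have h1 : {x₀}ᶜ ∩ V ∈ nhdsWithin x₀ {x₀}ᶜ := inter_mem_nhdsWithin _ hV
    obtain ⟨z, hz⟩ := (NormedField.nhdsNE_neBot x₀).nonempty_of_mem h1
    have h2 : {x₀}ᶜ ∩ (V ∩ {z}ᶜ) ∈ nhdsWithin x₀ {x₀}ᶜ :=
      inter_mem_nhdsWithin _ (Filter.inter_mem hV (isOpen_compl_singleton.mem_nhds (by
        intro h; exact hz.1 h.symm)))
    obtain ⟨w, hw⟩ := (NormedField.nhdsNE_neBot x₀).nonempty_of_mem h2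
    exact ⟨z, hz.2, w, hw.2.1, fun h => hw.2.2 h.symm, hz.1, hw.1, by simp [hA0]⟩
  set k := A.rootMultiplicity x₀ with hk
  have hk2 : 1 < k := (one_lt_rootMultiplicity_iff_isRoot hA0).2 ⟨hA, hA'⟩
  obtain ⟨A₁, hA₁, hA₁x⟩ := exists_eq_pow_rootMultiplicity_mul_and_not_dvd A hA0 x₀
  rw [dvd_iff_isRoot, IsRoot.def] at hA₁x
  set c : ℂ := A₁.eval x₀ / B.eval x₀ with hc
  have hc0 : c ≠ 0 := div_ne_zero hA₁x hB
  set g : ℂ → ℂ := fun z => A₁.eval z / B.eval z / c with hg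
  have hgx : g x₀ = 1 := by simp [hg, ← hc, hc0]
  have hgan : AnalyticAt ℂ g x₀ := by
    have h1 : AnalyticAt ℂ (fun z => A₁.eval z) x₀ := AnalyticAt.aeval_polynomial analyticAt_id A₁
    have h2 : AnalyticAt ℂ (fun z => B.eval z) x₀ := AnalyticAt.aeval_polynomial analyticAt_id B
    exact (h1.div h2 hB).div analyticAt_const hc0
  set φ : ℂ → ℂ := fun z => (z - x₀) * (g z) ^ (1 / (k : ℂ)) with hφ
  have hr : AnalyticAt ℂ (fun z => (g z) ^ (1 / (k : ℂ))) x₀ :=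
    hgan.cpow analyticAt_const (by simp [hgx])
  have hφan : AnalyticAt ℂ φ x₀ := (analyticAt_id.sub analyticAt_const).mul hr
  have hder : HasStrictDerivAt φ 1 x₀ := by
    have h := hφan.hasStrictDerivAt
    have h2 : HasDerivAt φ (1 * (g x₀) ^ (1 / (k : ℂ)) +
      (x₀ - x₀) * deriv (fun z => (g z) ^ (1 / (k : ℂ))) x₀) x₀ :=
      ((hasDerivAt_id x₀).sub_const x₀).mul hr.differentiableAt.hasDerivAt
    rw [h2.deriv] at h
    simpa [hgx] using h
  have hmap := hder.map_nhds_eq one_ne_zero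
  have hφx : φ x₀ = 0 := by simp [hφ]
  have hBV : {z | B.eval z ≠ 0} ∈ nhds x₀ :=
    B.continuous.continuousAt.eventually_ne hB
  have himg : φ '' (V ∩ {z | B.eval z ≠ 0}) ∈ nhds (0 : ℂ) := by
    have h := Filter.image_mem_map (m := φ) (Filter.inter_mem hV hBV)
    rwa [hmap, hφx] at h
  obtain ⟨ε, hε, hball⟩ := Metric.mem_nhds_iff.1 himg
  set ζ : ℂ := Complex.exp (2 * Real.pi * Complex.I / k) with hζ
  have hprim : IsPrimitiveRoot ζ k := Complex.isPrimitiveRoot_exp k (by omega)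
  have hy : ((ε / 2 : ℝ) : ℂ) ∈ Metric.ball (0 : ℂ) ε := by
    simp [abs_of_pos hε, hε]
  have hy2 : ζ * ((ε / 2 : ℝ) : ℂ) ∈ Metric.ball (0 : ℂ) ε := by
    have : ‖ζ‖ = 1 := hprim.norm'_eq_one (by omega)
    rw [mem_ball_zero_iff, norm_mul, this, one_mul]
    exact mem_ball_zero_iff.1 hy
  obtain ⟨z, ⟨hzV, hzB⟩, hz⟩ := hball hy
  obtain ⟨w, ⟨hwV, hwB⟩, hw⟩ := hball hy2
  have hε2 : ((ε / 2 : ℝ) : ℂ) ≠ 0 := by exact_mod_cast (half_pos hε).ne'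
  have hpow : ∀ x, φ x ^ k = (x - x₀) ^ k * g x := by
    intro x
    simp only [hφ, mul_pow]
    rw [one_div, Complex.cpow_nat_inv_pow _ (by omega)]
  refine ⟨z, hzV, w, hwV, ?_, ?_, ?_, ?_⟩
  · rintro rfl
    rw [hz] at hw
    exact hprim.ne_one hk2 ((mul_eq_right₀ hε2).1 hw.symm)
  · rintro rfl
    exact hε2 (hz ▸ hφx)
  · rintro rfl
    rw [hw] at hφx
    exact (mul_ne_zero (hprim.ne_zero (by omega)) hε2) hφx
  · have h1 : φ z ^ k = φ w ^ k := by
      rw [hz, hw, mul_pow, hprim.pow_eq_one, one_mul]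
    rw [hpow, hpow] at h1
    simp only [hg] at h1
    have hzB' : B.eval z ≠ 0 := hzB
    have hwB' : B.eval w ≠ 0 := hwB
    field_simp at h1
    rw [hA₁, ← hk]
    simp only [eval_mul, eval_pow, eval_sub, eval_X, eval_C]
    linear_combination h1

theorem ratExt_coe_eq_of_eval_mul_eq {f₁ f₀ : ℂ[X]} (hcop : IsCoprime f₁ f₀) {z w : ℂ}
    (h : f₁.eval z * f₀.eval w = f₁.eval w * f₀.eval z) :
    ratExt f₁ f₀ (z : OnePoint ℂ) = ratExt f₁ f₀ (w : OnePoint ℂ) := by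
  have hne : ∀ x, f₀.eval x = 0 → f₁.eval x ≠ 0 := by
    intro x h0 h1
    obtain ⟨u, v, huv⟩ := hcop
    have := congrArg (eval x) huv
    simp [h0, h1] at this
  change (if f₀.eval z = 0 then ∞ else ((f₁.eval z / f₀.eval z : ℂ) : OnePoint ℂ)) =
    (if f₀.eval w = 0 then ∞ else ((f₁.eval w / f₀.eval w : ℂ) : OnePoint ℂ))
  by_cases hz : f₀.eval z = 0
  · have hw : f₀.eval w = 0 := by
      rw [hz, mul_zero] at h
      exact (mul_eq_zero.1 h).resolve_left (hne z hz)
    simp [hz, hw]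
  · have hw : f₀.eval w ≠ 0 := by
      intro hw
      rw [hw, mul_zero] at h
      exact (mul_ne_zero (hne w hw) hz) h.symm
    simp only [hz, hw, if_false]
    rw [(div_eq_div_iff hz hw).2 h]

theorem isCritPt_coe_of_wronskian_eval_eq_zero {f₁ f₀ : ℂ[X]} (hcop : IsCoprime f₁ f₀) {z₀ : ℂ}
    (hW : (wronskian f₀ f₁).eval z₀ = 0) : IsCritPt (ratExt f₁ f₀) (z₀ : OnePoint ℂ) := by
  rintro ⟨U, hU, hinj⟩
  set p := f₁.eval z₀ with hp
  set q := f₀.eval z₀ with hq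
  have hpq : p * star p + q * star q ≠ 0 := by
    have h1 : (p * star p + q * star q : ℂ) = ((‖p‖ ^ 2 + ‖q‖ ^ 2 : ℝ) : ℂ) := by
      push_cast
      rw [Complex.star_def, Complex.mul_conj', Complex.mul_conj']
    rw [h1]
    intro h
    have h2 : ‖p‖ ^ 2 + ‖q‖ ^ 2 = 0 := by exact_mod_cast h
    have hp0 : p = 0 := by
      have : ‖p‖ = 0 := by nlinarith [sq_nonneg ‖p‖, sq_nonneg ‖q‖]
      simpa using this
    have hq0 : q = 0 := by
      have : ‖q‖ = 0 := by nlinarith [sq_nonneg ‖p‖, sq_nonneg ‖q‖]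
      simpa using this
    obtain ⟨u, v, huv⟩ := hcop
    have := congrArg (eval z₀) huv
    rw [eval_add, eval_mul, eval_mul, ← hp, ← hq, hp0, hq0] at this
    simp at this
  have hV : ((↑) : ℂ → OnePoint ℂ) ⁻¹' U ∈ nhds z₀ :=
    OnePoint.continuous_coe.continuousAt.preimage_mem_nhds hU
  obtain ⟨z, hz, w, hw, hzw, -, -, h⟩ := exists_ne_eval_mul_eq_of_derivative_eval_eq_zero
    (A := C q * f₁ - C p * f₀) (B := C (star p) * f₁ + C (star q) * f₀) (x₀ := z₀)
    (by simp only [eval_add, eval_mul, eval_C, ← hp, ← hq]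
        rwa [mul_comm, mul_comm (star q)])
    (by simp only [eval_sub, eval_mul, eval_C, ← hp, ← hq]; ring)
    (by simp only [derivative_sub, derivative_mul, derivative_C, eval_sub, eval_mul, eval_C,
          zero_mul, zero_add]
        rw [← hW, wronskian, eval_sub, eval_mul, eval_mul, ← hp, ← hq]
        ring) hV
  have h' : f₁.eval z * f₀.eval w = f₁.eval w * f₀.eval z := by
    simp only [eval_add, eval_sub, eval_mul, eval_C] at h
    have : (p * star p + q * star q) *
        (f₁.eval z * f₀.eval w - f₁.eval w * f₀.eval z) = 0 := by linear_combination h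
    exact sub_eq_zero.1 ((mul_eq_zero.1 this).resolve_left hpq)
  exact hzw (OnePoint.coe_injective (hinj hz hw (ratExt_coe_eq_of_eval_mul_eq hcop h')))

theorem isCritPt_infty_of_natDegree {f₁ f₀ g₁ g₀ : ℂ[X]} (hcop : IsCoprime f₁ f₀) {a b c e : ℂ}
    (hdet : a * e - b * c ≠ 0) (hg₁ : g₁ = C a * f₁ + C b * f₀) (hg₀ : g₀ = C c * f₁ + C e * f₀)
    (h0 : g₁ ≠ 0) (hdeg : g₀.natDegree + 1 < g₁.natDegree) : IsCritPt (ratExt f₁ f₀) ∞ := by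
  rintro ⟨U, hU, hinj⟩
  set d := g₁.natDegree with hd
  have hT : Filter.Tendsto (fun x : ℂ => ((x⁻¹ : ℂ) : OnePoint ℂ)) (nhdsWithin 0 {0}ᶜ)
      (nhds ∞) := by
    refine Filter.Tendsto.comp (g := ((↑) : ℂ → OnePoint ℂ)) (y := Filter.cocompact ℂ) ?_ ?_
    · rw [← Filter.coclosedCompact_eq_cocompact]
      exact OnePoint.tendsto_coe_infty
    · rw [← Metric.cobounded_eq_cocompact]
      exact Filter.tendsto_inv₀_nhdsNE_zero
  have hV := mem_nhdsWithin_iff_eventually.1 (hT hU)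
  obtain ⟨z, hz, w, hw, hzw, hz0, hw0, h⟩ := exists_ne_eval_mul_eq_of_derivative_eval_eq_zero
    (A := reflect d g₀) (B := reflect d g₁) (x₀ := 0)
    (by rw [← coeff_zero_eq_eval_zero, coeff_reflect, revAt_le (Nat.zero_le d)]
        simpa [hd] using h0)
    (by rw [← coeff_zero_eq_eval_zero, coeff_reflect, revAt_le (Nat.zero_le d)]
        exact coeff_eq_zero_of_natDegree_lt (by omega))
    (by rw [← coeff_zero_eq_eval_zero, coeff_derivative, coeff_reflect,
          revAt_le (by omega : 0 + 1 ≤ d), coeff_eq_zero_of_natDegree_lt (by omega), zero_mul]) hV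
  have hev : ∀ (f : ℂ[X]) (x : ℂ), x ≠ 0 → f.natDegree ≤ d →
      (reflect d f).eval x * x⁻¹ ^ d = f.eval x⁻¹ := by
    intro f x hx hf
    let := invertibleOfNonzero (inv_ne_zero hx)
    have := eval₂_reflect_mul_pow (RingHom.id ℂ) x⁻¹ d f hf
    simpa [eval₂_id] using this
  have h' : g₀.eval z⁻¹ * g₁.eval w⁻¹ = g₀.eval w⁻¹ * g₁.eval z⁻¹ := by
    rw [← hev g₀ z hz0 (by omega), ← hev g₁ w hw0 le_rfl, ← hev g₀ w hw0 (by omega),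
      ← hev g₁ z hz0 le_rfl]
    linear_combination (z⁻¹ ^ d * w⁻¹ ^ d) * h
  have h'' : f₁.eval z⁻¹ * f₀.eval w⁻¹ = f₁.eval w⁻¹ * f₀.eval z⁻¹ := by
    simp only [hg₁, hg₀, eval_add, eval_mul, eval_C] at h'
    have : (a * e - b * c) *
        (f₁.eval z⁻¹ * f₀.eval w⁻¹ - f₁.eval w⁻¹ * f₀.eval z⁻¹) = 0 := by linear_combination -h'
    exact sub_eq_zero.1 ((mul_eq_zero.1 this).resolve_left hdet)
  exact hzw (inv_injective (OnePoint.coe_injective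
    (hinj (hz hz0) (hw hw0) (ratExt_coe_eq_of_eval_mul_eq hcop h''))))

theorem cramer_add_vecMulVec {n R : Type*} [Fintype n] [DecidableEq n] [CommRing R]
    (A : Matrix n n R) (b φ : n → R) :
    Matrix.cramer (A + Matrix.vecMulVec b φ) b = Matrix.cramer A b := by
  funext i
  rw [Matrix.cramer_apply, Matrix.cramer_apply, ← Matrix.det_transpose,
    ← Matrix.det_transpose (A.updateCol i b)]
  refine Matrix.det_eq_of_forall_row_eq_smul_add_const (fun j => if j = i then 0 else φ j) i
    (by simp) fun j r => ?_
  by_cases hj : j = i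
  · subst hj; simp
  · simp [hj, Matrix.vecMulVec_apply, mul_comm]

/-- The matrix of `g ↦ L g mod q` on the polynomials of degree less than `m`, with respect to
the monomial basis. -/
noncomputable def modMatrix (L : ℂ[X] →ₗ[ℂ] ℂ[X]) (m : ℕ) (q : ℂ[X]) : Matrix (Fin m) (Fin m) ℂ :=
  Matrix.of fun i j => (L (X ^ (j : ℕ)) %ₘ q).coeff i

theorem ofFn_toFn_of_degree_lt {m : ℕ} {g : ℂ[X]} (hg : g.degree < m) :
    ofFn m (toFn m g) = g := by
  ext i
  by_cases h : i < m
  · simp [h, toFn]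
  · rw [ofFn_coeff_eq_zero_of_ge _ (not_lt.1 h)]
    exact (coeff_eq_zero_of_degree_lt (hg.trans_le (by exact_mod_cast not_lt.1 h))).symm

theorem ofFn_modMatrix_mulVec (L : ℂ[X] →ₗ[ℂ] ℂ[X]) {m : ℕ} {q : ℂ[X]} (hq : q.Monic)
    (hm : q.natDegree = m) (v : Fin m → ℂ) :
    ofFn m (Matrix.mulVec (modMatrix L m q) v) = L (ofFn m v) %ₘ q := by
  have hdeg : (L (ofFn m v) %ₘ q).degree < m := by
    have := degree_modByMonic_lt (L (ofFn m v)) hq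
    rwa [degree_eq_natDegree hq.ne_zero, hm] at this
  rw [← ofFn_toFn_of_degree_lt hdeg]
  congr 1
  funext i
  have h1 : ofFn m v = ∑ j : Fin m, v j • (X : ℂ[X]) ^ (j : ℕ) := by
    rw [ofFn_eq_sum_monomial]
    exact Finset.sum_congr rfl fun j _ => by rw [smul_X_eq_monomial]
  rw [h1, map_sum, ← modByMonicHom_apply, map_sum]
  simp only [_root_.map_smul, toFn, LinearMap.pi_apply, lcoeff_apply, finsetSum_coeff, coeff_smul,
    modByMonicHom_apply, Matrix.mulVec, dotProduct, modMatrix, Matrix.of_apply, smul_eq_mul]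
  exact Finset.sum_congr rfl fun j _ => mul_comm _ _

theorem modByMonic_X_sub_C_mul {q : ℂ[X]} (hq : q.Monic) (u : ℂ) (h : ℂ[X]) :
    h %ₘ ((X - C u) * q) = q * C ((h /ₘ q).eval u) + h %ₘ q := by
  have hm : ((X - C u) * q).Monic := (monic_X_sub_C u).mul hq
  refine (div_modByMonic_unique (f := h) (h /ₘ q /ₘ (X - C u)) _ hm ⟨?_, ?_⟩).2
  · have h1 := modByMonic_add_div h q
    have h2 := modByMonic_add_div (h /ₘ q) (X - C u)
    rw [modByMonic_X_sub_C_eq_C_eval] at h2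
    linear_combination h1 + q * h2
  · have hd : q.degree < ((X - C u) * q).degree := by
      rw [degree_mul, degree_X_sub_C, degree_eq_natDegree hq.ne_zero]
      exact_mod_cast (by omega : q.natDegree < 1 + q.natDegree)
    refine (degree_add_le _ _).trans_lt (max_lt ?_ ((degree_modByMonic_lt h hq).trans hd))
    refine lt_of_le_of_lt ?_ hd
    rw [degree_mul]
    exact (add_le_add le_rfl degree_C_le).trans (by simp)

theorem exists_cramer_modMatrix (L : ℂ[X] →ₗ[ℂ] ℂ[X]) {m : ℕ} {q : ℂ[X]} (hq : q.Monic)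
    (hm : q.natDegree = m) :
    ∃ g Q : ℂ[X], g.degree < (m + 1 : ℕ) ∧ L g = q * Q ∧
      ∀ u, (modMatrix L (m + 1) ((X - C u) * q)).det = Q.eval u ∧
        ofFn (m + 1)
          (Matrix.cramer (modMatrix L (m + 1) ((X - C u) * q)) (toFn (m + 1) q)) = g := by
  set b := toFn (m + 1) q with hb
  set N : Matrix (Fin (m + 1)) (Fin (m + 1)) ℂ :=
    Matrix.of fun i j => (L (X ^ (j : ℕ)) %ₘ q).coeff i with hN
  have hM : ∀ u, modMatrix L (m + 1) ((X - C u) * q) =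
      N + Matrix.vecMulVec b (fun j : Fin (m + 1) => (L (X ^ (j : ℕ)) /ₘ q).eval u) := by
    intro u
    ext i j
    simp [modMatrix, hN, hb, toFn, modByMonic_X_sub_C_mul hq, Matrix.vecMulVec_apply,
      -map_pow, add_comm]
  have hcr : ∀ u, Matrix.cramer (modMatrix L (m + 1) ((X - C u) * q)) b = Matrix.cramer N b :=
    fun u => by rw [hM, cramer_add_vecMulVec]
  have hqb : ofFn (m + 1) b = q :=
    ofFn_toFn_of_degree_lt (by
      rw [degree_eq_natDegree hq.ne_zero, hm]; exact_mod_cast Nat.lt_succ_self m)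
  set g := ofFn (m + 1) (Matrix.cramer N b) with hg
  have hmod : ∀ u, L g %ₘ ((X - C u) * q) =
      (modMatrix L (m + 1) ((X - C u) * q)).det • q := by
    intro u
    rw [hg, ← hcr u, ← ofFn_modMatrix_mulVec L ((monic_X_sub_C u).mul hq)
      (by rw [(monic_X_sub_C u).natDegree_mul hq, natDegree_X_sub_C, hm, add_comm]),
      Matrix.mulVec_cramer, _root_.map_smul, hqb]
  have hdvd : q ∣ L g := by
    have h1 := modByMonic_add_div (L g) ((X - C 0) * q)
    rw [hmod 0] at h1
    rw [← h1]
    exact dvd_add (Dvd.intro_left _ (smul_eq_C_mul _).symm)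
      (Dvd.dvd.mul_right (Dvd.intro_left _ rfl) _)
  have h0 : L g %ₘ q = 0 := (modByMonic_eq_zero_iff_dvd hq).2 hdvd
  refine ⟨g, L g /ₘ q, ofFn_degree_lt _, ?_, fun u => ⟨?_, ?_⟩⟩
  · have := modByMonic_add_div (L g) q
    rw [h0, zero_add] at this
    exact this.symm
  · have h1 := hmod u
    rw [modByMonic_X_sub_C_mul hq, h0, add_zero, smul_eq_C_mul, mul_comm] at h1
    exact (C_injective (mul_right_cancel₀ hq.ne_zero h1)).symm
  · rw [hcr]

theorem det_modMatrix_smul {ι : Type*} (L : ℂ[X] →ₗ[ℂ] ℂ[X]) {m : ℕ} {q f : ℂ[X]} (hq : q.Monic)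
    (hqm : q.natDegree = m) (hf : f.Monic) (hfm : f.natDegree = m) (hLf : L f = 0)
    (s : Finset ι) (ρ : ι → ℂ) (p : ι → ℂ[X]) (hp : ∀ i ∈ s, (p i).degree < m)
    (h : q ∣ L q - ∑ i ∈ s, ρ i • p i) :
    (modMatrix L m q).det • L q =
      ∑ i ∈ s, ρ i • L (ofFn m (Matrix.cramer (modMatrix L m q) (toFn m (p i)))) := by
  have hd : (q - f).degree < m := by
    have := degree_sub_lt_left (p := q) (q := f) (by rw [degree_eq_natDegree hq.ne_zero,
      degree_eq_natDegree hf.ne_zero, hqm, hfm]) hq.ne_zero (by rw [hq, hf])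
    rwa [degree_eq_natDegree hq.ne_zero, hqm] at this
  have hps : (∑ i ∈ s, ρ i • p i).degree < q.degree := by
    rw [degree_eq_natDegree hq.ne_zero, hqm, ← mem_degreeLT]
    exact Submodule.sum_mem _ fun i hi => Submodule.smul_mem _ _ (mem_degreeLT.2 (hp i hi))
  have hr : L (ofFn m (toFn m (q - f))) %ₘ q = ∑ i ∈ s, ρ i • p i := by
    rw [ofFn_toFn_of_degree_lt hd, map_sub, hLf, sub_zero]
    have h1 := (modByMonic_eq_zero_iff_dvd hq).2 h
    rw [sub_modByMonic, (modByMonic_eq_self_iff hq).2 hps] at h1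
    exact sub_eq_zero.1 h1
  have hMw : Matrix.mulVec (modMatrix L m q) (toFn m (q - f)) = ∑ i ∈ s, ρ i • toFn m (p i) := by
    rw [← ofFn_modMatrix_mulVec L hq hqm] at hr
    have h2 := congrArg (toFn m) hr
    rw [toFn_comp_ofFn_eq_id] at h2
    rw [h2, map_sum]
    simp
  have hw := congrArg (Matrix.cramer (modMatrix L m q)) hMw
  rw [Matrix.cramer_eq_adjugate_mulVec, Matrix.mulVec_mulVec, Matrix.adjugate_mul,
    Matrix.smul_mulVec, Matrix.one_mulVec, map_sum] at hw
  have h3 := congrArg (fun v => L (ofFn m v)) hw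
  simp only [_root_.map_smul, map_sum, ofFn_toFn_of_degree_lt hd] at h3
  rwa [map_sub, hLf, sub_zero] at h3

/-- The second order linear differential operator on polynomials with leading coefficient `A`,
first order coefficient `-R` and zeroth order coefficient `U`. -/
noncomputable def diffOp (A R U : ℂ[X]) : ℂ[X] →ₗ[ℂ] ℂ[X] where
  toFun g := A * derivative (derivative g) - R * derivative g + U * g
  map_add' g h := by simp only [derivative_add]; ring
  map_smul' c g := by simp only [RingHom.id_apply, smul_eq_C_mul, derivative_C_mul]; ring

theorem diffOp_apply (A R U g : ℂ[X]) :
    diffOp A R U g = A * derivative (derivative g) - R * derivative g + U * g := rfl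

theorem exists_diffOp_eq_zero {f₀ f₁ A R : ℂ[X]} (hcop : IsCoprime f₁ f₀)
    (hW : wronskian f₀ f₁ ≠ 0) (hR : wronskian f₀ f₁ * R = A * derivative (wronskian f₀ f₁)) :
    ∃ U, diffOp A R U f₀ = 0 ∧ diffOp A R U f₁ = 0 := by
  obtain ⟨β, α, h⟩ := hcop
  have hW' : derivative (wronskian f₀ f₁) =
      f₀ * derivative (derivative f₁) - derivative (derivative f₀) * f₁ := by
    simp only [wronskian, derivative_sub, derivative_mul]; ring
  rw [hW'] at hR
  refine ⟨α * (R * derivative f₀ - A * derivative (derivative f₀)) +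
    β * (R * derivative f₁ - A * derivative (derivative f₁)), ?_, ?_⟩
  all_goals
    refine (mul_eq_zero.1 ?_).resolve_left hW
    rw [diffOp_apply]
  · have e₀ : wronskian f₀ f₁ * (R * derivative f₀ - A * derivative (derivative f₀)) =
        A * f₀ * (derivative (derivative f₁) * derivative f₀ -
          derivative f₁ * derivative (derivative f₀)) := by
      rw [mul_sub, ← mul_assoc, hR, wronskian]; ring
    have e₁ : wronskian f₀ f₁ * (R * derivative f₁ - A * derivative (derivative f₁)) =
        A * f₁ * (derivative (derivative f₁) * derivative f₀ -
          derivative f₁ * derivative (derivative f₀)) := by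
      rw [mul_sub, ← mul_assoc, hR, wronskian]; ring
    linear_combination (f₀ * α - 1) * e₀ + f₀ * β * e₁ + A * f₀ *
      (derivative (derivative f₁) * derivative f₀ -
          derivative f₁ * derivative (derivative f₀)) * h
  · have e₀ : wronskian f₀ f₁ * (R * derivative f₀ - A * derivative (derivative f₀)) =
        A * f₀ * (derivative (derivative f₁) * derivative f₀ -
          derivative f₁ * derivative (derivative f₀)) := by
      rw [mul_sub, ← mul_assoc, hR, wronskian]; ring
    have e₁ : wronskian f₀ f₁ * (R * derivative f₁ - A * derivative (derivative f₁)) =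
        A * f₁ * (derivative (derivative f₁) * derivative f₀ -
          derivative f₁ * derivative (derivative f₀)) := by
      rw [mul_sub, ← mul_assoc, hR, wronskian]; ring
    linear_combination (f₁ * β - 1) * e₁ + f₁ * α * e₀ + A * f₁ *
      (derivative (derivative f₁) * derivative f₀ -
          derivative f₁ * derivative (derivative f₀)) * h

theorem diffOp_wronskian {A R U f : ℂ[X]} (hf : diffOp A R U f = 0) (g : ℂ[X]) :
    A * derivative (wronskian f g) - R * wronskian f g = f * diffOp A R U g := by
  rw [diffOp_apply] at hf ⊢
  simp only [wronskian, derivative_sub, derivative_mul]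
  linear_combination -g * hf

theorem natDegree_eq_of_wronskian_eq_zero {p q : ℂ[X]} (hp : p ≠ 0) (hq : q ≠ 0)
    (h : wronskian p q = 0) : p.natDegree = q.natDegree := by
  have hl : ∀ r : ℂ[X], (derivative r).leadingCoeff = r.leadingCoeff * r.natDegree := by
    intro r
    rcases Nat.eq_zero_or_pos r.natDegree with h0 | h0
    · rw [eq_C_of_natDegree_eq_zero h0]; simp
    · rw [leadingCoeff, natDegree_derivative, coeff_derivative, Nat.sub_add_cancel h0,
        leadingCoeff]
      congr 1
      exact_mod_cast (Nat.sub_add_cancel h0)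
  have h1 : p * derivative q = derivative p * q := sub_eq_zero.1 h
  have h2 := congrArg leadingCoeff h1
  rw [leadingCoeff_mul, leadingCoeff_mul, hl, hl] at h2
  have h3 : p.leadingCoeff * q.leadingCoeff * ((q.natDegree : ℂ) - p.natDegree) = 0 := by
    linear_combination h2
  have h4 := (mul_eq_zero.1 h3).resolve_left
    (mul_ne_zero (leadingCoeff_ne_zero.2 hp) (leadingCoeff_ne_zero.2 hq))
  exact_mod_cast (sub_eq_zero.1 h4).symm

theorem eq_zero_of_diffOp_eq_zero {A R U f₀ f₁ g : ℂ[X]} {m : ℕ} (hA : A ≠ 0)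
    (h₀ : diffOp A R U f₀ = 0) (h₁ : diffOp A R U f₁ = 0) (hf₀ : f₀ ≠ 0)
    (hd₀ : f₀.natDegree = m) (hW : wronskian f₀ f₁ ≠ 0)
    (hdW : (wronskian f₀ f₁).natDegree = 2 * m)
    (hg : g.degree < m) (h : diffOp A R U g = 0) : g = 0 := by
  by_contra hg0
  have hgm : g.natDegree < m := (natDegree_lt_iff_degree_lt hg0).2 hg
  have e₁ := diffOp_wronskian h₀ f₁
  have e₂ := diffOp_wronskian h₀ g
  rw [h₁, mul_zero] at e₁
  rw [h, mul_zero] at e₂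
  have hne : wronskian f₀ g ≠ 0 := fun h0 => by
    have := natDegree_eq_of_wronskian_eq_zero hf₀ hg0 h0
    omega
  have hWW : wronskian (wronskian f₀ f₁) (wronskian f₀ g) = 0 := by
    refine (mul_eq_zero.1 (?_ : A * _ = 0)).resolve_left hA
    rw [wronskian]
    linear_combination wronskian f₀ f₁ * e₂ - wronskian f₀ g * e₁
  have h1 := natDegree_eq_of_wronskian_eq_zero hW hne hWW
  have h2 := natDegree_wronskian_lt_add hne
  omega

theorem not_pow_succ_dvd_diffOp_sub {A R U f A₁ : ℂ[X]} {z : ℂ} {k : ℕ}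
    (hf : diffOp A R U f = 0) (hfz : f.eval z ≠ 0) (hA : A = (X - C z) * A₁)
    (hA₁ : A₁.eval z ≠ 0) (hR : X - C z ∣ R - C (k : ℂ) * A₁) (g : ℂ[X]) :
    ¬ (X - C z) ^ (k + 1) ∣ diffOp A R U g - (X - C z) ^ k := by
  rintro ⟨s, hs⟩
  obtain ⟨B, hB⟩ := hR
  have hX : (X - C z : ℂ[X]) ≠ 0 := X_sub_C_ne_zero z
  have hω := diffOp_wronskian hf g
  have hD : diffOp A R U g = (X - C z) ^ k * (1 + (X - C z) * s) := by
    linear_combination hs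
  rw [hD] at hω
  by_cases h0 : wronskian f g = 0
  · rw [h0, derivative_zero, mul_zero, mul_zero, sub_zero] at hω
    have h1 : f * (1 + (X - C z) * s) = 0 := by
      refine (mul_eq_zero.1 (?_ : (X - C z) ^ k * _ = 0)).resolve_left (pow_ne_zero k hX)
      linear_combination -hω
    have h2 := congrArg (eval z) h1
    simp [hfz] at h2
  obtain ⟨η, hη, hηz⟩ := exists_eq_pow_rootMultiplicity_mul_and_not_dvd _ h0 z
  rw [dvd_iff_isRoot, IsRoot.def] at hηz
  set j := (wronskian f g).rootMultiplicity z
  have hder : (X - C z) * derivative (wronskian f g) =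
      (X - C z) ^ j * (C (j : ℂ) * η + (X - C z) * derivative η) := by
    rw [hη, derivative_mul, derivative_X_sub_C_pow]
    rcases j with _ | j
    · simp
    · simp only [Nat.add_sub_cancel]
      push_cast
      simp only [map_add, map_natCast, map_one]
      ring
  have key : (X - C z) ^ j * (C ((j : ℂ) - k) * A₁ * η +
      (X - C z) * (A₁ * derivative η - B * η)) = (X - C z) ^ k * (f * (1 + (X - C z) * s)) := by
    rw [C_sub]
    linear_combination hω - A₁ * hder + wronskian f g * hB
      - derivative (wronskian f g) * hA + (C (k : ℂ) * A₁ + (X - C z) * B) * hη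
  rcases lt_or_ge j k with hjk | hjk
  · obtain ⟨t, rfl⟩ := Nat.exists_eq_add_of_lt hjk
    have h1 := mul_left_cancel₀ (pow_ne_zero j hX) (key.trans (by
      rw [add_assoc, pow_add, mul_assoc]))
    have h2 := congrArg (eval z) h1
    simp only [eval_add, eval_mul, eval_C, eval_sub, eval_X, sub_self, zero_mul, add_zero,
      eval_pow, zero_pow (Nat.succ_ne_zero t)] at h2
    have h3 : ((j : ℂ) - ((j + t + 1 : ℕ) : ℂ)) ≠ 0 := by
      push_cast
      have : (t : ℂ) + 1 ≠ 0 := by exact_mod_cast Nat.succ_ne_zero t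
      intro h; apply this; linear_combination -h
    exact mul_ne_zero (mul_ne_zero h3 hA₁) hηz h2
  · obtain ⟨t, ht⟩ := Nat.exists_eq_add_of_le hjk
    rw [ht, pow_add, mul_assoc] at key
    have h1 := mul_left_cancel₀ (pow_ne_zero k hX) key
    have h2 := congrArg (eval z) h1
    simp only [eval_add, eval_mul, eval_C, eval_sub, eval_X, sub_self, zero_mul, add_zero,
      eval_pow, eval_one, mul_one] at h2
    rcases t with _ | t
    · simp at h2; exact hfz h2.symm
    · rw [zero_pow (Nat.succ_ne_zero t), zero_mul] at h2; exact hfz h2.symm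

theorem pow_dvd_diffOp_sub {A R U A₁ : ℂ[X]} {z : ℂ} {k t : ℕ} (hA : A = (X - C z) * A₁)
    (hR : X - C z ∣ R - C (k : ℂ) * A₁) (η : ℂ[X]) :
    (X - C z) ^ (t + 1) ∣ diffOp A R U ((X - C z) ^ (t + 1) * η) -
      (A₁.eval z * (t + 1) * (t - k)) • ((X - C z) ^ t * η) := by
  obtain ⟨B, hB⟩ := hR
  obtain ⟨E, hE⟩ : X - C z ∣ A₁ - C (A₁.eval z) := by
    rw [dvd_iff_isRoot]; simp
  have h1 : derivative ((X - C z) ^ (t + 1) * η) =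
      (X - C z) ^ t * (C ((t : ℂ) + 1) * η + (X - C z) * derivative η) := by
    rw [derivative_mul, derivative_X_sub_C_pow, Nat.add_sub_cancel]
    push_cast
    simp only [map_add, map_natCast, map_one]
    ring
  have h2 : (X - C z) *
        derivative ((X - C z) ^ t * (C ((t : ℂ) + 1) * η + (X - C z) * derivative η)) =
      (X - C z) ^ t * (C ((t : ℂ) * (t + 1)) * η +
        C (2 * ((t : ℂ) + 1)) * (X - C z) * derivative η
        + (X - C z) ^ 2 * derivative (derivative η)) := by
    rw [derivative_mul, derivative_X_sub_C_pow]
    have h3 : (X - C z) * (C (t : ℂ) * (X - C z) ^ (t - 1)) = C (t : ℂ) * (X - C z) ^ t := by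
      rcases t with _ | t
      · simp
      · rw [Nat.add_sub_cancel]; ring
    simp only [derivative_add, derivative_mul, derivative_sub, derivative_X, derivative_C,
      derivative_add]
    simp only [map_add, map_mul, map_one, map_ofNat, sub_zero, zero_mul, zero_add, one_mul]
    linear_combination ((C (t : ℂ) + 1) * η + (X - C z) * derivative η) * h3
  rw [diffOp_apply, h1, hA, smul_eq_C_mul]
  have hCC : C (A₁.eval z * (t + 1) * (t - k)) =
      C (A₁.eval z) * (C ((t : ℂ)) + 1) * (C (t : ℂ) - C (k : ℂ)) := by
    simp only [map_mul, map_add, map_sub, map_one]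
  refine ⟨E * (C (t : ℂ) + 1) * (C (t : ℂ) - C (k : ℂ)) * η
    + A₁ * (C (2 * ((t : ℂ) + 1)) * derivative η + (X - C z) * derivative (derivative η))
    - C (k : ℂ) * A₁ * derivative η - B * (C ((t : ℂ) + 1) * η + (X - C z) * derivative η)
    + U * η, ?_⟩
  simp only [map_add, map_mul, map_one, map_ofNat] at h2 ⊢
  rw [pow_succ]
  rw [map_sub]
  linear_combination A₁ * h2
    - ((X - C z) ^ t * ((C ((t : ℂ)) + 1) * η + (X - C z) * derivative η)) * hB
    + (C (t : ℂ) + 1) * (C (t : ℂ) - C (k : ℂ)) * η * (X - C z) ^ t * hE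

theorem finrank_map_mulLeft {p : ℂ[X]} (hp : p ≠ 0) (G : Submodule ℂ ℂ[X]) :
    Module.finrank ℂ (G.map (LinearMap.mulLeft ℂ p)) = Module.finrank ℂ G :=
  (Submodule.equivMapOfInjective _ (fun _ _ h => mul_left_cancel₀ hp h) G).finrank_eq.symm

theorem comap_mulLeft_le_degreeLT {p : ℂ[X]} (hp : p ≠ 0) {F : Submodule ℂ ℂ[X]} {n : ℕ}
    (hF : F ≤ degreeLT ℂ (n + p.natDegree)) :
    F.comap (LinearMap.mulLeft ℂ p) ≤ degreeLT ℂ n := by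
  intro g hg
  rw [mem_degreeLT]
  by_cases h0 : g = 0
  · rw [h0, degree_zero]; exact WithBot.bot_lt_coe n
  have h1 := mem_degreeLT.1 (hF hg)
  rw [LinearMap.mulLeft_apply, ← natDegree_lt_iff_degree_lt (mul_ne_zero hp h0),
    natDegree_mul hp h0] at h1
  rw [← natDegree_lt_iff_degree_lt h0]
  omega

theorem exists_finrank_comap_mulLeft_le {ι : Type*} [Fintype ι] [Nonempty ι] {z : ι → ℂ}
    (hz : Function.Injective z) {m : ℕ} {F : Submodule ℂ ℂ[X]} (hF : Module.finrank ℂ F ≤ m + 1)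
    (hle : F ≤ degreeLT ℂ (m + Fintype.card ι)) :
    ∃ i, Module.finrank ℂ (F.comap (LinearMap.mulLeft ℂ (X - C (z i)))) ≤ m := by
  have : FiniteDimensional ℂ F := Submodule.finiteDimensional_of_le hle
  by_cases hall : ∀ i, (F.comap (LinearMap.mulLeft ℂ (X - C (z i)))).map
      (LinearMap.mulLeft ℂ (X - C (z i))) = F
  · have hne : (∏ i, (X - C (z i)) : ℂ[X]) ≠ 0 :=
      Finset.prod_ne_zero_iff.2 fun i _ => X_sub_C_ne_zero _
    have hmap : (F.comap (LinearMap.mulLeft ℂ (∏ i, (X - C (z i))))).map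
        (LinearMap.mulLeft ℂ (∏ i, (X - C (z i)))) = F := by
      refine le_antisymm (Submodule.map_comap_le _ _) fun h hh => ?_
      obtain ⟨g, rfl⟩ : ∏ i, (X - C (z i)) ∣ h := by
        refine Finset.prod_dvd_of_coprime
          (fun i _ j _ hij => pairwise_coprime_X_sub_C hz hij) fun i _ => ?_
        have hh' := hh
        rw [← hall i] at hh'
        obtain ⟨g, -, rfl⟩ := hh'
        exact Dvd.intro _ rfl
      exact ⟨g, hh, rfl⟩
    have hdeg : (∏ i, (X - C (z i)) : ℂ[X]).natDegree = Fintype.card ι := by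
      rw [natDegree_finsetProd_X_sub_C_eq_card, Finset.card_univ]
    have h1 := finrank_map_mulLeft hne (F.comap (LinearMap.mulLeft ℂ (∏ i, (X - C (z i)))))
    have h2 := comap_mulLeft_le_degreeLT hne (hdeg.symm ▸ hle)
    have hfd : Module.Finite ℂ (degreeLT ℂ m) := Module.Finite.equiv (degreeLTEquiv ℂ m).symm
    have h3 := Submodule.finrank_mono h2
    rw [(degreeLTEquiv ℂ m).finrank_eq, Module.finrank_fin_fun, ← h1, hmap] at h3
    obtain ⟨i⟩ := ‹Nonempty ι›
    refine ⟨i, ?_⟩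
    rwa [← finrank_map_mulLeft (X_sub_C_ne_zero (z i)), hall i]
  · obtain ⟨i, hi⟩ := not_forall.1 hall
    refine ⟨i, ?_⟩
    rw [← finrank_map_mulLeft (X_sub_C_ne_zero (z i))]
    have := Submodule.finrank_lt_finrank_of_lt (lt_of_le_of_ne (Submodule.map_comap_le _ _) hi)
    omega

theorem prod_pow_add_single {ι : Type*} [Fintype ι] [DecidableEq ι] (z : ι → ℂ) (a : ι → ℕ)
    (i : ι) : ∏ j, (X - C (z j)) ^ (a + Pi.single i 1 : ι → ℕ) j =
      (X - C (z i)) * ∏ j, (X - C (z j)) ^ a j := by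
  simp only [Pi.add_apply, pow_add, Finset.prod_mul_distrib]
  rw [mul_comm]
  congr 1
  rw [Finset.prod_eq_single i (fun j _ hj => by simp [hj]) (by simp)]
  simp

theorem exists_prod_pow_dvd_imp_eq_zero {ι : Type*} [Fintype ι] [Nonempty ι] {z : ι → ℂ}
    (hz : Function.Injective z) (m : ℕ) :
    ∀ F : Submodule ℂ ℂ[X], Module.finrank ℂ F ≤ m →
      F ≤ degreeLT ℂ (m + Fintype.card ι - 1) →
      ∃ a : ι → ℕ, ∑ i, a i = m ∧ ∀ h ∈ F, ∏ i, (X - C (z i)) ^ a i ∣ h → h = 0 := by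
  classical
  induction m with
  | zero =>
    intro F hF hle
    have : FiniteDimensional ℂ F := Submodule.finiteDimensional_of_le hle
    have h0 : F = ⊥ := Submodule.finrank_eq_zero.1 (Nat.le_zero.1 hF)
    exact ⟨0, by simp, fun h hh _ => by rw [h0] at hh; simpa using hh⟩
  | succ m ih =>
    intro F hF hle
    have hcard : 0 < Fintype.card ι := Fintype.card_pos
    rw [show m + 1 + Fintype.card ι - 1 = m + Fintype.card ι by omega] at hle
    obtain ⟨i, hi⟩ := exists_finrank_comap_mulLeft_le hz hF hle
    obtain ⟨a, ha, hF'⟩ := ih _ hi (comap_mulLeft_le_degreeLT (X_sub_C_ne_zero _) (by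
      rwa [natDegree_X_sub_C, Nat.sub_add_cancel (by omega)]))
    refine ⟨a + Pi.single i 1, by simp [Finset.sum_add_distrib, ha], ?_⟩
    rintro h hh ⟨s, hs⟩
    rw [prod_pow_add_single, mul_assoc] at hs
    have h1 := hF' ((∏ j, (X - C (z j)) ^ a j) * s) (by
      rw [Submodule.mem_comap, LinearMap.mulLeft_apply, ← hs]; exact hh) (Dvd.intro _ rfl)
    rw [hs, h1, mul_zero]

open scoped ComplexConjugate in
theorem im_eq_zero_of_sum_eq {ι : Type*} [Fintype ι] [DecidableEq ι] {m : ℕ} {k : ι → ℕ}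
    {ω y : ι → ℝ} (hω : ∀ i, ω i ≠ 0) {p Q : (ι → ℕ) → ℂ} {r : (ι → ℕ) → ℝ} {c : ℝ} {U : ℂ}
    (hp0 : ∀ a, ∑ i, a i = m + 1 → ∀ i, k i < a i → p a = 0)
    (hne : ∃ a, ∑ i, a i = m + 1 ∧ p a ≠ 0)
    (hmain : ∀ a, ∑ i, a i = m + 1 → p a * (U + r a) = ∑ i with a i ≠ 0,
      ω i * a i * (a i - 1 - k i) * (Q (a - Pi.single i 1) * y i))
    (hlag : ∀ a, ∑ i, a i = m → Q a * c = ∑ i, p (a + Pi.single i 1) * ((ω i)⁻¹ * y i)) :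
    U.im = 0 := by
  set G : ι → ℕ → ℝ := fun i j => (((ω i) ^ 2)⁻¹) ^ j * (k i - j).factorial / j.factorial with hG
  have hGpos : ∀ i j, 0 < G i j := fun i j => by
    have := sq_pos_of_ne_zero (hω i)
    positivity
  set w : (ι → ℕ) → ℝ := fun a => ∏ i, G i (a i) with hw
  have hwpos : ∀ a, 0 < w a := fun a => Finset.prod_pos fun i _ => hGpos i _
  have hwstep : ∀ a i, a i < k i →
      w (a + Pi.single i 1) * (ω i * (a i + 1) * (a i - k i)) = -(w a * (ω i)⁻¹) := by
    intro a i hai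
    have h1 : w (a + Pi.single i 1) = G i (a i + 1) * ∏ j ∈ Finset.univ.erase i, G j (a j) := by
      change ∏ j, G j ((a + Pi.single i 1 : ι → ℕ) j) = _
      rw [← Finset.mul_prod_erase Finset.univ _ (Finset.mem_univ i)]
      simp only [Pi.add_apply, Pi.single_eq_same]
      congr 1
      refine Finset.prod_congr rfl fun j hj => ?_
      simp [Finset.ne_of_mem_erase hj]
    have h2 : w a = G i (a i) * ∏ j ∈ Finset.univ.erase i, G j (a j) :=
      (Finset.mul_prod_erase Finset.univ _ (Finset.mem_univ i)).symm
    rw [h1, h2]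
    obtain ⟨t, ht⟩ := Nat.exists_eq_add_of_lt hai
    have h3 : G i (a i + 1) * (ω i * (a i + 1) * (a i - k i)) = -(G i (a i) * (ω i)⁻¹) := by
      simp only [hG]
      rw [ht, show a i + t + 1 - (a i + 1) = t by omega, show a i + t + 1 - a i = t + 1 by omega,
        Nat.factorial_succ, Nat.factorial_succ, pow_succ]
      have := hω i
      push_cast
      field_simp
      ring
    linear_combination (∏ j ∈ Finset.univ.erase i, G j (a j)) * h3
  have hstep : ∀ a i, ∑ i, a i = m →
      (w (a + Pi.single i 1) * (ω i * (a i + 1) * (a i - k i)) : ℂ) * conj (p (a + Pi.single i 1)) =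
        -(w a * (ω i)⁻¹) * conj (p (a + Pi.single i 1)) := by
    intro a i ha
    rcases lt_or_ge (a i) (k i) with h | h
    · have := hwstep a i h
      rw [← Complex.ofReal_inj] at this
      push_cast at this ⊢
      rw [this]
    · rw [hp0 (a + Pi.single i 1) (by simp [Finset.sum_add_distrib, ha]) i (by simp; omega)]
      simp
  set S : ℕ → Finset (ι → ℕ) := fun n => Finset.piAntidiag Finset.univ n with hS
  have hSm : ∀ n a, a ∈ S n ↔ ∑ i, a i = n := fun n a => by simp [hS]
  have hsingle : ∀ (a : ι → ℕ) i, a i ≠ 0 → (Pi.single i 1 : ι → ℕ) ≤ a := by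
    intro a i hi j
    rcases eq_or_ne j i with rfl | hj
    · simpa [Nat.one_le_iff_ne_zero] using hi
    · simp [hj]
  have key : ∑ a ∈ S (m + 1), ((w a * ‖p a‖ ^ 2 : ℝ) : ℂ) * (U + r a) =
      -∑ a ∈ S m, ((w a * ‖Q a‖ ^ 2 * c : ℝ) : ℂ) := by
    have h1 : ∑ a ∈ S (m + 1), ((w a * ‖p a‖ ^ 2 : ℝ) : ℂ) * (U + r a) =
        ∑ x ∈ (S (m + 1)).sigma fun a => Finset.univ.filter fun i => a i ≠ 0,
          (w x.1 : ℂ) * conj (p x.1) * (ω x.2 * x.1 x.2 * (x.1 x.2 - 1 - k x.2) *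
            (Q (x.1 - Pi.single x.2 1) * y x.2)) := by
      rw [Finset.sum_sigma]
      refine Finset.sum_congr rfl fun a ha => ?_
      dsimp only
      rw [← Finset.mul_sum, ← hmain a ((hSm _ _).1 ha)]
      push_cast
      rw [← Complex.conj_mul']
      ring
    have h2 : ∑ x ∈ (S (m + 1)).sigma fun a => Finset.univ.filter fun i => a i ≠ 0,
          (w x.1 : ℂ) * conj (p x.1) * (ω x.2 * x.1 x.2 * (x.1 x.2 - 1 - k x.2) *
            (Q (x.1 - Pi.single x.2 1) * y x.2)) =
        ∑ x ∈ (S m).sigma fun _ => (Finset.univ : Finset ι),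
          (-(w x.1 * (ω x.2)⁻¹) * conj (p (x.1 + Pi.single x.2 1)) : ℂ) * (Q x.1 * y x.2) := by
      symm
      refine Finset.sum_bij' (fun x _ => ⟨x.1 + Pi.single x.2 1, x.2⟩)
        (fun x _ => ⟨x.1 - Pi.single x.2 1, x.2⟩) ?_ ?_ ?_ ?_ ?_
      · rintro ⟨a, i⟩ hx
        simp only [Finset.mem_sigma, hSm, Finset.mem_univ, and_true] at hx
        simp [hSm, Finset.sum_add_distrib, hx]
      · rintro ⟨a, i⟩ hx
        simp only [Finset.mem_sigma, hSm, Finset.mem_filter, Finset.mem_univ, true_and] at hx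
        have hle : (Pi.single i 1 : ι → ℕ) + (a - Pi.single i 1) = a :=
          add_tsub_cancel_of_le (hsingle a i hx.2)
        have := hx.1
        rw [← hle] at this
        simp only [Pi.add_apply, Finset.sum_add_distrib, Finset.sum_pi_single'] at this
        simp only [Finset.mem_sigma, hSm, Finset.mem_univ, and_true]
        simp at this ⊢
        omega
      · rintro ⟨a, i⟩ hx
        simp
      · rintro ⟨a, i⟩ hx
        simp only [Finset.mem_sigma, hSm, Finset.mem_filter, Finset.mem_univ, true_and] at hx
        have hle : a - Pi.single i 1 + (Pi.single i 1 : ι → ℕ) = a :=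
          tsub_add_cancel_of_le (hsingle a i hx.2)
        simp [hle]
      · rintro ⟨a, i⟩ hx
        simp only [Finset.mem_sigma, hSm, Finset.mem_univ, and_true] at hx
        simp only [add_tsub_cancel_right, Pi.add_apply, Pi.single_eq_same]
        rw [← hstep a i hx]
        push_cast
        ring
    rw [h1, h2, Finset.sum_sigma, ← Finset.sum_neg_distrib]
    refine Finset.sum_congr rfl fun a ha => ?_
    have h3 := congrArg conj (hlag a ((hSm _ _).1 ha))
    simp only [map_mul, map_sum, Complex.conj_ofReal] at h3
    push_cast
    rw [← Complex.conj_mul']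
    calc _ = -(w a * Q a) * ∑ i, conj (p (a + Pi.single i 1)) * (((ω i)⁻¹ : ℝ) * y i) := by
          rw [Finset.mul_sum]
          refine Finset.sum_congr rfl fun i _ => ?_
          push_cast
          ring
      _ = _ := by rw [← h3]; ring
  have him := congrArg Complex.im key
  simp only [Complex.im_sum, Complex.neg_im, Complex.ofReal_im, Finset.sum_const_zero, neg_zero,
    Complex.im_ofReal_mul, Complex.add_im, add_zero, ← Finset.sum_mul] at him
  refine (mul_eq_zero.1 him).resolve_left (Finset.sum_pos' (fun a _ => ?_) ?_).ne'
  · have := hwpos a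
    positivity
  · obtain ⟨a, ha, hpa⟩ := hne
    have := hwpos a
    exact ⟨a, (hSm _ _).2 ha, by positivity⟩

theorem det_modMatrix_diffOp_eq_zero_of_pow_dvd {A R U f A₁ : ℂ[X]} {z : ℂ} {k : ℕ}
    (hf : diffOp A R U f = 0) (hfz : f.eval z ≠ 0) (hA : A = (X - C z) * A₁)
    (hA₁ : A₁.eval z ≠ 0) (hR : X - C z ∣ R - C (k : ℂ) * A₁) {m : ℕ} {q : ℂ[X]} (hq : q.Monic)
    (hqm : q.natDegree = m) (hdvd : (X - C z) ^ (k + 1) ∣ q) :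
    (modMatrix (diffOp A R U) m q).det = 0 := by
  by_contra hdet
  have hkm : k < m := by
    have := natDegree_le_of_dvd hdvd hq.ne_zero
    rwa [natDegree_pow, natDegree_X_sub_C, mul_one, hqm] at this
  have hdeg : ((X - C z) ^ k : ℂ[X]).degree < m := by
    rw [degree_pow, degree_X_sub_C, nsmul_eq_mul, mul_one]
    exact_mod_cast hkm
  obtain ⟨x, hx⟩ := (Matrix.mulVec_surjective_iff_isUnit.2
    ((Matrix.isUnit_iff_isUnit_det _).2 (isUnit_iff_ne_zero.2 hdet)))
    (toFn m ((X - C z) ^ k))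
  have h1 := ofFn_modMatrix_mulVec (diffOp A R U) hq hqm x
  rw [hx, ofFn_toFn_of_degree_lt hdeg] at h1
  have h2 := modByMonic_add_div (diffOp A R U (ofFn m x)) q
  refine not_pow_succ_dvd_diffOp_sub hf hfz hA hA₁ hR (ofFn m x) (hdvd.trans ?_)
  rw [h1]
  exact ⟨diffOp A R U (ofFn m x) /ₘ q, by linear_combination -h2⟩

theorem natDegree_mul_sub_mul_derivative_le {A R : ℂ[X]} {N : ℕ} (hN : 0 < N) (hA : A.natDegree ≤ N)
    (hR : R.natDegree ≤ N - 1) (g : ℂ[X]) :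
    (A * derivative (derivative g) - R * derivative g).natDegree ≤ N + g.natDegree - 2 := by
  have h : ∀ p : ℂ[X], derivative p ≠ 0 → (derivative p).natDegree + 1 ≤ p.natDegree := by
    intro p hp
    exact natDegree_derivative_lt fun h0 => hp (by
      rw [eq_C_of_natDegree_eq_zero h0, derivative_C])
  by_cases h1 : derivative g = 0
  · simp [h1]
  have := h _ h1
  refine (natDegree_sub_le _ _).trans (max_le ?_ (natDegree_mul_le.trans ?_))
  · by_cases h2 : derivative (derivative g) = 0
    · simp [h2]
    have := h _ h2
    exact natDegree_mul_le.trans (by omega)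
  · omega

theorem degree_diffOp_lt {A R U : ℂ[X]} {N m : ℕ} (hN : 0 < N) (hA : A.natDegree ≤ N)
    (hR : R.natDegree ≤ N - 1) (hU : U.natDegree ≤ N - 1) {g : ℂ[X]} (hg : g.degree < m) :
    (diffOp A R U g).degree < (m + N - 1 : ℕ) := by
  by_cases h0 : g = 0
  · rw [h0, map_zero, degree_zero]; exact WithBot.bot_lt_coe _
  have hgm := (natDegree_lt_iff_degree_lt h0).2 hg
  have h1 := natDegree_mul_sub_mul_derivative_le hN hA hR g
  refine degree_le_natDegree.trans_lt ?_
  rw [diffOp_apply]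
  have h2 := natDegree_add_le (A * derivative (derivative g) - R * derivative g) (U * g)
  have h3 : (U * g).natDegree ≤ _ := natDegree_mul_le
  exact_mod_cast (by omega : _ < m + N - 1)

theorem exists_det_modMatrix_diffOp_ne_zero {ι : Type*} [Fintype ι] [Nonempty ι] {z : ι → ℂ}
    (hz : Function.Injective z) {A R U f₀ f₁ : ℂ[X]} {m : ℕ} (hA0 : A ≠ 0)
    (hA : A.natDegree ≤ Fintype.card ι) (hR : R.natDegree ≤ Fintype.card ι - 1)
    (hU : U.natDegree ≤ Fintype.card ι - 1)
    (h₀ : diffOp A R U f₀ = 0) (h₁ : diffOp A R U f₁ = 0) (hf₀ : f₀ ≠ 0)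
    (hd₀ : f₀.natDegree = m) (hW : wronskian f₀ f₁ ≠ 0)
    (hdW : (wronskian f₀ f₁).natDegree = 2 * m) :
    ∃ a : ι → ℕ, ∑ i, a i = m ∧
      (modMatrix (diffOp A R U) m (∏ i, (X - C (z i)) ^ a i)).det ≠ 0 := by
  have hfd : Module.Finite ℂ (degreeLT ℂ m) := Module.Finite.equiv (degreeLTEquiv ℂ m).symm
  obtain ⟨a, ha, hF⟩ := exists_prod_pow_dvd_imp_eq_zero hz m ((degreeLT ℂ m).map (diffOp A R U))
    ((Submodule.finrank_map_le _ _).trans_eq (by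
      rw [(degreeLTEquiv ℂ m).finrank_eq, Module.finrank_fin_fun])) (by
    rintro _ ⟨g, hg, rfl⟩
    exact mem_degreeLT.2 (degree_diffOp_lt Fintype.card_pos hA hR hU (mem_degreeLT.1 hg)))
  refine ⟨a, ha, fun hdet => ?_⟩
  obtain ⟨x, hx, hMx⟩ := Matrix.exists_mulVec_eq_zero_iff.2 hdet
  have hq : (∏ i, (X - C (z i)) ^ a i).Monic :=
    monic_prod_of_monic _ _ fun i _ => (monic_X_sub_C _).pow _
  have hqm : (∏ i, (X - C (z i)) ^ a i).natDegree = m := by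
    rw [natDegree_prod_of_monic _ _ fun i _ => (monic_X_sub_C _).pow _]
    simp [ha]
  have h1 := ofFn_modMatrix_mulVec (diffOp A R U) hq hqm x
  rw [hMx, map_zero] at h1
  have h2 := hF _ ⟨ofFn m x, mem_degreeLT.2 (ofFn_degree_lt _), rfl⟩
    ((modByMonic_eq_zero_iff_dvd hq).1 h1.symm)
  have h3 := eq_zero_of_diffOp_eq_zero hA0 h₀ h₁ hf₀ hd₀ hW hdW (ofFn_degree_lt x) h2
  refine hx ?_
  have := toFn_comp_ofFn_eq_id (n := m) x
  rw [h3, map_zero] at this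
  exact this.symm

theorem prod_pow_dvd_diffOp_sub {ι : Type*} [Fintype ι] [DecidableEq ι] {v : ι → ℂ}
    (hv : Function.Injective v) (k : ι → ℕ) {R : ℂ[X]} (U : ℂ[X])
    (hR : ∀ i, X - C (v i) ∣ R - C (k i : ℂ) * Lagrange.nodal (Finset.univ.erase i) v)
    (a : ι → ℕ) :
    ∏ i, (X - C (v i)) ^ a i ∣
      diffOp (Lagrange.nodal Finset.univ v) R U (∏ i, (X - C (v i)) ^ a i) -
        ∑ i with a i ≠ 0, ((Lagrange.nodal (Finset.univ.erase i) v).eval (v i) * a i *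
          (a i - 1 - k i)) • ∏ j, (X - C (v j)) ^ (a - Pi.single i 1 : ι → ℕ) j := by
  refine Finset.prod_dvd_of_coprime (fun i _ j _ hij => (pairwise_coprime_X_sub_C hv hij).pow)
    fun i _ => ?_
  by_cases hi : a i = 0
  · simp [hi]
  obtain ⟨t, ht⟩ := Nat.exists_eq_succ_of_ne_zero hi
  have h1 : ∏ j, (X - C (v j)) ^ a j =
      (X - C (v i)) ^ (t + 1) * ∏ j ∈ Finset.univ.erase i, (X - C (v j)) ^ a j := by
    rw [← Finset.mul_prod_erase _ _ (Finset.mem_univ i), ht]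
  have h2 : ∏ j, (X - C (v j)) ^ (a - Pi.single i 1 : ι → ℕ) j =
      (X - C (v i)) ^ t * ∏ j ∈ Finset.univ.erase i, (X - C (v j)) ^ a j := by
    rw [← Finset.mul_prod_erase _ _ (Finset.mem_univ i)]
    congr 1
    · simp [ht]
    · refine Finset.prod_congr rfl fun j hj => ?_
      simp [Finset.ne_of_mem_erase hj]
  have h3 := pow_dvd_diffOp_sub (t := t) (U := U)
    (Lagrange.nodal_eq_mul_nodal_erase (v := v) (Finset.mem_univ i)) (hR i)
    (∏ j ∈ Finset.univ.erase i, (X - C (v j)) ^ a j)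
  rw [← Finset.add_sum_erase _ _ (Finset.mem_filter.2 ⟨Finset.mem_univ i, hi⟩), ← sub_sub]
  refine dvd_sub ?_ (Finset.dvd_sum fun j hj => ?_)
  · rw [h1, h2, ht]
    convert h3 using 3
    push_cast
    ring
  · rw [smul_eq_C_mul]
    refine Dvd.dvd.mul_left ?_ _
    have hij : i ≠ j := (Finset.ne_of_mem_erase hj).symm
    convert Finset.dvd_prod_of_mem (fun l => (X - C (v l)) ^ (a - Pi.single j 1 : ι → ℕ) l)
      (Finset.mem_univ i) using 2
    simp [hij]

theorem X_sub_C_dvd_sum_nodal_erase_sub {ι : Type*} [Fintype ι] [DecidableEq ι] (v k : ι → ℂ)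
    (i : ι) : X - C (v i) ∣ (∑ j, C (k j) * Lagrange.nodal (Finset.univ.erase j) v) -
      C (k i) * Lagrange.nodal (Finset.univ.erase i) v := by
  rw [← Finset.add_sum_erase _ _ (Finset.mem_univ i), add_sub_cancel_left]
  refine Finset.dvd_sum fun j hj => Dvd.dvd.mul_left ?_ _
  exact Finset.dvd_prod_of_mem (fun l => X - C (v l))
    (Finset.mem_erase.2 ⟨(Finset.ne_of_mem_erase hj).symm, Finset.mem_univ i⟩)

theorem natDegree_sum_nodal_erase_le {ι : Type*} [Fintype ι] [DecidableEq ι] (v k : ι → ℂ) :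
    (∑ j, C (k j) * Lagrange.nodal (Finset.univ.erase j) v).natDegree ≤ Fintype.card ι - 1 := by
  refine natDegree_sum_le_of_forall_le _ _ fun j _ => (natDegree_C_mul_le _ _).trans ?_
  rw [Lagrange.natDegree_nodal, Finset.card_erase_of_mem (Finset.mem_univ j), Finset.card_univ]

theorem im_eval_eq_zero_of_diffOp_eq_zero {ι : Type*} [Fintype ι] [DecidableEq ι] [Nonempty ι]
    {z : ι → ℝ} {v : ι → ℂ} (hv : ∀ i, v i = z i) (hz : Function.Injective z) {k : ι → ℕ}
    {A R U f₀ f₁ : ℂ[X]}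
    (hA : A = Lagrange.nodal Finset.univ v)
    (hR : R = ∑ i, C (k i : ℂ) * Lagrange.nodal (Finset.univ.erase i) v)
    {m : ℕ} (hcop : IsCoprime f₁ f₀) (h₀ : diffOp A R U f₀ = 0) (h₁ : diffOp A R U f₁ = 0)
    (hf₀ : f₀.Monic) (hd₀ : f₀.natDegree = m + 1) (hW : wronskian f₀ f₁ ≠ 0)
    (hdW : (wronskian f₀ f₁).natDegree = 2 * (m + 1))
    (hU : U.natDegree ≤ Fintype.card ι - 1) {u : ℝ} (hu : ∀ i, u ≠ z i) :
    (U.eval (u : ℂ)).im = 0 := by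
  have hvinj : Function.Injective v := fun i j h => hz (by
    rw [hv, hv] at h; exact_mod_cast h)
  have hcard : 0 < Fintype.card ι := Fintype.card_pos
  have hA0 : A ≠ 0 := hA ▸ Lagrange.nodal_ne_zero
  have hAd : A.natDegree ≤ Fintype.card ι := by
    rw [hA, Lagrange.natDegree_nodal, Finset.card_univ]
  have hRd : R.natDegree ≤ Fintype.card ι - 1 := hR ▸ natDegree_sum_nodal_erase_le v _
  have hRdvd : ∀ i, X - C (v i) ∣ R - C (k i : ℂ) * Lagrange.nodal (Finset.univ.erase i) v :=
    fun i => hR ▸ X_sub_C_dvd_sum_nodal_erase_sub v _ i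
  have hAi : ∀ i, A = (X - C (v i)) * Lagrange.nodal (Finset.univ.erase i) v := fun i => by
    rw [hA, Lagrange.nodal_eq_mul_nodal_erase (Finset.mem_univ i)]
  set ω : ι → ℝ := fun i => (Lagrange.nodal (Finset.univ.erase i) z).eval (z i) with hω
  have hωv : ∀ i, (Lagrange.nodal (Finset.univ.erase i) v).eval (v i) = ω i := fun i => by
    simp [hω, Lagrange.eval_nodal, hv]
  have hω0 : ∀ i, ω i ≠ 0 := fun i => by
    rw [hω]
    simp only [Lagrange.eval_nodal]
    exact Finset.prod_ne_zero_iff.2 fun j hj =>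
      sub_ne_zero.2 fun h => Finset.ne_of_mem_erase hj (hz h).symm
  have huv : ∀ i, (u : ℂ) - v i ≠ 0 := fun i => by
    rw [hv, sub_ne_zero]; exact_mod_cast hu i
  set q : (ι → ℕ) → ℂ[X] := fun a => ∏ i, (X - C (v i)) ^ a i with hq
  have hqm : ∀ a, (q a).Monic := fun a =>
    monic_prod_of_monic _ _ fun i _ => (monic_X_sub_C _).pow _
  have hqd : ∀ a, (q a).natDegree = ∑ i, a i := fun a => by
    rw [hq, natDegree_prod_of_monic _ _ fun i _ => (monic_X_sub_C _).pow _]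
    simp
  have hqu : ∀ a, (q a).eval (u : ℂ) ≠ 0 := fun a => by
    simp only [hq, eval_prod, eval_pow, eval_sub, eval_X, eval_C]
    exact Finset.prod_ne_zero_iff.2 fun i _ => pow_ne_zero _ (huv i)
  have hqs : ∀ a i, q (a + Pi.single i 1) = (X - C (v i)) * q a := prod_pow_add_single v
  have hsub : ∀ (a : ι → ℕ) i, a i ≠ 0 → a - Pi.single i 1 + (Pi.single i 1 : ι → ℕ) = a := by
    intro a i hi
    refine tsub_add_cancel_of_le fun j => ?_
    rcases eq_or_ne j i with rfl | hj
    · simpa [Nat.one_le_iff_ne_zero] using hi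
    · simp [hj]
  have hsubsum : ∀ (a : ι → ℕ) i, ∑ j, a j = m + 1 → a i ≠ 0 →
      ∑ j, (a - Pi.single i 1 : ι → ℕ) j = m := by
    intro a i ha hi
    have := hsub a i hi
    rw [← this] at ha
    simp only [Pi.add_apply, Finset.sum_add_distrib] at ha
    simpa using ha
  choose g Q hgd hgQ hgu using fun a => exists_cramer_modMatrix (diffOp A R U) (hqm a) (hqd a)
  have hQd : ∀ a, (Q a).degree < Fintype.card ι := by
    intro a
    by_cases hQ0 : Q a = 0
    · rw [hQ0, degree_zero]; exact WithBot.bot_lt_coe _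
    have h1 := degree_diffOp_lt hcard hAd hRd hU (hgd a)
    rw [hgQ, ← natDegree_lt_iff_degree_lt (mul_ne_zero (hqm a).ne_zero hQ0),
      natDegree_mul (hqm a).ne_zero hQ0, hqd] at h1
    rw [← natDegree_lt_iff_degree_lt hQ0]
    omega
  set p : (ι → ℕ) → ℂ := fun a => (modMatrix (diffOp A R U) (m + 1) (q a)).det with hp
  have hpQ : ∀ a i, ∑ j, a j = m → p (a + Pi.single i 1) = (Q a).eval (v i) := by
    intro a i ha
    rw [← (hgu a (v i)).1, ha, ← hqs]
  have hreal : ∀ a, ∃ r : ℝ,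
      (diffOp A R U (q a)).eval (u : ℂ) = (q a).eval (u : ℂ) * (U.eval (u : ℂ) + r) := by
    intro a
    set q' : ℝ[X] := ∏ i, (X - C (z i)) ^ a i with hq'
    have hqq : q a = q'.map (algebraMap ℝ ℂ) := by
      simp [hq, hq', Polynomial.map_prod, hv]
    have hnod : ∀ s : Finset ι, Lagrange.nodal s v = (Lagrange.nodal s z).map (algebraMap ℝ ℂ) :=
      fun s => by simp [Lagrange.nodal, Polynomial.map_prod, hv]
    set T : ℝ[X] := Lagrange.nodal Finset.univ z * derivative (derivative q') -
      (∑ i, C (k i : ℝ) * Lagrange.nodal (Finset.univ.erase i) z) * derivative q' with hT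
    have hTT : A * derivative (derivative (q a)) - R * derivative (q a) =
        T.map (algebraMap ℝ ℂ) := by
      rw [hA, hR, hT, hqq]
      simp only [hnod, Polynomial.map_sub, Polynomial.map_mul, derivative_map,
        Polynomial.map_sum, map_natCast, Polynomial.map_natCast]
    have hev : ∀ P : ℝ[X], (P.map (algebraMap ℝ ℂ)).eval (u : ℂ) = (P.eval u : ℝ) := fun P => by
      rw [eval_map_algebraMap]
      exact (aeval_algebraMap_apply ℂ u P).trans (by simp)
    refine ⟨T.eval u / q'.eval u, ?_⟩
    have h1 := hqu a
    rw [diffOp_apply, hTT, eval_add, eval_mul, hev, hqq, hev, mul_add]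
    rw [hqq, hev] at h1
    push_cast
    field_simp
    ring
  choose r hr using hreal
  refine im_eq_zero_of_sum_eq (k := k) (y := fun i => (u - z i)⁻¹) hω0 (p := p)
    (Q := fun a => (Q a).eval (u : ℂ)) (r := r)
    (c := ((Lagrange.nodal Finset.univ z).eval u)⁻¹) (m := m) ?_ ?_ ?_ ?_
  · intro a ha i hi
    have hωi : (Lagrange.nodal (Finset.univ.erase i) v).eval (v i) ≠ 0 := by
      rw [hωv]; exact_mod_cast hω0 i
    have hdvd : (X - C (v i)) ^ (k i + 1) ∣ q a :=
      (pow_dvd_pow _ hi).trans (Finset.dvd_prod_of_mem (fun j => (X - C (v j)) ^ a j)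
        (Finset.mem_univ i))
    by_cases h : f₀.eval (v i) = 0
    · have h' : f₁.eval (v i) ≠ 0 := fun h' => by
        obtain ⟨β, α, hβ⟩ := hcop
        have := congrArg (eval (v i)) hβ
        simp [h, h'] at this
      exact det_modMatrix_diffOp_eq_zero_of_pow_dvd h₁ h' (hAi i) hωi (hRdvd i) (hqm a)
        ((hqd a).trans ha) hdvd
    · exact det_modMatrix_diffOp_eq_zero_of_pow_dvd h₀ h (hAi i) hωi (hRdvd i) (hqm a)
        ((hqd a).trans ha) hdvd
  · exact exists_det_modMatrix_diffOp_ne_zero hvinj hA0 hAd hRd hU h₀ h₁ hf₀.ne_zero hd₀ hW hdW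
  · intro a ha
    have h1 := prod_pow_dvd_diffOp_sub hvinj k U hRdvd a
    rw [← hA] at h1
    have h2 := det_modMatrix_smul (diffOp A R U) (hqm a) ((hqd a).trans ha) hf₀ hd₀ h₀ _ _ _
      (fun i hi => by
        rw [← natDegree_lt_iff_degree_lt (hqm _).ne_zero]
        rw [hqd, hsubsum a i ha (Finset.mem_filter.1 hi).2]
        exact Nat.lt_succ_self m) h1
    have h3 := congrArg (eval (u : ℂ)) h2
    rw [eval_smul, hr, eval_finsetSum] at h3
    refine mul_left_cancel₀ (hqu a) ?_
    rw [Finset.mul_sum]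
    refine (Eq.trans ?_ h3).trans (Finset.sum_congr rfl fun i hi => ?_)
    · rw [smul_eq_mul]; ring
    · have hi' := (Finset.mem_filter.1 hi).2
      have hs := hsubsum a i ha hi'
      have h4 := (hgu (a - Pi.single i 1) (v i)).2
      rw [hs, ← hqs, hsub a i hi'] at h4
      change eval (u : ℂ) ((_ : ℂ) • diffOp A R U (ofFn (m + 1)
        (Matrix.cramer (modMatrix (diffOp A R U) (m + 1) (q a))
          (toFn (m + 1) (q (a - Pi.single i 1)))))) = _
      rw [h4, hgQ, eval_smul, eval_mul, hωv, smul_eq_mul]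
      have h5 := congrArg (eval (u : ℂ)) (hqs (a - Pi.single i 1) i)
      rw [hsub a i hi', eval_mul, eval_sub, eval_X, eval_C] at h5
      rw [h5]
      have h6 := huv i
      rw [hv] at h6 ⊢
      push_cast
      field_simp
  · intro a ha
    have hint := Lagrange.eq_interpolate (s := Finset.univ) (v := v) hvinj.injOn
      (f := Q a) (by rw [Finset.card_univ]; exact hQd a)
    have h1 := congrArg (eval (u : ℂ)) hint
    rw [Lagrange.eval_interpolate_not_at_node _ fun i _ => sub_ne_zero.1 (huv i)] at h1
    have hAu : (Lagrange.nodal Finset.univ v).eval (u : ℂ) =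
        ((Lagrange.nodal Finset.univ z).eval u : ℝ) := by
      simp [Lagrange.eval_nodal, hv]
    have hne : (Lagrange.nodal Finset.univ v).eval (u : ℂ) ≠ 0 := by
      rw [Lagrange.eval_nodal]
      exact Finset.prod_ne_zero_iff.2 fun i _ => huv i
    simp only [Complex.ofReal_inv, ← hAu]
    rw [← div_eq_mul_inv, div_eq_iff hne]
    conv_lhs => rw [h1, mul_comm]
    congr 1
    refine Finset.sum_congr rfl fun i _ => ?_
    rw [Lagrange.nodalWeight_eq_eval_derivative_nodal (Finset.mem_univ i),
      Lagrange.eval_nodal_derivative_eval_node_eq (Finset.mem_univ i), hωv, hpQ a i ha, hv]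
    push_cast
    ring

theorem prod_pow_mul_sum_nodal_erase {ι : Type*} [Fintype ι] [DecidableEq ι] (v : ι → ℂ)
    (k : ι → ℕ) :
    (∏ i, (X - C (v i)) ^ k i) * ∑ i, C (k i : ℂ) * Lagrange.nodal (Finset.univ.erase i) v =
      Lagrange.nodal Finset.univ v * derivative (∏ i, (X - C (v i)) ^ k i) := by
  rw [derivative_prod_finset, Finset.mul_sum, Finset.mul_sum]
  refine Finset.sum_congr rfl fun i hi => ?_
  rw [← Finset.mul_prod_erase _ _ hi, Lagrange.nodal_eq_mul_nodal_erase hi,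
    derivative_X_sub_C_pow]
  rcases hk : k i with _ | t
  · simp
  · rw [Nat.add_sub_cancel, pow_succ]
    ring

theorem monic_wronskian {f₀ f₁ : ℂ[X]} {m : ℕ} (hf₀ : f₀.Monic) (hf₁ : f₁.Monic)
    (hd₀ : f₀.natDegree = m) (hd₁ : f₁.natDegree = m + 1) :
    (wronskian f₀ f₁).Monic ∧ (wronskian f₀ f₁).natDegree = 2 * m := by
  have hle : (wronskian f₀ f₁).natDegree ≤ 2 * m := by
    by_cases h0 : wronskian f₀ f₁ = 0
    · simp [h0]
    have := natDegree_wronskian_lt_add h0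
    omega
  have hc : (wronskian f₀ f₁).coeff (2 * m) = 1 := by
    have h0 : f₀.coeff m = 1 := hd₀ ▸ hf₀.coeff_natDegree
    have h1 : f₁.coeff (m + 1) = 1 := hd₁ ▸ hf₁.coeff_natDegree
    have e₁ : (f₀ * derivative f₁).coeff (2 * m) = m + 1 := by
      rw [two_mul, coeff_mul_add_eq_of_natDegree_le hd₀.le
        ((natDegree_derivative_le f₁).trans (by omega)), coeff_derivative, h0, h1]
      simp
    have e₂ : (derivative f₀ * f₁).coeff (2 * m) = m := by
      rcases m with _ | m
      · rw [eq_one_of_monic_natDegree_zero hf₀ hd₀]; simp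
      · rw [show 2 * (m + 1) = m + (m + 1 + 1) by ring, coeff_mul_add_eq_of_natDegree_le
          ((natDegree_derivative_le f₀).trans (by omega)) hd₁.le, coeff_derivative, h0, h1]
        simp
    rw [wronskian, coeff_sub, e₁, e₂]
    ring
  exact ⟨monic_of_natDegree_le_of_coeff_eq_one _ hle hc,
    natDegree_eq_of_le_of_coeff_ne_zero hle (by rw [hc]; exact one_ne_zero)⟩

theorem exists_pencil_basis_natDegree_lt {f₁ f₀ : ℂ[X]} (h : LinearIndependent ℂ ![f₀, f₁]) :
    ∃ a b c e : ℂ, a * e - b * c ≠ 0 ∧ C c * f₁ + C e * f₀ ≠ 0 ∧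
      (C c * f₁ + C e * f₀).natDegree < (C a * f₁ + C b * f₀).natDegree := by
  rw [LinearIndependent.pair_iff] at h
  have h0 : f₀ ≠ 0 := fun h0 => one_ne_zero (h 1 0 (by simp [h0])).1
  have h1 : f₁ ≠ 0 := fun h1 => one_ne_zero (h 0 1 (by simp [h1])).2
  rcases lt_trichotomy f₀.natDegree f₁.natDegree with hlt | heq | hlt
  · exact ⟨1, 0, 0, 1, by simp, by simpa, by simpa⟩
  · have hne : f₁ - C (f₁.leadingCoeff / f₀.leadingCoeff) * f₀ ≠ 0 := fun h2 =>
      one_ne_zero (h (-(f₁.leadingCoeff / f₀.leadingCoeff)) 1 (by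
        rw [smul_eq_C_mul, smul_eq_C_mul, C_neg, C_1]; linear_combination h2)).2
    refine ⟨0, 1, 1, -(f₁.leadingCoeff / f₀.leadingCoeff), by simp, ?_, ?_⟩
    · simpa [sub_eq_add_neg] using hne
    · have hl : f₀.leadingCoeff ≠ 0 := leadingCoeff_ne_zero.2 h0
      have hcne : f₁.leadingCoeff / f₀.leadingCoeff ≠ 0 :=
        div_ne_zero (leadingCoeff_ne_zero.2 h1) hl
      have hdeg := degree_sub_lt_left (p := f₁)
        (q := C (f₁.leadingCoeff / f₀.leadingCoeff) * f₀)
        (by rw [degree_C_mul hcne, degree_eq_natDegree h0, degree_eq_natDegree h1, heq]) h1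
        (by rw [leadingCoeff_mul, leadingCoeff_C, div_mul_cancel₀ _ hl])
      have := natDegree_lt_natDegree hne hdeg
      rw [← heq] at this
      simpa [sub_eq_add_neg] using this
  · exact ⟨0, 1, 1, 0, by simp, by simpa, by simpa⟩

theorem exists_monic_sub_coeff_eq_zero {g₁ g₀ : ℂ[X]} (hne : g₀ ≠ 0)
    (hlt : g₀.natDegree < g₁.natDegree) :
    ∃ s t r : ℂ, s ≠ 0 ∧ t ≠ 0 ∧ (C s * g₁ - C r * (C t * g₀)).Monic ∧ (C t * g₀).Monic ∧
      (C t * g₀).natDegree < (C s * g₁ - C r * (C t * g₀)).natDegree ∧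
      (C s * g₁ - C r * (C t * g₀)).coeff (C t * g₀).natDegree = 0 := by
  have hne₁ : g₁ ≠ 0 := fun h1 => by rw [h1, natDegree_zero] at hlt; omega
  have hs0 : g₁.leadingCoeff⁻¹ ≠ 0 := inv_ne_zero (leadingCoeff_ne_zero.2 hne₁)
  have ht0 : g₀.leadingCoeff⁻¹ ≠ 0 := inv_ne_zero (leadingCoeff_ne_zero.2 hne)
  have hm₀ : (C g₀.leadingCoeff⁻¹ * g₀).Monic := by
    rw [mul_comm]; exact monic_mul_leadingCoeff_inv hne
  have hm₁ : (C g₁.leadingCoeff⁻¹ * g₁).Monic := by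
    rw [mul_comm]; exact monic_mul_leadingCoeff_inv hne₁
  have hn₀ : (C g₀.leadingCoeff⁻¹ * g₀).natDegree = g₀.natDegree := natDegree_C_mul ht0
  have hn₁ : (C g₁.leadingCoeff⁻¹ * g₁).natDegree = g₁.natDegree := natDegree_C_mul hs0
  refine ⟨g₁.leadingCoeff⁻¹, g₀.leadingCoeff⁻¹,
    (C g₁.leadingCoeff⁻¹ * g₁).coeff g₀.natDegree, hs0, ht0, ?_⟩
  generalize C g₁.leadingCoeff⁻¹ * g₁ = p₁ at *
  generalize C g₀.leadingCoeff⁻¹ * g₀ = p₀ at *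
  rw [← hn₀, ← hn₁] at hlt
  rw [← hn₀]
  have hlt' : (C (p₁.coeff p₀.natDegree) * p₀).natDegree < p₁.natDegree :=
    (natDegree_C_mul_le _ _).trans_lt hlt
  refine ⟨hm₁.sub_of_left (degree_lt_degree hlt'), hm₀, ?_, ?_⟩
  · rwa [natDegree_sub_eq_left_of_natDegree_lt hlt']
  · rw [coeff_sub, coeff_C_mul, hm₀.coeff_natDegree, mul_one, sub_self]

theorem exists_monic_pencil_basis {f₁ f₀ : ℂ[X]} (h : LinearIndependent ℂ ![f₀, f₁]) :
    ∃ a b c e : ℂ, a * e - b * c ≠ 0 ∧ (C a * f₁ + C b * f₀).Monic ∧ (C c * f₁ + C e * f₀).Monic ∧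
      (C c * f₁ + C e * f₀).natDegree < (C a * f₁ + C b * f₀).natDegree ∧
      (C a * f₁ + C b * f₀).coeff (C c * f₁ + C e * f₀).natDegree = 0 := by
  obtain ⟨a, b, c, e, hdet, hne, hlt⟩ := exists_pencil_basis_natDegree_lt h
  obtain ⟨s, t, r, hs, ht, hrest⟩ := exists_monic_sub_coeff_eq_zero hne hlt
  refine ⟨s * a - r * t * c, s * b - r * t * e, t * c, t * e, ?_, ?_⟩
  · have : (s * a - r * t * c) * (t * e) - (s * b - r * t * e) * (t * c) =
        s * t * (a * e - b * c) := by ring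
    rw [this]
    exact mul_ne_zero (mul_ne_zero hs ht) hdet
  · have e₁ : C (s * a - r * t * c) * f₁ + C (s * b - r * t * e) * f₀ =
        C s * (C a * f₁ + C b * f₀) - C r * (C t * (C c * f₁ + C e * f₀)) := by
      simp only [C_sub, C_mul]; ring
    have e₀ : C (t * c) * f₁ + C (t * e) * f₀ = C t * (C c * f₁ + C e * f₀) := by
      simp only [C_mul]; ring
    rwa [e₁, e₀]

theorem exists_eq_map_of_map_conj_eq {f : ℂ[X]} (hf : f.map (starRingEnd ℂ) = f) :
    ∃ g : ℝ[X], f = g.map (algebraMap ℝ ℂ) := by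
  obtain ⟨g, hg⟩ := (mem_lifts f).1 ((lifts_iff_coeff_lifts (f := algebraMap ℝ ℂ) f).2 fun n => by
    have h1 := congrArg (fun p => coeff p n) hf
    simp only [coeff_map] at h1
    exact ⟨(f.coeff n).re, Complex.conj_eq_iff_re.1 h1⟩)
  exact ⟨g, hg.symm⟩

theorem map_conj_eq_of_forall_im_eq_zero {f : ℂ[X]} {S : Set ℝ} (hS : S.Finite)
    (h : ∀ u : ℝ, u ∉ S → (f.eval (u : ℂ)).im = 0) : f.map (starRingEnd ℂ) = f := by
  refine eq_of_infinite_eval_eq _ _ (Set.Infinite.mono ?_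
    (hS.infinite_compl.image Complex.ofReal_injective.injOn))
  rintro _ ⟨u, hu, rfl⟩
  have h1 := eval_map_apply (p := f) (f := starRingEnd ℂ) (u : ℂ)
  rw [Complex.conj_ofReal] at h1
  rw [Set.mem_ofPred_eq, h1]
  exact Complex.conj_eq_iff_im.2 (h u hu)

theorem map_conj_eq_of_wronskian_roots_real {f₀ f₁ : ℂ[X]} {m : ℕ} (hcop : IsCoprime f₁ f₀)
    (hf₀ : f₀.Monic) (hf₁ : f₁.Monic) (hd₀ : f₀.natDegree = m) (hd₁ : f₁.natDegree = m + 1)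
    (hc : f₁.coeff m = 0)
    (hroot : ∀ w : ℂ, (wronskian f₀ f₁).eval w = 0 → ∃ x : ℝ, w = x) :
    f₀.map (starRingEnd ℂ) = f₀ ∧ f₁.map (starRingEnd ℂ) = f₁ := by
  classical
  rcases m with _ | m
  · have h1 := eq_X_add_C_of_natDegree_le_one hd₁.le
    have h2 : f₁.coeff 1 = 1 := by simpa [hd₁] using hf₁.coeff_natDegree
    rw [h2, hc] at h1
    rw [eq_one_of_monic_natDegree_zero hf₀ hd₀, h1]
    simp
  obtain ⟨hWm, hdW⟩ := monic_wronskian hf₀ hf₁ hd₀ hd₁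
  set W := wronskian f₀ f₁ with hWdef
  set ι := {x // x ∈ W.roots.toFinset} with hι
  set v : ι → ℂ := fun i => i.1 with hv
  have hvreal : ∀ i, ∃ x : ℝ, v i = x := fun i =>
    hroot _ (mem_roots'.1 (Multiset.mem_toFinset.1 i.2)).2
  choose z hz using hvreal
  have hzinj : Function.Injective z := fun i j h => Subtype.ext (by
    change v i = v j
    rw [hz, hz, h])
  set k : ι → ℕ := fun i => W.roots.count i.1 with hk
  have hWprod : W = ∏ i, (X - C (v i)) ^ k i := by
    conv_lhs => rw [(IsAlgClosed.splits W).eq_prod_roots_of_monic hWm]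
    rw [Finset.prod_multiset_map_count, ← Finset.prod_coe_sort]
  have hne : Nonempty ι := by
    obtain ⟨w, hw⟩ := IsAlgClosed.exists_root W fun h => by
      have h' : W.natDegree = 0 := natDegree_eq_of_degree_eq_some h
      omega
    exact ⟨⟨w, Multiset.mem_toFinset.2 (mem_roots'.2 ⟨hWm.ne_zero, hw⟩)⟩⟩
  have hcard : 0 < Fintype.card ι := Fintype.card_pos
  set A := Lagrange.nodal Finset.univ v with hA
  set R := ∑ i, C (k i : ℂ) * Lagrange.nodal (Finset.univ.erase i) v with hR
  have hA0 : A ≠ 0 := Lagrange.nodal_ne_zero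
  obtain ⟨U, h₀, h₁⟩ := exists_diffOp_eq_zero hcop hWm.ne_zero (A := A) (R := R) (by
    rw [← hWdef, hWprod, hR, hA, prod_pow_mul_sum_nodal_erase])
  have hU : U.natDegree ≤ Fintype.card ι - 1 := by
    by_cases hU0 : U = 0
    · simp [hU0]
    have h2 : U * f₀ = -(A * derivative (derivative f₀) - R * derivative f₀) := by
      rw [diffOp_apply] at h₀; linear_combination h₀
    have h3 := natDegree_mul_sub_mul_derivative_le hcard (A := A) (R := R)
      (by rw [hA, Lagrange.natDegree_nodal, Finset.card_univ])
      (natDegree_sum_nodal_erase_le v _) f₀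
    rw [← natDegree_neg, ← h2, natDegree_mul hU0 hf₀.ne_zero, hd₀] at h3
    omega
  have hUreal : U.map (starRingEnd ℂ) = U :=
    map_conj_eq_of_forall_im_eq_zero (Set.finite_range z) fun u hu =>
      im_eval_eq_zero_of_diffOp_eq_zero hz hzinj hA hR hcop h₀ h₁ hf₀ hd₀ hWm.ne_zero hdW hU
        fun i hi => hu ⟨i, hi.symm⟩
  have hnod : ∀ s : Finset ι, (Lagrange.nodal s v).map (starRingEnd ℂ) = Lagrange.nodal s v :=
    fun s => by simp [Lagrange.nodal, Polynomial.map_prod, hz]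
  have hAreal : A.map (starRingEnd ℂ) = A := hnod _
  have hRreal : R.map (starRingEnd ℂ) = R := by
    simp [hR, Polynomial.map_sum, hnod]
  have hD : ∀ g, diffOp A R U g = 0 → diffOp A R U (g.map (starRingEnd ℂ) - g) = 0 := by
    intro g hg
    have h2 := congrArg (Polynomial.map (starRingEnd ℂ)) hg
    rw [diffOp_apply] at h2
    simp only [Polynomial.map_add, Polynomial.map_sub, Polynomial.map_mul, hAreal, hRreal,
      hUreal, ← derivative_map, Polynomial.map_zero] at h2
    rw [map_sub, hg, sub_zero, diffOp_apply, h2]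
  have hker : ∀ g, diffOp A R U g = 0 →
      (g.map (starRingEnd ℂ) - g).degree < (m + 1 : ℕ) → g.map (starRingEnd ℂ) = g :=
    fun g hg hdeg => sub_eq_zero.1
      (eq_zero_of_diffOp_eq_zero hA0 h₀ h₁ hf₀.ne_zero hd₀ hWm.ne_zero hdW hdeg (hD g hg))
  refine ⟨hker _ h₀ ((degree_lt_iff_coeff_zero _ _).2 fun n hn => ?_),
    hker _ h₁ ((degree_lt_iff_coeff_zero _ _).2 fun n hn => ?_)⟩
  · rw [coeff_sub, coeff_map]
    rcases hn.eq_or_lt with rfl | hn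
    · have : f₀.coeff (m + 1) = 1 := hd₀ ▸ hf₀.coeff_natDegree
      simp [this]
    · simp [coeff_eq_zero_of_natDegree_lt (hd₀.trans_lt hn)]
  · rw [coeff_sub, coeff_map]
    rcases hn.eq_or_lt with rfl | hn
    · simp [hc]
    rcases (Nat.succ_le_of_lt hn).eq_or_lt with rfl | hn
    · have : f₁.coeff (m + 1 + 1) = 1 := hd₁ ▸ hf₁.coeff_natDegree
      simp [this]
    · simp [coeff_eq_zero_of_natDegree_lt (hd₁.trans_lt hn)]

/-- **Theorem 1.** If all critical points of a nonconstant rational function `f = f₁/f₀`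
(all points of the Riemann sphere where `f` fails to be locally injective) are real, then
`f` is equivalent to a real rational function: there is a fractional-linear transformation
`ℓ(w) = (aw+b)/(cw+e)`, `ae − bc ≠ 0`, such that `ℓ∘f = (a f₁ + b f₀)/(c f₁ + e f₀)` is a
ratio of two polynomials with real coefficients. -/
theorem real_critical_points_implies_equiv_real
    (f₁ f₀ : ℂ[X]) (hcop : IsCoprime f₁ f₀)
    (hnonconst : LinearIndependent ℂ ![f₀, f₁])
    (hcrit : ∀ p : OnePoint ℂ, IsCritPt (ratExt f₁ f₀) p →
      ∃ x : ℝ, p = ((x : ℂ) : OnePoint ℂ)) :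
    ∃ a b c e : ℂ, a * e - b * c ≠ 0 ∧
      (∃ g₁ : ℝ[X], a • f₁ + b • f₀ = g₁.map (algebraMap ℝ ℂ)) ∧
      (∃ g₀ : ℝ[X], c • f₁ + e • f₀ = g₀.map (algebraMap ℝ ℂ)) := by
  obtain ⟨a, b, c, e, hdet, hm₁, hm₀, hlt, hcoeff⟩ := exists_monic_pencil_basis hnonconst
  have hdC : C (a * e - b * c) * C (a * e - b * c)⁻¹ = 1 := by
    rw [← C_mul, mul_inv_cancel₀ hdet, C_1]
  have hcop' : IsCoprime (C a * f₁ + C b * f₀) (C c * f₁ + C e * f₀) := by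
    obtain ⟨β, α, h⟩ := hcop
    refine ⟨C (a * e - b * c)⁻¹ * (β * C e - α * C c),
      C (a * e - b * c)⁻¹ * (α * C a - β * C b), ?_⟩
    simp only [C_sub, C_mul] at hdC
    linear_combination h + (β * f₁ + α * f₀) * hdC
  have hW : wronskian (C c * f₁ + C e * f₀) (C a * f₁ + C b * f₀) =
      C (a * e - b * c) * wronskian f₀ f₁ := by
    simp only [wronskian, derivative_add, derivative_C_mul, C_sub, C_mul]
    ring
  have hd : (C a * f₁ + C b * f₀).natDegree = (C c * f₁ + C e * f₀).natDegree + 1 := by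
    by_contra hd
    obtain ⟨x, hx⟩ := hcrit ∞ (isCritPt_infty_of_natDegree hcop hdet rfl rfl hm₁.ne_zero
      (by omega))
    exact OnePoint.infty_ne_coe _ hx
  obtain ⟨h₀, h₁⟩ := map_conj_eq_of_wronskian_roots_real hcop' hm₀ hm₁ rfl hd hcoeff
    fun w hw => by
      rw [hW, eval_mul, eval_C] at hw
      obtain ⟨x, hx⟩ := hcrit w (isCritPt_coe_of_wronskian_eval_eq_zero hcop
        ((mul_eq_zero.1 hw).resolve_left hdet))
      exact ⟨x, OnePoint.coe_injective hx⟩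
  refine ⟨a, b, c, e, hdet, ?_, ?_⟩
  · simp only [smul_eq_C_mul]
    exact exists_eq_map_of_map_conj_eq h₁
  · simp only [smul_eq_C_mul]
    exact exists_eq_map_of_map_conj_eq h₀
end

section
/- Let f₀ and f₁ be linearly independent complex polynomials such that every complex root of the Wronskian W(f₀,f₁) = f₀·f₁′ − f₀′·f₁ is real. Then the pair (f₀, f₁) can be made real by an invertible linear transformation with constant coefficients: there exist a,b,c,d ∈ ℂ with ad−bc ≠ 0 such that both a·f₀ + b·f₁ and c·f₀ + d·f₁ are polynomials with real coefficients. -/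
section JointEigenvectors

variable {V : Type*} [AddCommGroup V] [Module ℂ V] {ι : Type*}

/-- A commuting family of operators preserving a nonzero finite-dimensional complex subspace
has a joint eigenvector there. -/
lemma exists_joint_eigenvector [Fintype ι] {T : ι → Module.End ℂ V}
    (hT : ∀ i j, Commute (T i) (T j)) {I : Submodule ℂ V} [FiniteDimensional ℂ I]
    (hI : ∀ i, ∀ v ∈ I, T i v ∈ I) (hne : I ≠ ⊥) :
    ∃ v ∈ I, v ≠ 0 ∧ ∃ μ : ι → ℂ, ∀ i, T i v = μ i • v := by
  classical
  have key : ∀ s : Finset ι, ∃ J ≤ I, J ≠ ⊥ ∧ (∀ i, ∀ v ∈ J, T i v ∈ J) ∧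
      ∀ i ∈ s, ∃ μ : ℂ, ∀ v ∈ J, T i v = μ • v := by
    intro s
    induction s using Finset.induction_on with
    | empty => exact ⟨I, le_rfl, hne, hI, by simp⟩
    | insert i s _ ih =>
      obtain ⟨J, hJI, hJne, hJT, hJs⟩ := ih
      have : FiniteDimensional ℂ J := Submodule.finiteDimensional_of_le hJI
      have : Nontrivial J := Submodule.nontrivial_iff_ne_bot.mpr hJne
      obtain ⟨μ, hμ⟩ := Module.End.exists_eigenvalue ((T i).restrict (hJT i))
      obtain ⟨w, hw⟩ := hμ.exists_hasEigenvector
      have hw1 : T i w = μ • (w : V) := by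
        simpa using congrArg Subtype.val hw.apply_eq_smul
      refine ⟨J ⊓ LinearMap.ker (T i - algebraMap ℂ _ μ), inf_le_left.trans hJI, ?_, ?_, ?_⟩
      · refine (Submodule.ne_bot_iff _).mpr ⟨w, ⟨w.2, ?_⟩, ?_⟩
        · simp [hw1]
        · simpa using hw.2
      · rintro j v ⟨hv, hv'⟩
        refine ⟨hJT j v hv, ?_⟩
        have h1 : T i v = μ • v := by simpa [sub_eq_zero] using hv'
        have h2 : T i (T j v) = T j (T i v) := LinearMap.congr_fun (hT i j).eq v
        simp [h2, h1]
      · intro j hj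
        rcases Finset.mem_insert.mp hj with rfl | hj
        · exact ⟨μ, fun v hv => by simpa [sub_eq_zero] using hv.2⟩
        · obtain ⟨ν, hν⟩ := hJs j hj
          exact ⟨ν, fun v hv => hν v hv.1⟩
  obtain ⟨J, hJI, hJne, -, hJ⟩ := key Finset.univ
  obtain ⟨v, hv, hv0⟩ := (Submodule.ne_bot_iff _).mp hJne
  choose μ hμ using fun i => hJ i (Finset.mem_univ i)
  exact ⟨v, hJI hv, hv0, μ, fun i => hμ i v hv⟩

/-- If a finite-dimensional invariant subspace contains no joint eigenvector with the eigenvalues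
of `Ψ`, then it is killed by an element of the generated algebra that fixes `Ψ`. -/
lemma exists_mem_adjoin_annihilator [Fintype ι] {T : ι → Module.End ℂ V}
    (hT : ∀ i j, Commute (T i) (T j)) {Ψ : V} {c : ι → ℂ} (hΨ : ∀ i, T i Ψ = c i • Ψ)
    (I : Submodule ℂ V) [FiniteDimensional ℂ I]
    (hI : ∀ i, ∀ v ∈ I, T i v ∈ I)
    (hno : ∀ v ∈ I, (∀ i, T i v = c i • v) → v = 0) :
    ∃ a ∈ Algebra.adjoin ℂ (Set.range T), a Ψ = Ψ ∧ ∀ v ∈ I, a v = 0 := by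
  induction hn : Module.finrank ℂ I using Nat.strong_induction_on generalizing I with
  | _ n ih =>
  by_cases hne : I = ⊥
  · subst hne
    exact ⟨1, one_mem _, rfl, by simp⟩
  obtain ⟨v, hvI, hv0, μ, hμ⟩ := exists_joint_eigenvector hT hI hne
  obtain ⟨j, hj⟩ : ∃ j, μ j ≠ c j := by
    by_contra! h
    exact hv0 (hno v hvI fun i => by rw [hμ, h])
  have hj' : c j - μ j ≠ 0 := sub_ne_zero.mpr hj.symm
  set b : Module.End ℂ V := (c j - μ j)⁻¹ • (T j - algebraMap ℂ _ (μ j)) with hb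
  have hbapp (u : V) : b u = (c j - μ j)⁻¹ • (T j u - μ j • u) := by simp [hb]
  have hbmem : b ∈ Algebra.adjoin ℂ (Set.range T) :=
    Subalgebra.smul_mem _ (sub_mem (Algebra.subset_adjoin (Set.mem_range_self j))
      (Subalgebra.algebraMap_mem _ _)) _
  have hbI : ∀ u ∈ I, b u ∈ I := fun u hu => by
    rw [hbapp]
    exact I.smul_mem _ (I.sub_mem (hI j u hu) (I.smul_mem _ hu))
  have hbΨ : b Ψ = Ψ := by
    rw [hbapp, hΨ, ← sub_smul, smul_smul, inv_mul_cancel₀ hj', one_smul]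
  have hle : I.map b ≤ I := by
    rintro _ ⟨u, hu, rfl⟩
    exact hbI u hu
  have : FiniteDimensional ℂ (I.map b) := Submodule.finiteDimensional_of_le hle
  have hlt : Module.finrank ℂ (I.map b) < n := by
    have hk := LinearMap.finrank_range_add_finrank_ker (b.domRestrict I)
    rw [LinearMap.range_domRestrict, hn] at hk
    have : 0 < Module.finrank ℂ (LinearMap.ker (b.domRestrict I)) := by
      have : Nontrivial (LinearMap.ker (b.domRestrict I)) := by
        refine Submodule.nontrivial_iff_ne_bot.mpr ((Submodule.ne_bot_iff _).mpr
          ⟨⟨v, hvI⟩, ?_, by simpa using hv0⟩)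
        simp [hbapp, hμ]
      exact Module.finrank_pos
    omega
  obtain ⟨a, ha, haΨ, haI⟩ := ih _ hlt (I.map b)
    (by
      rintro i _ ⟨u, hu, rfl⟩
      refine ⟨T i u, hI i u hu, ?_⟩
      have h2 : T i (T j u) = T j (T i u) := LinearMap.congr_fun (hT i j).eq u
      simp [hbapp, h2])
    (fun u hu => hno u (hle hu)) rfl
  exact ⟨a * b, mul_mem ha hbmem, by simp [hbΨ, haΨ], fun u hu => haI _ ⟨u, hu, rfl⟩⟩

/-- A joint eigenvector of a commuting family lying in a sum of finite-dimensional invariant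
subspaces vanishes as soon as none of the summands has a joint eigenvector with the same
eigenvalues. -/
lemma eq_zero_of_mem_iSup_of_joint_eigenvector [Fintype ι] {T : ι → Module.End ℂ V}
    (hT : ∀ i j, Commute (T i) (T j)) {Ψ : V} {c : ι → ℂ} (hΨ : ∀ i, T i Ψ = c i • Ψ)
    {κ : Type*} [Fintype κ] (I : κ → Submodule ℂ V) [∀ l, FiniteDimensional ℂ (I l)]
    (hI : ∀ l i, ∀ v ∈ I l, T i v ∈ I l)
    (hno : ∀ l, ∀ v ∈ I l, (∀ i, T i v = c i • v) → v = 0)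
    (hmem : Ψ ∈ ⨆ l, I l) : Ψ = 0 := by
  classical
  have hcomm : ∀ a ∈ Algebra.adjoin ℂ (Set.range T), ∀ b ∈ Algebra.adjoin ℂ (Set.range T),
      Commute a b := fun a ha b hb => by
    refine Algebra.commute_of_mem_adjoin_of_forall_mem_commute hb ?_
    rintro _ ⟨i, rfl⟩
    refine (Algebra.commute_of_mem_adjoin_of_forall_mem_commute ha ?_).symm
    rintro _ ⟨j, rfl⟩
    exact hT i j
  have key : ∀ s : Finset κ, ∃ a ∈ Algebra.adjoin ℂ (Set.range T), a Ψ = Ψ ∧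
      ∀ l ∈ s, ∀ v ∈ I l, a v = 0 := by
    intro s
    induction s using Finset.induction_on with
    | empty => exact ⟨1, one_mem _, rfl, by simp⟩
    | insert l s _ ih =>
      obtain ⟨a, ha, haΨ, has⟩ := ih
      obtain ⟨b, hb, hbΨ, hbl⟩ := exists_mem_adjoin_annihilator hT hΨ (I l) (hI l) (hno l)
      refine ⟨a * b, mul_mem ha hb, by simp [haΨ, hbΨ], fun l' hl' v hv => ?_⟩
      rcases Finset.mem_insert.mp hl' with rfl | hl'
      · simp [hbl v hv]
      · rw [(hcomm a ha b hb).eq]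
        simp [has l' hl' v hv]
  obtain ⟨a, -, haΨ, ha⟩ := key Finset.univ
  have : ⨆ l, I l ≤ LinearMap.ker a := iSup_le fun l v hv => ha l (Finset.mem_univ l) v hv
  rw [← haΨ]
  exact this hmem

end JointEigenvectors

section Gaudin

variable {A : Type*} [Ring A] [Algebra ℂ A]

/-- The split Casimir element built from two `sl₂`-triples. -/
noncomputable def splitCasimir (e f h e' f' h' : A) : A :=
  e * f' + f * e' + (1 / 2 : ℂ) • (h * h')

/-- The split Casimir element commutes with the diagonal action of `sl₂`. -/
lemma commute_splitCasimir_diagonal {e f h e' f' h' : A}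
    (hef : e * f - f * e = h) (hhe : h * e - e * h = 2 * e) (hhf : h * f - f * h = -(2 * f))
    (hef' : e' * f' - f' * e' = h') (hhe' : h' * e' - e' * h' = 2 * e')
    (hhf' : h' * f' - f' * h' = -(2 * f'))
    (cee : Commute e e') (cef : Commute e f') (ceh : Commute e h')
    (cfe : Commute f e') (cff : Commute f f') (cfh : Commute f h')
    (che : Commute h e') (chf : Commute h f') (chh : Commute h h') :
    Commute (splitCasimir e f h e' f' h') (e + e') ∧
      Commute (splitCasimir e f h e' f' h') (f + f') ∧
      Commute (splitCasimir e f h e' f' h') (h + h') := by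
  have two : ∀ a : A, a = (1 / 2 : ℂ) • (2 * a) := fun a => by
    rw [two_mul, ← two_smul ℂ a, smul_smul]; norm_num
  have key : ∀ x : A, Commute (2 * (e * f' + f * e') + h * h') x →
      Commute (splitCasimir e f h e' f' h') x := fun x hx => by
    have : splitCasimir e f h e' f' h' = (1 / 2 : ℂ) • (2 * (e * f' + f * e') + h * h') := by
      rw [smul_add, ← two, splitCasimir]
    rw [this]
    exact hx.smul_left _
  have cee := cee.eq
  have cef := cef.eq
  have ceh := ceh.eq
  have cfe := cfe.eq
  have cff := cff.eq
  have cfh := cfh.eq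
  have che := che.eq
  have chf := chf.eq
  have chh := chh.eq
  refine ⟨key _ ?_, key _ ?_, key _ ?_⟩
  · change _ = _
    linear_combination (norm := noncomm_ring)
      2 * (-(e * cef) - e * hef' + cee * f' - f * cee - hef * e' + cfe * e')
        - h * ceh + hhe * h' + h * hhe' + che * h'
  · change _ = _
    linear_combination (norm := noncomm_ring)
      2 * (-(e * cff) + hef * f' + cef * f' - f * cfe + f * hef' + cff * e')
        - h * cfh + hhf * h' + h * hhf' + chf * h'
  · change _ = _
    linear_combination (norm := noncomm_ring)
      2 * (-(e * chf) - hhe * f' - e * hhf' + ceh * f' - f * che - hhf * e' - f * hhe' + cfh * e')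
        - h * chh + chh * h'

lemma commute_splitCasimir_of_forall {e f h e' f' h' a : A}
    (he : Commute e a) (hf : Commute f a) (hh : Commute h a)
    (he' : Commute e' a) (hf' : Commute f' a) (hh' : Commute h' a) :
    Commute (splitCasimir e f h e' f' h') a :=
  ((he.mul_left hf').add_left (hf.mul_left he')).add_left ((hh.mul_left hh').smul_left _)

/-- Gaudin Hamiltonians commute, as a formal consequence of the infinitesimal braid relations. -/
lemma commute_sum_of_infinitesimal_braid {ι : Type*} [Fintype ι] {K : ι → ι → A}
    (hsymm : ∀ i j, K i j = K j i)
    (hdisj : ∀ i j k l, i ≠ k → i ≠ l → j ≠ k → j ≠ l → Commute (K i j) (K k l))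
    (hbraid : ∀ i j k, i ≠ j → i ≠ k → j ≠ k → Commute (K i j) (K i k + K j k))
    {z : ι → ℂ} (hz : Function.Injective z) (i j : ι) :
    Commute (∑ k, (z i - z k)⁻¹ • K i k) (∑ k, (z j - z k)⁻¹ • K j k) := by
  classical
  rcases eq_or_ne i j with rfl | hij
  · exact Commute.refl _
  have sub_ne {a b : ι} (h : a ≠ b) : z a - z b ≠ 0 := sub_ne_zero.mpr (hz.ne h)
  let br (a b : A) : A := a * b - b * a
  suffices h : ∑ k, ∑ l, ((z i - z k)⁻¹ * (z j - z l)⁻¹) • br (K i k) (K j l) = 0 by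
    refine sub_eq_zero.mp (Eq.trans ?_ h)
    simp only [br, Finset.sum_mul_sum, smul_sub, Finset.sum_sub_distrib, smul_mul_smul_comm]
    congr 1
    rw [Finset.sum_comm]
    simp only [mul_comm]
  have hb1 (k : ι) (hik : i ≠ k) (hjk : j ≠ k) :
      br (K i k) (K j i) = br (K i j) (K j k) := by
    have := (hbraid i j k hij hik hjk).eq
    simp only [br, hsymm j i]
    rw [mul_add, add_mul] at this
    linear_combination (norm := noncomm_ring) -this
  have hb2 (k : ι) (hik : i ≠ k) (hjk : j ≠ k) :
      br (K i k) (K j k) = - br (K i j) (K j k) := by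
    have h1 := (hbraid i k j hik hij hjk.symm).eq
    have h2 := (hbraid i j k hij hik hjk).eq
    simp only [br, hsymm k j] at h1 ⊢
    rw [mul_add, add_mul] at h1 h2
    linear_combination (norm := noncomm_ring) h1 + h2
  let B (k : ι) : A := if k = i ∨ k = j then 0 else br (K i j) (K j k)
  let c (a b : ι) : ℂ := (z a - z b)⁻¹
  have hc (a : ι) : c a a = 0 := by simp [c]
  have hterm (k l : ι) : (c i k * c j l) • br (K i k) (K j l) =
      (if k = j then (c i j * c j l) • B l else 0) + (if l = i then (c i k * c j i) • B k else 0)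
        - (if l = k then (c i k * c j k) • B k else 0) := by
    by_cases hki : k = i
    · subst hki
      simp [hc, hij]
    by_cases hlj : l = j
    · subst hlj
      by_cases hkl : l = k
      · simp [hc, hkl, hki]
      · simp [hc, hij.symm, hkl]
    by_cases hkj : k = j
    · subst hkj
      by_cases hli : l = i
      · subst hli
        simp [B, br, hsymm k l, hij]
      · simp [B, hli, hlj]
    by_cases hli : l = i
    · subst hli
      simp [B, hki, hkj, Ne.symm hki, hb1 k (Ne.symm hki) (Ne.symm hkj)]
    by_cases hlk : l = k
    · subst hlk
      simp [B, hki, hkj, hb2 l (Ne.symm hki) (Ne.symm hkj)]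
    · have := (hdisj i k j l hij (Ne.symm hli) hkj (Ne.symm hlk)).eq
      simp [br, this, hkj, hli, hlk]
  change ∑ k, ∑ l, (c i k * c j l) • br (K i k) (K j l) = 0
  simp only [hterm, Finset.sum_add_distrib, Finset.sum_sub_distrib]
  rw [Finset.sum_comm]
  simp only [Finset.sum_ite_eq', Finset.mem_univ, if_true]
  rw [← Finset.sum_add_distrib, ← Finset.sum_sub_distrib]
  refine Finset.sum_eq_zero fun k _ => ?_
  by_cases hk : k = i ∨ k = j
  · simp [B, hk]
  push Not at hk
  rw [← add_smul, ← sub_smul]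
  have h1 := sub_ne hij
  have h2 := sub_ne hij.symm
  have h3 := sub_ne (Ne.symm hk.1)
  have h4 := sub_ne (Ne.symm hk.2)
  have : c i j * c j k + c i k * c j i - c i k * c j k = 0 := by
    simp only [c]
    field_simp
    ring
  rw [this, zero_smul]

end Gaudin

section Operators

open MvPolynomial

variable {ι : Type*}

/-- The raising operator at site `i` on the tensor product of Verma modules of highest weights
`m i`, realised on polynomials. -/
noncomputable def gaudinE (m : ι → ℕ) (i : ι) : Module.End ℂ (MvPolynomial ι ℂ) :=
  (m i : ℂ) • (pderiv i).toLinearMap -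
    LinearMap.mulLeft ℂ (X i) * (pderiv i).toLinearMap * (pderiv i).toLinearMap

/-- The lowering operator at site `i`. -/
noncomputable def gaudinF (i : ι) : Module.End ℂ (MvPolynomial ι ℂ) :=
  LinearMap.mulLeft ℂ (X i)

/-- The weight operator at site `i`. -/
noncomputable def gaudinH (m : ι → ℕ) (i : ι) : Module.End ℂ (MvPolynomial ι ℂ) :=
  (m i : ℂ) • 1 - (2 : ℂ) • (LinearMap.mulLeft ℂ (X i) * (pderiv i).toLinearMap)

lemma gaudinE_apply (m : ι → ℕ) (i : ι) (p : MvPolynomial ι ℂ) :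
    gaudinE m i p = C (m i : ℂ) * pderiv i p - X i * pderiv i (pderiv i p) := by
  simp [gaudinE, smul_eq_C_mul]

lemma gaudinF_apply (i : ι) (p : MvPolynomial ι ℂ) : gaudinF i p = X i * p := rfl

lemma gaudinH_apply (m : ι → ℕ) (i : ι) (p : MvPolynomial ι ℂ) :
    gaudinH m i p = C (m i : ℂ) * p - 2 * (X i * pderiv i p) := by
  have h2 : (C 2 : MvPolynomial ι ℂ) = 2 := map_ofNat _ 2
  simp [gaudinH, smul_eq_C_mul, h2]

lemma pderiv_comm (i j : ι) (p : MvPolynomial ι ℂ) :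
    pderiv i (pderiv j p) = pderiv j (pderiv i p) := by
  have h : ⁅pderiv (R := ℂ) i, pderiv (R := ℂ) j⁆ = 0 := by
    classical
    refine derivation_ext fun k => ?_
    simp [Derivation.commutator_apply, pderiv_X, Pi.single_apply, apply_ite]
  have := DFunLike.congr_fun h p
  simpa [Derivation.commutator_apply, sub_eq_zero] using this

/-- The two-site interaction. -/
noncomputable def gaudinOmega (m : ι → ℕ) (i j : ι) : Module.End ℂ (MvPolynomial ι ℂ) :=
  splitCasimir (gaudinE m i) (gaudinF i) (gaudinH m i) (gaudinE m j) (gaudinF j) (gaudinH m j)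

lemma gaudinE_gaudinF (m : ι → ℕ) (i : ι) :
    gaudinE m i * gaudinF i - gaudinF i * gaudinE m i = gaudinH m i := by
  refine LinearMap.ext fun p => ?_
  simp [gaudinE_apply, gaudinF_apply, gaudinH_apply]
  ring

lemma gaudinH_gaudinE (m : ι → ℕ) (i : ι) :
    gaudinH m i * gaudinE m i - gaudinE m i * gaudinH m i = 2 * gaudinE m i := by
  refine LinearMap.ext fun p => ?_
  simp [two_mul, gaudinE_apply, gaudinH_apply]
  ring

lemma gaudinH_gaudinF (m : ι → ℕ) (i : ι) :
    gaudinH m i * gaudinF i - gaudinF i * gaudinH m i = -(2 * gaudinF i) := by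
  refine LinearMap.ext fun p => ?_
  simp [two_mul, gaudinF_apply, gaudinH_apply]
  ring

/-- The `sl₂`-triple at site `i`. -/
def gaudinSite (m : ι → ℕ) (i : ι) : Set (Module.End ℂ (MvPolynomial ι ℂ)) :=
  {gaudinE m i, gaudinF i, gaudinH m i}

lemma commute_of_mem_gaudinSite {m : ι → ℕ} {i j : ι} (hij : i ≠ j)
    {a b : Module.End ℂ (MvPolynomial ι ℂ)} (ha : a ∈ gaudinSite m i) (hb : b ∈ gaudinSite m j) :
    Commute a b := by
  simp only [gaudinSite, Set.mem_insert_iff, Set.mem_singleton_iff] at ha hb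
  have two (k : ι) : pderiv k (2 : MvPolynomial ι ℂ) = 0 := by
    simpa using (pderiv k).map_natCast 2
  refine LinearMap.ext fun p => ?_
  rcases ha with rfl | rfl | rfl <;> rcases hb with rfl | rfl | rfl <;>
  · simp [gaudinE_apply, gaudinF_apply, gaudinH_apply, two, pderiv_X_of_ne hij,
      pderiv_X_of_ne hij.symm, pderiv_comm j i]
    try ring

lemma gaudinE_mem (m : ι → ℕ) (i : ι) : gaudinE m i ∈ gaudinSite m i := by simp [gaudinSite]
lemma gaudinF_mem (m : ι → ℕ) (i : ι) : gaudinF i ∈ gaudinSite m i := by simp [gaudinSite]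
lemma gaudinH_mem (m : ι → ℕ) (i : ι) : gaudinH m i ∈ gaudinSite m i := by simp [gaudinSite]

lemma commute_gaudinOmega_of_mem_gaudinSite {m : ι → ℕ} {i j k : ι} (hik : i ≠ k) (hjk : j ≠ k)
    {a : Module.End ℂ (MvPolynomial ι ℂ)} (ha : a ∈ gaudinSite m k) :
    Commute (gaudinOmega m i j) a :=
  commute_splitCasimir_of_forall
    (commute_of_mem_gaudinSite hik (gaudinE_mem m i) ha)
    (commute_of_mem_gaudinSite hik (gaudinF_mem m i) ha)
    (commute_of_mem_gaudinSite hik (gaudinH_mem m i) ha)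
    (commute_of_mem_gaudinSite hjk (gaudinE_mem m j) ha)
    (commute_of_mem_gaudinSite hjk (gaudinF_mem m j) ha)
    (commute_of_mem_gaudinSite hjk (gaudinH_mem m j) ha)

lemma commute_gaudinOmega_of_disjoint (m : ι → ℕ) {i j k l : ι} (hik : i ≠ k) (hil : i ≠ l)
    (hjk : j ≠ k) (hjl : j ≠ l) : Commute (gaudinOmega m i j) (gaudinOmega m k l) :=
  (commute_splitCasimir_of_forall
    (commute_gaudinOmega_of_mem_gaudinSite hik hjk (gaudinE_mem m k)).symm
    (commute_gaudinOmega_of_mem_gaudinSite hik hjk (gaudinF_mem m k)).symm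
    (commute_gaudinOmega_of_mem_gaudinSite hik hjk (gaudinH_mem m k)).symm
    (commute_gaudinOmega_of_mem_gaudinSite hil hjl (gaudinE_mem m l)).symm
    (commute_gaudinOmega_of_mem_gaudinSite hil hjl (gaudinF_mem m l)).symm
    (commute_gaudinOmega_of_mem_gaudinSite hil hjl (gaudinH_mem m l)).symm).symm

lemma gaudinOmega_symm (m : ι → ℕ) (i j : ι) : gaudinOmega m i j = gaudinOmega m j i := by
  rcases eq_or_ne i j with rfl | hij
  · rfl
  simp only [gaudinOmega, splitCasimir]
  rw [(commute_of_mem_gaudinSite hij (gaudinE_mem m i) (gaudinF_mem m j)).eq,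
    (commute_of_mem_gaudinSite hij (gaudinF_mem m i) (gaudinE_mem m j)).eq,
    (commute_of_mem_gaudinSite hij (gaudinH_mem m i) (gaudinH_mem m j)).eq,
    add_comm (gaudinF j * _)]

lemma commute_gaudinOmega_braid (m : ι → ℕ) {i j k : ι} (hij : i ≠ j) (hik : i ≠ k)
    (hjk : j ≠ k) : Commute (gaudinOmega m i j) (gaudinOmega m i k + gaudinOmega m j k) := by
  have comm {a b} := @commute_of_mem_gaudinSite ι m i j hij a b
  obtain ⟨he, hf, hh⟩ := commute_splitCasimir_diagonal
    (gaudinE_gaudinF m i) (gaudinH_gaudinE m i) (gaudinH_gaudinF m i)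
    (gaudinE_gaudinF m j) (gaudinH_gaudinE m j) (gaudinH_gaudinF m j)
    (comm (gaudinE_mem m i) (gaudinE_mem m j)) (comm (gaudinE_mem m i) (gaudinF_mem m j))
    (comm (gaudinE_mem m i) (gaudinH_mem m j)) (comm (gaudinF_mem m i) (gaudinE_mem m j))
    (comm (gaudinF_mem m i) (gaudinF_mem m j)) (comm (gaudinF_mem m i) (gaudinH_mem m j))
    (comm (gaudinH_mem m i) (gaudinE_mem m j)) (comm (gaudinH_mem m i) (gaudinF_mem m j))
    (comm (gaudinH_mem m i) (gaudinH_mem m j))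
  have hsum : gaudinOmega m i k + gaudinOmega m j k =
      (gaudinE m i + gaudinE m j) * gaudinF k + (gaudinF i + gaudinF j) * gaudinE m k +
        (1 / 2 : ℂ) • ((gaudinH m i + gaudinH m j) * gaudinH m k) := by
    simp only [gaudinOmega, splitCasimir, add_mul, smul_add]
    abel
  rw [hsum]
  have site {a} := @commute_gaudinOmega_of_mem_gaudinSite ι m i j k hik hjk a
  exact ((he.mul_right (site (gaudinF_mem m k))).add_right
    (hf.mul_right (site (gaudinE_mem m k)))).add_right
    ((hh.mul_right (site (gaudinH_mem m k))).smul_right _)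

/-- The Gaudin Hamiltonian at site `i`. -/
noncomputable def gaudinHamiltonian [Fintype ι] (m : ι → ℕ) (z : ι → ℂ) (i : ι) :
    Module.End ℂ (MvPolynomial ι ℂ) :=
  ∑ j, (z i - z j)⁻¹ • gaudinOmega m i j

lemma commute_gaudinHamiltonian [Fintype ι] (m : ι → ℕ) {z : ι → ℂ} (hz : Function.Injective z)
    (i j : ι) : Commute (gaudinHamiltonian m z i) (gaudinHamiltonian m z j) :=
  commute_sum_of_infinitesimal_braid (gaudinOmega_symm m)
    (fun _ _ _ _ => commute_gaudinOmega_of_disjoint m)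
    (fun _ _ _ => commute_gaudinOmega_braid m) hz i j

/-- The directional derivation along the difference of two coordinates. -/
noncomputable def pderivSub (i j : ι) : Derivation ℂ (MvPolynomial ι ℂ) (MvPolynomial ι ℂ) :=
  pderiv i - pderiv j

lemma pderivSub_apply (i j : ι) (p : MvPolynomial ι ℂ) :
    pderivSub i j p = pderiv i p - pderiv j p := rfl

lemma gaudinOmega_apply (m : ι → ℕ) {i j : ι} (hij : i ≠ j) (p : MvPolynomial ι ℂ) :
    gaudinOmega m i j p = C (m i * m j / 2 : ℂ) * p
      - X i * X j *
        pderivSub i j (pderivSub i j p)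
      + (C (m i : ℂ) * X j - C (m j : ℂ) * X i)
        * pderivSub i j p := by
  have two (k : ι) : pderiv k (2 : MvPolynomial ι ℂ) = 0 := by
    simpa using (pderiv k).map_natCast 2
  have half : (2 : MvPolynomial ι ℂ) * C (1 / 2 : ℂ) = 1 := by
    rw [show (2 : MvPolynomial ι ℂ) = C (2 : ℂ) from (map_ofNat _ 2).symm, ← map_mul]
    norm_num
  have hmm : C (m i * m j / 2 : ℂ) = C (1 / 2 : ℂ) *
      C (m i : ℂ) * (C (m j : ℂ) : MvPolynomial ι ℂ) := by
    rw [← map_mul, ← map_mul]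
    congr 1
    ring
  rw [hmm]
  simp only [gaudinOmega, splitCasimir, LinearMap.add_apply, Module.End.mul_apply,
    LinearMap.smul_apply, smul_eq_C_mul, gaudinE_apply, gaudinF_apply, gaudinH_apply,
    map_sub, pderivSub_apply, Derivation.leibniz, mul_zero, add_zero,
     pderiv_C, two, smul_eq_mul,
    pderiv_X_of_ne hij.symm, pderiv_comm j i]
  generalize C (1 / 2 : ℂ) = t at half ⊢
  linear_combination (-(X j * C (m i : ℂ) * pderiv j p)
    - X i * C (m j : ℂ) * pderiv i p + 2 * (X i *
      X j * pderiv i (pderiv j p))) * half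

lemma exists_of_coeff_X_mul_ne_zero {i : ι} {α : ι →₀ ℕ} {p : MvPolynomial ι ℂ}
    (h : coeff α (X i * p) ≠ 0) :
    ∃ β, α = β + Finsupp.single i 1 ∧ coeff β p ≠ 0 := by
  classical
  rw [coeff_X_mul'] at h
  split_ifs at h with hi
  · refine ⟨α - Finsupp.single i 1, ?_, h⟩
    rw [tsub_add_cancel_of_le]
    rw [Finsupp.single_le_iff, Nat.succ_le_iff, pos_iff_ne_zero]
    exact Finsupp.mem_support_iff.mp hi
  · exact absurd rfl h

lemma coeff_X_mul_pderiv (i : ι) (α : ι →₀ ℕ) (p : MvPolynomial ι ℂ) :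
    coeff α (X i * pderiv i p) = α i * coeff α p := by
  classical
  rw [coeff_X_mul']
  split_ifs with hi
  · have hi' : Finsupp.single i 1 ≤ α := by
      rw [Finsupp.single_le_iff, Nat.succ_le_iff, pos_iff_ne_zero]
      exact Finsupp.mem_support_iff.mp hi
    have h1 : 1 ≤ α i := by simpa using hi' i
    rw [coeff_pderiv, tsub_add_cancel_of_le hi']
    simp [Nat.cast_sub h1, mul_comm]
  · simp [Finsupp.notMem_support_iff.mp hi]

lemma coeff_gaudinE (m : ι → ℕ) (i : ι) (α : ι →₀ ℕ) (p : MvPolynomial ι ℂ) :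
    coeff α (gaudinE m i p) =
      (α i + 1) * (m i - α i) * coeff (α + Finsupp.single i 1) p := by
  rw [gaudinE_apply, coeff_sub, coeff_C_mul, coeff_X_mul_pderiv, coeff_pderiv]
  ring

lemma coeff_gaudinH (m : ι → ℕ) (i : ι) (α : ι →₀ ℕ) (p : MvPolynomial ι ℂ) :
    coeff α (gaudinH m i p) = (m i - 2 * α i) * coeff α p := by
  have h2 : (2 : MvPolynomial ι ℂ) = C 2 := (map_ofNat _ 2).symm
  rw [gaudinH_apply, coeff_sub, coeff_C_mul, h2, coeff_C_mul, coeff_X_mul_pderiv]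
  ring

lemma exists_of_coeff_gaudinE_gaudinF_ne_zero {m : ι → ℕ} {i j : ι} {α : ι →₀ ℕ}
    {p : MvPolynomial ι ℂ} (h : coeff α (gaudinE m i (gaudinF j p)) ≠ 0) :
    ∃ β, coeff β p ≠ 0 ∧ β.degree = α.degree ∧ ∀ l, m l < β l → m l < α l := by
  classical
  rw [coeff_gaudinE] at h
  obtain ⟨β, hβ, hβp⟩ := exists_of_coeff_X_mul_ne_zero (right_ne_zero_of_mul h)
  have hne : m i ≠ α i := fun hm => left_ne_zero_of_mul h (by simp [hm])
  refine ⟨β, hβp, ?_, fun l hl => ?_⟩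
  · have := congrArg Finsupp.degree hβ
    simp only [map_add, Finsupp.degree_single] at this
    omega
  · have := DFunLike.congr_fun hβ l
    simp only [Finsupp.add_apply, Finsupp.single_apply] at this
    split_ifs at this with h1 h2 h2
    · omega
    · subst h1; omega
    · omega
    · omega

lemma exists_of_coeff_gaudinOmega_ne_zero {m : ι → ℕ} {i j : ι} (hij : i ≠ j) {α : ι →₀ ℕ}
    {p : MvPolynomial ι ℂ} (h : coeff α (gaudinOmega m i j p) ≠ 0) :
    ∃ β, coeff β p ≠ 0 ∧ β.degree = α.degree ∧ ∀ l, m l < β l → m l < α l := by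
  rw [gaudinOmega, splitCasimir,
    (commute_of_mem_gaudinSite hij (gaudinF_mem m i) (gaudinE_mem m j)).eq] at h
  simp only [LinearMap.add_apply, Module.End.mul_apply, LinearMap.smul_apply, coeff_add,
    coeff_smul, coeff_gaudinH] at h
  by_cases h1 : coeff α (gaudinE m i (gaudinF j p)) = 0
  · by_cases h2 : coeff α (gaudinE m j (gaudinF i p)) = 0
    · refine ⟨α, fun h3 => h ?_, rfl, fun _ => id⟩
      simp [h1, h2, h3]
    · exact exists_of_coeff_gaudinE_gaudinF_ne_zero h2
  · exact exists_of_coeff_gaudinE_gaudinF_ne_zero h1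

/-- The degree `k` part of the ideal generated by `X l ^ (m l + 1)`. -/
noncomputable def siteIdeal (m : ι → ℕ) (k : ℕ) (l : ι) : Submodule ℂ (MvPolynomial ι ℂ) :=
  restrictSupport ℂ {α | α.degree = k ∧ m l < α l}

lemma mem_siteIdeal {m : ι → ℕ} {k : ℕ} {l : ι} {p : MvPolynomial ι ℂ} :
    p ∈ siteIdeal m k l ↔ ∀ α, coeff α p ≠ 0 → α.degree = k ∧ m l < α l := by
  simp [siteIdeal, mem_restrictSupport_iff, Set.subset_def]

instance finiteDimensional_siteIdeal [Finite ι] (m : ι → ℕ) (k : ℕ) (l : ι) :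
    FiniteDimensional ℂ (siteIdeal m k l) := by
  have hfin : ({α : ι →₀ ℕ | α.degree = k ∧ m l < α l}).Finite :=
    (Finsupp.finite_of_degree_le k).subset fun α h => h.1.le
  have := hfin.to_subtype
  exact Module.Finite.of_basis (basisRestrictSupport ℂ _)

lemma gaudinHamiltonian_mem_siteIdeal [Fintype ι] {m : ι → ℕ} (z : ι → ℂ) {k : ℕ} {l : ι} (i : ι)
    {p : MvPolynomial ι ℂ} (hp : p ∈ siteIdeal m k l) :
    gaudinHamiltonian m z i p ∈ siteIdeal m k l := by
  rw [gaudinHamiltonian, LinearMap.sum_apply]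
  refine Submodule.sum_mem _ fun j _ => ?_
  rcases eq_or_ne i j with rfl | hij
  · simp
  refine Submodule.smul_mem _ _ (mem_siteIdeal.mpr fun α hα => ?_)
  obtain ⟨β, hβ, hdeg, hl⟩ := exists_of_coeff_gaudinOmega_ne_zero hij hα
  obtain ⟨h1, h2⟩ := mem_siteIdeal.mp hp β hβ
  exact ⟨hdeg ▸ h1, hl l h2⟩

lemma linearMap_ext₂_monomial {f g : MvPolynomial ι ℂ →ₗ[ℂ] MvPolynomial ι ℂ →ₗ[ℂ] ℂ}
    (h : ∀ α q, f (monomial α 1) q = g (monomial α 1) q) : f = g :=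
  (basisMonomials ι ℂ).ext fun α => LinearMap.ext fun q => by simpa using h α q

section Form

variable [Fintype ι]

/-- The squared norm of a monomial for the contravariant form. -/
def monomialNorm (m : ι → ℕ) (α : ι →₀ ℕ) : ℕ :=
  ∏ i, (α i).factorial * (m i).descFactorial (α i)

lemma monomialNorm_add_single (m : ι → ℕ) (α : ι →₀ ℕ) (i : ι) :
    (monomialNorm m (α + Finsupp.single i 1) : ℂ) =
      (α i + 1) * (m i - α i) * monomialNorm m α := by
  classical
  have hdesc : ((m i).descFactorial (α i + 1) : ℂ) =
      (m i - α i) * (m i).descFactorial (α i) := by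
    rw [Nat.descFactorial_succ]
    rcases le_or_gt (α i) (m i) with h | h
    · push_cast [h]; rfl
    · simp [Nat.descFactorial_eq_zero_iff_lt.mpr h]
  have hrest : ∏ j ∈ Finset.univ.erase i, (((α + Finsupp.single i 1 : ι →₀ ℕ) j).factorial *
      (m j).descFactorial ((α + Finsupp.single i 1 : ι →₀ ℕ) j)) =
      ∏ j ∈ Finset.univ.erase i, ((α j).factorial * (m j).descFactorial (α j)) :=
    Finset.prod_congr rfl fun j hj => by
      simp [(Finset.ne_of_mem_erase hj).symm]
  rw [monomialNorm, monomialNorm, ← Finset.mul_prod_erase _ _ (Finset.mem_univ i),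
    ← Finset.mul_prod_erase (a := i) _ (fun j => (α j).factorial * (m j).descFactorial (α j))
      (Finset.mem_univ i), hrest, Finsupp.add_apply, Finsupp.single_eq_same, Nat.factorial_succ]
  push_cast
  rw [hdesc]
  ring

lemma monomialNorm_eq_zero {m : ι → ℕ} {α : ι →₀ ℕ} (h : monomialNorm m α = 0) :
    ∃ l, m l < α l := by
  obtain ⟨l, -, hl⟩ := Finset.prod_eq_zero_iff.mp h
  refine ⟨l, Nat.descFactorial_eq_zero_iff_lt.mp ?_⟩
  exact (mul_eq_zero.mp hl).resolve_left (Nat.factorial_ne_zero _)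

/-- The contravariant (Shapovalov) bilinear form. -/
noncomputable def contravariantForm (m : ι → ℕ) :
    MvPolynomial ι ℂ →ₗ[ℂ] MvPolynomial ι ℂ →ₗ[ℂ] ℂ :=
  (basisMonomials ι ℂ).constr ℂ fun α => (monomialNorm m α : ℂ) • lcoeff ℂ α

lemma contravariantForm_monomial (m : ι → ℕ) (α : ι →₀ ℕ) (q : MvPolynomial ι ℂ) :
    contravariantForm m (monomial α 1) q = monomialNorm m α * coeff α q := by
  have := (basisMonomials ι ℂ).constr_basis ℂ
    (fun α => (monomialNorm m α : ℂ) • lcoeff ℂ α) α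
  rw [coe_basisMonomials] at this
  rw [contravariantForm, this]
  simp [lcoeff]

lemma contravariantForm_eq_sum (m : ι → ℕ) (p q : MvPolynomial ι ℂ) :
    contravariantForm m p q = ∑ α ∈ p.support, monomialNorm m α * coeff α p * coeff α q := by
  conv_lhs => rw [p.as_sum]
  rw [map_sum, LinearMap.sum_apply]
  refine Finset.sum_congr rfl fun α _ => ?_
  rw [show monomial α (coeff α p) = coeff α p • monomial α (1 : ℂ) by simp [smul_monomial],
    map_smul, LinearMap.smul_apply, contravariantForm_monomial, smul_eq_mul]
  ring

lemma contravariantForm_gaudinF (m : ι → ℕ) (i : ι) (p q : MvPolynomial ι ℂ) :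
    contravariantForm m (gaudinF i p) q = contravariantForm m p (gaudinE m i q) := by
  have : (contravariantForm m).comp (gaudinF i) =
      (contravariantForm m).compl₂ (gaudinE m i) := linearMap_ext₂_monomial fun α q => by
    have hX : gaudinF i (monomial α (1 : ℂ)) = monomial (α + Finsupp.single i 1) 1 := by
      rw [gaudinF_apply, X, monomial_mul, one_mul, add_comm]
    rw [LinearMap.comp_apply, LinearMap.compl₂_apply, hX, contravariantForm_monomial,
      contravariantForm_monomial, coeff_gaudinE, monomialNorm_add_single]
    ring
  simpa using LinearMap.congr_fun₂ this p q

lemma contravariantForm_symm (m : ι → ℕ) (p q : MvPolynomial ι ℂ) :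
    contravariantForm m p q = contravariantForm m q p := by
  classical
  have h (p q : MvPolynomial ι ℂ) : contravariantForm m p q =
      ∑ α ∈ p.support ∪ q.support, monomialNorm m α * coeff α p * coeff α q := by
    rw [contravariantForm_eq_sum]
    refine Finset.sum_subset Finset.subset_union_left fun α _ hα => ?_
    simp [notMem_support_iff.mp hα]
  rw [h, h, Finset.union_comm]
  exact Finset.sum_congr rfl fun α _ => by ring

lemma contravariantForm_gaudinE (m : ι → ℕ) (i : ι) (p q : MvPolynomial ι ℂ) :
    contravariantForm m (gaudinE m i p) q = contravariantForm m p (gaudinF i q) := by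
  rw [contravariantForm_symm, ← contravariantForm_gaudinF, contravariantForm_symm]

lemma contravariantForm_gaudinH (m : ι → ℕ) (i : ι) (p q : MvPolynomial ι ℂ) :
    contravariantForm m (gaudinH m i p) q = contravariantForm m p (gaudinH m i q) := by
  simp only [← gaudinE_gaudinF, LinearMap.sub_apply, Module.End.mul_apply, map_sub,
    contravariantForm_gaudinE, contravariantForm_gaudinF]

lemma contravariantForm_gaudinOmega (m : ι → ℕ) (i j : ι) (p q : MvPolynomial ι ℂ) :
    contravariantForm m (gaudinOmega m i j p) q = contravariantForm m p (gaudinOmega m i j q) := by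
  conv_rhs => rw [gaudinOmega_symm]
  simp only [gaudinOmega, splitCasimir, LinearMap.add_apply, Module.End.mul_apply,
    LinearMap.smul_apply, map_add, map_smul, contravariantForm_gaudinE, contravariantForm_gaudinF,
    contravariantForm_gaudinH]

lemma contravariantForm_gaudinHamiltonian (m : ι → ℕ) (z : ι → ℂ) (i : ι)
    (p q : MvPolynomial ι ℂ) :
    contravariantForm m (gaudinHamiltonian m z i p) q =
      contravariantForm m p (gaudinHamiltonian m z i q) := by
  simp only [gaudinHamiltonian, LinearMap.sum_apply, map_sum, LinearMap.smul_apply, map_smul,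
    contravariantForm_gaudinOmega]

lemma map_conj_gaudinHamiltonian (m : ι → ℕ) {z : ι → ℂ}
    (hz : ∀ i, starRingEnd ℂ (z i) = z i) (i : ι) (p : MvPolynomial ι ℂ) :
    map (starRingEnd ℂ) (gaudinHamiltonian m z i p) =
      gaudinHamiltonian m z i (map (starRingEnd ℂ) p) := by
  simp only [gaudinHamiltonian, LinearMap.sum_apply, map_sum, LinearMap.smul_apply,
    smul_eq_C_mul, map_mul, map_C, map_inv₀, map_sub, hz]
  refine Finset.sum_congr rfl fun j _ => ?_
  rcases eq_or_ne i j with rfl | hij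
  · simp
  congr 1
  have h2 : starRingEnd ℂ 2 = 2 := Complex.conj_ofNat 2
  simp [gaudinOmega_apply m hij, pderivSub_apply, pderiv_map, h2]

/-- An eigenvector of a Gaudin Hamiltonian with real sites and a non-real eigenvalue is isotropic,
hence lies in the sum of the site ideals. -/
lemma mem_iSup_siteIdeal_of_nonreal_eigenvalue {m : ι → ℕ} {z : ι → ℂ}
    (hz : ∀ i, starRingEnd ℂ (z i) = z i) {k : ℕ} {p : MvPolynomial ι ℂ} (hp : p.IsHomogeneous k)
    {i : ι} {c : ℂ} (hc : starRingEnd ℂ c ≠ c) (hpc : gaudinHamiltonian m z i p = c • p) :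
    p ∈ ⨆ l, siteIdeal m k l := by
  have h0 : contravariantForm m (map (starRingEnd ℂ) p) p = 0 := by
    have h1 := contravariantForm_gaudinHamiltonian m z i (map (starRingEnd ℂ) p) p
    rw [← map_conj_gaudinHamiltonian m hz, hpc, smul_eq_C_mul, map_mul, map_C,
      ← smul_eq_C_mul, ← smul_eq_C_mul, map_smul, map_smul,
      LinearMap.smul_apply, smul_eq_mul, smul_eq_mul, ← sub_eq_zero, ← sub_mul] at h1
    exact (mul_eq_zero.mp h1).resolve_left (sub_ne_zero.mpr hc)
  have hzero : ∀ α ∈ p.support, monomialNorm m α = 0 := by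
    rw [contravariantForm_symm, contravariantForm_eq_sum] at h0
    have h2 : ∑ α ∈ p.support, (monomialNorm m α : ℝ) * Complex.normSq (coeff α p) = 0 := by
      rw [← Complex.ofReal_eq_zero, ← h0]
      push_cast
      refine Finset.sum_congr rfl fun α _ => ?_
      rw [coeff_map, mul_assoc, Complex.mul_conj]
    intro α hα
    have h3 := (Finset.sum_eq_zero_iff_of_nonneg fun β _ =>
      mul_nonneg (Nat.cast_nonneg _) (Complex.normSq_nonneg _)).mp h2 α hα
    have h4 : Complex.normSq (coeff α p) ≠ 0 := by simpa using hα
    exact_mod_cast (mul_eq_zero.mp h3).resolve_right h4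
  rw [p.as_sum]
  refine Submodule.sum_mem _ fun α hα => ?_
  obtain ⟨l, hl⟩ := monomialNorm_eq_zero (hzero α hα)
  refine Submodule.mem_iSup_of_mem l (mem_siteIdeal.mpr fun β hβ => ?_)
  classical
  rw [coeff_monomial] at hβ
  obtain rfl : α = β := by
    by_contra h
    exact hβ (if_neg h)
  exact ⟨not_not.mp fun h => mem_support_iff.mp hα (hp.coeff_eq_zero h), hl⟩

end Form

end Operators

section BetheVector

open MvPolynomial

variable {ι : Type*} [Fintype ι]

/-- The linear form with coefficients `1 / (t - z i)`. -/
noncomputable def betheForm (z : ι → ℂ) (t : ℂ) : MvPolynomial ι ℂ :=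
  ∑ i, C (t - z i)⁻¹ * X i

/-- The Bethe vector attached to the set `T` of Bethe roots. -/
noncomputable def betheVector (z : ι → ℂ) (T : Finset ℂ) : MvPolynomial ι ℂ :=
  ∏ t ∈ T, betheForm z t

lemma derivation_prod {A : Type*} [CommRing A] [Algebra ℂ A] (D : Derivation ℂ A A)
    (T : Finset ℂ) (f : ℂ → A) :
    D (∏ t ∈ T, f t) = ∑ t ∈ T, (∏ s ∈ T.erase t, f s) * D (f t) := by
  induction T using Finset.induction_on with
  | empty => simp
  | insert a T ha ih =>
    rw [Finset.prod_insert ha, Derivation.leibniz, ih, Finset.sum_insert ha,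
      Finset.erase_insert ha, smul_eq_mul, smul_eq_mul, Finset.mul_sum, add_comm]
    congr 1
    refine Finset.sum_congr rfl fun t ht => ?_
    have hta : a ≠ t := fun h => ha (h ▸ ht)
    rw [Finset.erase_insert_of_ne hta, Finset.prod_insert (by simp [ha]), mul_assoc]

lemma pderiv_betheForm (z : ι → ℂ) (t : ℂ) (i : ι) :
    pderiv i (betheForm z t) = C (t - z i)⁻¹ := by
  classical
  simp [betheForm, pderiv_X, Pi.single_apply]

lemma pderivSub_betheForm {z : ι → ℂ} {t : ℂ} (ht : ∀ i, t ≠ z i) (i j : ι) :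
    pderivSub i j (betheForm z t) =
      C (z i - z j) * C (t - z i)⁻¹ * C (t - z j)⁻¹ := by
  have hi := sub_ne_zero.mpr (ht i)
  have hj := sub_ne_zero.mpr (ht j)
  rw [pderivSub_apply, pderiv_betheForm, pderiv_betheForm, ← map_sub, ← map_mul, ← map_mul]
  congr 1
  field_simp
  ring

lemma pderivSub_betheVector {z : ι → ℂ} {T : Finset ℂ} (hT : ∀ t ∈ T, ∀ i, t ≠ z i) (i j : ι) :
    pderivSub i j (betheVector z T) = C (z i - z j) *
      ∑ b ∈ T, C (b - z i)⁻¹ * C (b - z j)⁻¹ * betheVector z (T.erase b) := by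
  rw [betheVector, derivation_prod, Finset.mul_sum]
  refine Finset.sum_congr rfl fun b hb => ?_
  rw [pderivSub_betheForm (hT b hb), betheVector]
  ring

lemma pderivSub_pderivSub_betheVector {z : ι → ℂ} {T : Finset ℂ} (hT : ∀ t ∈ T, ∀ i, t ≠ z i)
    (i j : ι) :
    pderivSub i j (pderivSub i j (betheVector z T)) = C (z i - z j) * C (z i - z j) *
      ∑ b ∈ T, ∑ c ∈ T.erase b, C (b - z i)⁻¹ * C (b - z j)⁻¹ *
        (C (c - z i)⁻¹ * C (c - z j)⁻¹ * betheVector z ((T.erase b).erase c)) := by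
  have hC (a : ℂ) : pderivSub i j (C a : MvPolynomial ι ℂ) = 0 :=
    (pderivSub i j).map_algebraMap a
  rw [pderivSub_betheVector hT, Derivation.leibniz, hC, smul_zero, add_zero, smul_eq_mul,
    map_sum, mul_assoc]
  congr 1
  rw [Finset.mul_sum]
  refine Finset.sum_congr rfl fun b hb => ?_
  rw [← map_mul, Derivation.leibniz, hC, smul_zero, add_zero, smul_eq_mul,
    pderivSub_betheVector fun t ht => hT t (Finset.mem_of_mem_erase ht), ← Finset.mul_sum]
  ring

lemma betheForm_mul_betheVector_erase {z : ι → ℂ} {T : Finset ℂ} {b : ℂ} (hb : b ∈ T) :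
    betheForm z b * betheVector z (T.erase b) = betheVector z T :=
  Finset.mul_prod_erase T (betheForm z) hb

lemma inv_smul_gaudinOmega_betheVector (m : ι → ℕ) {z : ι → ℂ} (hz : Function.Injective z)
    {T : Finset ℂ} (hT : ∀ t ∈ T, ∀ i, t ≠ z i) (i j : ι) :
    (z i - z j)⁻¹ • gaudinOmega m i j (betheVector z T) =
      C ((z i - z j)⁻¹ * (m i * m j / 2)) * betheVector z T
      - X i * ∑ b ∈ T, ∑ c ∈ T.erase b, C (z i - z j) * C (b - z i)⁻¹ * C (b - z j)⁻¹ *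
        C (c - z i)⁻¹ * C (c - z j)⁻¹ * X j * betheVector z ((T.erase b).erase c)
      + ∑ b ∈ T, C (b - z i)⁻¹ * betheVector z (T.erase b) *
        (C (m i : ℂ) * (C (b - z j)⁻¹ * X j) - X i * C (m j * (b - z j)⁻¹)) := by
  rcases eq_or_ne i j with rfl | hij
  · have (x : ℂ) : C (m i : ℂ) * (C x * X i) - X i * C (m i * x) = (0 : MvPolynomial ι ℂ) := by
      rw [map_mul]
      ring
    simp only [this]
    simp
  have hinv : C (z i - z j)⁻¹ * (C (z i - z j) : MvPolynomial ι ℂ) = 1 := by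
    rw [← map_mul, inv_mul_cancel₀ (sub_ne_zero.mpr (hz.ne hij)), map_one]
  have h1 : ∑ b ∈ T, ∑ c ∈ T.erase b, C (z i - z j) * C (b - z i)⁻¹ * C (b - z j)⁻¹ *
        C (c - z i)⁻¹ * C (c - z j)⁻¹ * X j * betheVector z ((T.erase b).erase c) =
      C (z i - z j) * X j * ∑ b ∈ T, ∑ c ∈ T.erase b, C (b - z i)⁻¹ * C (b - z j)⁻¹ *
        (C (c - z i)⁻¹ * C (c - z j)⁻¹ * betheVector z ((T.erase b).erase c)) := by
    simp only [Finset.mul_sum]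
    exact Finset.sum_congr rfl fun b _ => Finset.sum_congr rfl fun c _ => by ring
  have h2 : ∑ b ∈ T, C (b - z i)⁻¹ * betheVector z (T.erase b) *
        (C (m i : ℂ) * (C (b - z j)⁻¹ * X j) - X i * C (m j * (b - z j)⁻¹)) =
      (C (m i : ℂ) * X j - C (m j : ℂ) * X i) *
        ∑ b ∈ T, C (b - z i)⁻¹ * C (b - z j)⁻¹ * betheVector z (T.erase b) := by
    rw [Finset.mul_sum]
    exact Finset.sum_congr rfl fun b _ => by rw [map_mul]; ring
  rw [gaudinOmega_apply m hij, pderivSub_pderivSub_betheVector hT, pderivSub_betheVector hT,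
    h1, h2, smul_eq_C_mul, map_mul]
  generalize (∑ b ∈ T, ∑ c ∈ T.erase b, C (b - z i)⁻¹ * C (b - z j)⁻¹ *
        (C (c - z i)⁻¹ * C (c - z j)⁻¹ * betheVector z ((T.erase b).erase c))) = S₂
  generalize (∑ b ∈ T, C (b - z i)⁻¹ * C (b - z j)⁻¹ * betheVector z (T.erase b)) = S₁
  linear_combination (-X i * X j * C (z i - z j) * S₂ +
    (C (m i : ℂ) * X j - C (m j : ℂ) * X i) * S₁) * hinv

lemma sum_exchange_betheForm {z : ι → ℂ} {b c : ℂ} (hbc : b ≠ c) (hb : ∀ i, b ≠ z i)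
    (hc : ∀ i, c ≠ z i) (i : ι) :
    ∑ j, C (z i - z j) * C (b - z i)⁻¹ * C (b - z j)⁻¹ * C (c - z i)⁻¹ * C (c - z j)⁻¹ * X j =
      C (c - b)⁻¹ * (C (b - z i)⁻¹ * betheForm z c - C (c - z i)⁻¹ * betheForm z b) := by
  simp only [betheForm, Finset.mul_sum, ← Finset.sum_sub_distrib]
  refine Finset.sum_congr rfl fun j _ => ?_
  simp only [← mul_assoc, ← map_mul]
  rw [← sub_mul, ← map_sub, ← mul_assoc, ← map_mul]
  congr 2
  have := sub_ne_zero.mpr hbc.symm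
  have := sub_ne_zero.mpr (hb i)
  have := sub_ne_zero.mpr (hb j)
  have := sub_ne_zero.mpr (hc i)
  have := sub_ne_zero.mpr (hc j)
  field_simp
  ring

lemma sum_sum_inv_sub_mul {A : Type*} [CommRing A] [Algebra ℂ A] (T : Finset ℂ) (P : ℂ → A) :
    ∑ b ∈ T, ∑ c ∈ T.erase b, algebraMap ℂ A (c - b)⁻¹ * (P b - P c) =
      -∑ b ∈ T, algebraMap ℂ A (2 * ∑ c ∈ T.erase b, (b - c)⁻¹) * P b := by
  have h1 : ∀ b ∈ T, ∑ c ∈ T.erase b, algebraMap ℂ A (c - b)⁻¹ * (P b - P c) =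
      ∑ c ∈ T, algebraMap ℂ A (c - b)⁻¹ * (P b - P c) := fun b _ =>
    Finset.sum_erase _ (by simp)
  have h2 (b : ℂ) : ∑ c ∈ T.erase b, (b - c)⁻¹ = ∑ c ∈ T, (b - c)⁻¹ :=
    Finset.sum_erase _ (by simp)
  have h3 : ∑ b ∈ T, ∑ c ∈ T, algebraMap ℂ A (c - b)⁻¹ * P c =
      -∑ b ∈ T, ∑ c ∈ T, algebraMap ℂ A (c - b)⁻¹ * P b := by
    rw [Finset.sum_comm, ← Finset.sum_neg_distrib]
    refine Finset.sum_congr rfl fun b _ => ?_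
    rw [← Finset.sum_neg_distrib]
    refine Finset.sum_congr rfl fun c _ => ?_
    rw [← neg_sub c b, inv_neg, map_neg, neg_mul]
  have h4 (b : ℂ) : algebraMap ℂ A (2 * ∑ c ∈ T, (b - c)⁻¹) * P b =
      -(2 * ∑ c ∈ T, algebraMap ℂ A (c - b)⁻¹ * P b) := by
    rw [map_mul, map_ofNat, map_sum, mul_assoc, Finset.sum_mul, ← mul_neg,
      ← Finset.sum_neg_distrib]
    congr 1
    refine Finset.sum_congr rfl fun c _ => ?_
    rw [← neg_sub c b, inv_neg, map_neg, neg_mul]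
  rw [Finset.sum_congr rfl h1]
  simp only [h2, h4, mul_sub, Finset.sum_sub_distrib, h3, Finset.sum_neg_distrib, ← Finset.mul_sum]
  ring

/-- **Bethe ansatz**: solutions of the Bethe equations give joint eigenvectors of the Gaudin
Hamiltonians. -/
theorem gaudinHamiltonian_betheVector (m : ι → ℕ) {z : ι → ℂ} (hz : Function.Injective z)
    {T : Finset ℂ} (hT : ∀ t ∈ T, ∀ i, t ≠ z i)
    (hbethe : ∀ t ∈ T, ∑ j, m j * (t - z j)⁻¹ = 2 * ∑ c ∈ T.erase t, (t - c)⁻¹) (i : ι) :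
    gaudinHamiltonian m z i (betheVector z T) =
      (∑ j, (z i - z j)⁻¹ * (m i * m j / 2) + m i * ∑ t ∈ T, (t - z i)⁻¹) • betheVector z T := by
  have hA : ∑ j, ∑ b ∈ T, ∑ c ∈ T.erase b, C (z i - z j) * C (b - z i)⁻¹ * C (b - z j)⁻¹ *
        C (c - z i)⁻¹ * C (c - z j)⁻¹ * X j * betheVector z ((T.erase b).erase c) =
      -∑ b ∈ T, C (2 * ∑ c ∈ T.erase b, (b - c)⁻¹) *
        (C (b - z i)⁻¹ * betheVector z (T.erase b)) := by
    rw [← algebraMap_eq, ← sum_sum_inv_sub_mul, Finset.sum_comm]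
    refine Finset.sum_congr rfl fun b hb => ?_
    rw [Finset.sum_comm]
    refine Finset.sum_congr rfl fun c hc => ?_
    have hcT := Finset.mem_of_mem_erase hc
    have hbc := Finset.ne_of_mem_erase hc
    rw [← Finset.sum_mul, algebraMap_eq, sum_exchange_betheForm hbc.symm (hT b hb) (hT c hcT),
      ← betheForm_mul_betheVector_erase hc,
      ← betheForm_mul_betheVector_erase (Finset.mem_erase.mpr ⟨hbc.symm, hb⟩),
      Finset.erase_right_comm (a := c)]
    ring
  have hB : ∑ j, ∑ b ∈ T, C (b - z i)⁻¹ * betheVector z (T.erase b) *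
        (C (m i : ℂ) * (C (b - z j)⁻¹ * X j) - X i * C (m j * (b - z j)⁻¹)) =
      C (m i * ∑ t ∈ T, (t - z i)⁻¹) * betheVector z T -
      X i * ∑ b ∈ T, C (2 * ∑ c ∈ T.erase b, (b - c)⁻¹) *
        (C (b - z i)⁻¹ * betheVector z (T.erase b)) := by
    rw [Finset.sum_comm, map_mul, map_sum, Finset.mul_sum, Finset.mul_sum, Finset.sum_mul,
      ← Finset.sum_sub_distrib]
    refine Finset.sum_congr rfl fun b hb => ?_
    rw [← Finset.mul_sum, Finset.sum_sub_distrib, ← Finset.mul_sum, ← Finset.mul_sum, ← map_sum,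
      hbethe b hb, ← betheForm_mul_betheVector_erase hb, ← betheForm]
    ring
  rw [gaudinHamiltonian, LinearMap.sum_apply]
  simp only [LinearMap.smul_apply, inv_smul_gaudinOmega_betheVector m hz hT, Finset.sum_add_distrib,
    Finset.sum_sub_distrib, ← Finset.mul_sum, ← Finset.sum_mul, hA, hB, smul_eq_C_mul, map_add,
    map_sum]
  ring

lemma isHomogeneous_betheVector (z : ι → ℂ) (T : Finset ℂ) :
    (betheVector z T).IsHomogeneous T.card := by
  have := IsHomogeneous.prod T (betheForm z) (fun _ => 1) fun t _ =>
    IsHomogeneous.sum _ _ _ fun i _ => by simpa using (isHomogeneous_C ι (t - z i)⁻¹).mul (isHomogeneous_X ℂ i)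
  simpa [betheVector] using this

lemma betheVector_ne_zero [Nonempty ι] {z : ι → ℂ} {T : Finset ℂ} (hT : ∀ t ∈ T, ∀ i, t ≠ z i) :
    betheVector z T ≠ 0 := by
  refine Finset.prod_ne_zero_iff.mpr fun t ht h => ?_
  obtain ⟨i⟩ := ‹Nonempty ι›
  have := pderiv_betheForm z t i
  rw [h, map_zero, eq_comm, C_eq_zero, inv_eq_zero, sub_eq_zero] at this
  exact hT t ht i this

end BetheVector

open Polynomial

section Wronskian

lemma coeff_wronskian {K : Type*} [Field K] (a : K[X]) {b : K[X]} (hb : b.natDegree ≠ 0) :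
    (wronskian a b).coeff (a.natDegree + (b.natDegree - 1)) =
      a.leadingCoeff * b.leadingCoeff * (b.natDegree - a.natDegree) := by
  have coeffDer (p : K[X]) (hp : p.natDegree ≠ 0) :
      (derivative p).coeff (p.natDegree - 1) = p.leadingCoeff * p.natDegree := by
    rw [coeff_derivative, ← Nat.cast_succ, Nat.succ_eq_add_one,
      Nat.sub_add_cancel (Nat.one_le_iff_ne_zero.mpr hp), leadingCoeff]
  rw [wronskian, coeff_sub,
    coeff_mul_add_eq_of_natDegree_le le_rfl (natDegree_derivative_le b), coeffDer b hb]
  by_cases ha : a.natDegree = 0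
  · have ha' : (a.natDegree : K) = 0 := by rw [ha, Nat.cast_zero]
    rw [derivative_of_natDegree_zero ha, zero_mul, coeff_zero, ha', coeff_natDegree]
    ring
  · rw [show a.natDegree + (b.natDegree - 1) = (a.natDegree - 1) + b.natDegree by omega,
      coeff_mul_add_eq_of_natDegree_le (natDegree_derivative_le a) le_rfl, coeffDer a ha]
    simp only [leadingCoeff]
    ring

lemma natDegree_eq_of_wronskian_eq_zero_s2 {K : Type*} [Field K] [CharZero K] {a b : K[X]}
    (ha : a ≠ 0) (hb : b ≠ 0) (h : wronskian a b = 0) : a.natDegree = b.natDegree := by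
  by_cases hb0 : b.natDegree = 0
  · by_contra hab
    have h1 := coeff_wronskian b (b := a) fun h0 => hab (h0.trans hb0.symm)
    rw [← wronskian_neg_eq, h, neg_zero, coeff_zero, eq_comm] at h1
    simp [ha, hb, sub_eq_zero, hab] at h1
  · have h1 := coeff_wronskian a hb0
    rw [h, coeff_zero, eq_comm] at h1
    exact (by simpa [ha, hb, sub_eq_zero] using h1 : b.natDegree = a.natDegree).symm

lemma eq_C_mul_of_wronskian_eq_zero {K : Type*} [Field K] [CharZero K] {a b : K[X]}
    (ha : a ≠ 0) (h : wronskian a b = 0) : ∃ c, b = C c * a := by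
  refine ⟨b.coeff a.natDegree / a.leadingCoeff, ?_⟩
  set c := b.coeff a.natDegree / a.leadingCoeff
  by_contra hb
  have hb' : b - C c * a ≠ 0 := sub_ne_zero.mpr hb
  have hw : wronskian a (b - C c * a) = 0 := by
    rw [← h]
    simp only [wronskian, derivative_sub, derivative_C_mul]
    ring
  have hdeg := natDegree_eq_of_wronskian_eq_zero_s2 ha hb' hw
  have hc : (b - C c * a).coeff a.natDegree = 0 := by
    rw [coeff_sub, coeff_C_mul, coeff_natDegree, div_mul_cancel₀ _ (leadingCoeff_ne_zero.mpr ha),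
      sub_self]
  rw [hdeg, coeff_natDegree] at hc
  exact hb' (leadingCoeff_eq_zero.mp hc)

end Wronskian

section BetheEquation

variable {ι : Type*} [Fintype ι]

/-- The Fuchsian differential equation attached to weights `m`, sites `z` and
accessory parameters `κ`. -/
def IsBetheSolution (m : ι → ℕ) (z κ : ι → ℂ) (F : ℂ[X]) : Prop :=
  ∀ x, (∀ i, x ≠ z i) →
    (derivative (derivative F)).eval x - (∑ i, m i * (x - z i)⁻¹) * (derivative F).eval x =
      (∑ i, κ i * (x - z i)⁻¹) * F.eval x

lemma infinite_setOf_forall_ne (z : ι → ℂ) : {x : ℂ | ∀ i, x ≠ z i}.Infinite := by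
  have : {x : ℂ | ∀ i, x ≠ z i} = (Set.range z)ᶜ := by
    ext x
    simp [eq_comm]
  rw [this]
  exact (Set.finite_range z).infinite_compl

lemma eval_derivative_prod_X_sub_C_pow (m : ι → ℕ) {z : ι → ℂ} {x : ℂ} (hx : ∀ i, x ≠ z i) :
    (derivative (∏ i, (X - C (z i)) ^ m i)).eval x =
      (∑ i, m i * (x - z i)⁻¹) * (∏ i, (X - C (z i)) ^ m i).eval x := by
  classical
  rw [derivative_prod_finset, eval_finsetSum, Finset.sum_mul]
  refine Finset.sum_congr rfl fun i _ => ?_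
  rw [← Finset.mul_prod_erase _ _ (Finset.mem_univ i), derivative_X_sub_C_pow]
  have hi := sub_ne_zero.mpr (hx i)
  simp only [eval_mul, eval_C, eval_pow, eval_sub, eval_X]
  rcases Nat.eq_zero_or_pos (m i) with h | h
  · simp [h]
  · obtain ⟨n, hn⟩ := Nat.exists_eq_add_of_le' h
    rw [hn, pow_succ]
    rw [Nat.add_sub_cancel]
    field_simp

/-- The Fuchsian equation has, up to scaling, at most one polynomial solution of low degree. -/
lemma IsBetheSolution.eq_C_mul {m : ι → ℕ} {z κ : ι → ℂ} {F y : ℂ[X]}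
    (hF : IsBetheSolution m z κ F) (hy : IsBetheSolution m z κ y) (hy0 : y ≠ 0)
    (hdeg : y.natDegree + F.natDegree ≤ ∑ i, m i) : ∃ c, F = C c * y := by
  refine eq_C_mul_of_wronskian_eq_zero hy0 ?_
  by_contra hG
  set P : ℂ[X] := ∏ i, (X - C (z i)) ^ m i with hP
  have hPmonic : P.Monic := monic_prod_of_monic _ _ fun i _ => (monic_X_sub_C _).pow _
  have hPdeg : P.natDegree = ∑ i, m i := by
    rw [hP, natDegree_prod_of_monic _ _ fun i _ => (monic_X_sub_C _).pow _]
    simp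
  have hGP : wronskian (wronskian y F) P = 0 := by
    refine eq_of_infinite_eval_eq _ _ ((infinite_setOf_forall_ne z).mono fun x hx => ?_)
    have h1 := hF x hx
    have h2 := hy x hx
    have h3 := eval_derivative_prod_X_sub_C_pow m hx
    rw [← hP] at h3
    simp only [wronskian, derivative_sub, derivative_mul, eval_sub, eval_mul, eval_add,
      Set.mem_ofPred_eq, eval_zero]
    rw [h3]
    linear_combination (-y.eval x * P.eval x) * h1 + F.eval x * P.eval x * h2
  have := natDegree_eq_of_wronskian_eq_zero_s2 hG hPmonic.ne_zero hGP
  have := natDegree_wronskian_lt_add hG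
  omega

lemma IsBetheSolution.map_conj {m : ι → ℕ} {z κ : ι → ℂ} {F : ℂ[X]}
    (hF : IsBetheSolution m z κ F) (hz : ∀ i, starRingEnd ℂ (z i) = z i)
    (hκ : ∀ i, starRingEnd ℂ (κ i) = κ i) : IsBetheSolution m z κ (F.map (starRingEnd ℂ)) := by
  intro x hx
  have h := congrArg (starRingEnd ℂ) (hF (starRingEnd ℂ x) fun i hi => hx i (by
    rw [← hz i, ← hi, Complex.conj_conj]))
  have hev (p : ℂ[X]) : starRingEnd ℂ (p.eval (starRingEnd ℂ x)) =
      (p.map (starRingEnd ℂ)).eval x := by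
    rw [← eval_map_apply, Complex.conj_conj]
  simpa [hev, hz, hκ, derivative_map] using h

/-- The polynomial with roots solving the Bethe equations solves the Fuchsian equation. -/
lemma isBetheSolution_prod_X_sub_C {m : ι → ℕ} {z : ι → ℂ} {T : Finset ℂ}
    (hT : ∀ t ∈ T, ∀ i, t ≠ z i)
    (hbethe : ∀ t ∈ T, ∑ j, m j * (t - z j)⁻¹ = 2 * ∑ c ∈ T.erase t, (t - c)⁻¹) :
    IsBetheSolution m z (fun i => m i * ∑ t ∈ T, (t - z i)⁻¹) (∏ t ∈ T, (X - C t)) := by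
  have hder (S : Finset ℂ) : derivative (∏ t ∈ S, (X - C t)) =
      ∑ t ∈ S, ∏ s ∈ S.erase t, (X - C s) := by
    simp [derivative_prod_finset]
  have hsecond : derivative (derivative (∏ t ∈ T, (X - C t))) =
      ∑ b ∈ T, C (2 * ∑ c ∈ T.erase b, (b - c)⁻¹) * ∏ s ∈ T.erase b, (X - C s) := by
    have key := sum_sum_inv_sub_mul T fun b => ∏ s ∈ T.erase b, (X - C s)
    simp only [algebraMap_eq] at key
    rw [hder, map_sum, ← neg_inj, ← key, ← Finset.sum_neg_distrib]
    refine Finset.sum_congr rfl fun b hb => ?_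
    rw [hder, ← Finset.sum_neg_distrib]
    refine Finset.sum_congr rfl fun c hc => ?_
    have hbc := Finset.ne_of_mem_erase hc
    rw [← Finset.mul_prod_erase (T.erase c) _ (Finset.mem_erase.mpr ⟨hbc.symm, hb⟩),
      ← Finset.mul_prod_erase (T.erase b) _ hc, Finset.erase_right_comm (a := c), ← sub_mul,
      show X - C c - (X - C b) = C (b - c) by rw [C_sub]; ring, ← mul_assoc,
      ← C_mul, ← neg_sub c b, mul_neg, inv_mul_cancel₀ (sub_ne_zero.mpr hbc), C_neg, C_1, neg_one_mul]
  intro x hx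
  rw [hsecond, hder, eval_finsetSum, eval_finsetSum, Finset.mul_sum, ← Finset.sum_sub_distrib]
  have hr : ∑ i, (m i * ∑ t ∈ T, (t - z i)⁻¹) * (x - z i)⁻¹ =
      ∑ t ∈ T, ∑ i, m i * ((t - z i)⁻¹ * (x - z i)⁻¹) := by
    rw [Finset.sum_comm]
    refine Finset.sum_congr rfl fun i _ => ?_
    rw [Finset.mul_sum, Finset.sum_mul]
    exact Finset.sum_congr rfl fun t _ => mul_assoc _ _ _
  rw [hr, Finset.sum_mul]
  refine Finset.sum_congr rfl fun t ht => ?_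
  rw [← hbethe t ht, eval_mul, eval_C, ← sub_mul, ← Finset.mul_prod_erase T _ ht, eval_mul,
    ← mul_assoc, ← Finset.sum_sub_distrib]
  congr 1
  rw [Finset.sum_mul]
  refine Finset.sum_congr rfl fun i _ => ?_
  have h1 := sub_ne_zero.mpr (hT t ht i)
  have h2 := sub_ne_zero.mpr (hx i)
  simp only [eval_sub, eval_X, eval_C]
  field_simp
  ring

end BetheEquation

section Slice

variable {ι : Type*}

/-- The restriction of a polynomial to the line `x ↦ (v i * (z i - x))ᵢ`. -/
noncomputable def slice (z v : ι → ℂ) : MvPolynomial ι ℂ →ₐ[ℂ] ℂ[X] :=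
  MvPolynomial.aeval fun i => C (v i) * (C (z i) - X)

lemma eval_slice (z v : ι → ℂ) (Φ : MvPolynomial ι ℂ) (x : ℂ) :
    (slice z v Φ).eval x = MvPolynomial.eval (fun i => v i * (z i - x)) Φ := by
  induction Φ using MvPolynomial.induction_on with
  | C a => simp [slice]
  | add p q hp hq => simp [hp, hq]
  | mul_X p i hp =>
    rw [map_mul, eval_mul, hp]
    simp [slice]

lemma natDegree_slice_le {z v : ι → ℂ} {Φ : MvPolynomial ι ℂ} {k : ℕ} (hΦ : Φ.totalDegree ≤ k) :
    (slice z v Φ).natDegree ≤ k := by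
  have := MvPolynomial.aeval_natDegree_le (n := 1) Φ hΦ (fun i => C (v i) * (C (z i) - X))
    fun i => by
      refine (natDegree_C_mul_le _ _).trans ((natDegree_sub_le _ _).trans ?_)
      simp
  simpa [slice] using this

variable [Fintype ι]

lemma derivative_slice (z v : ι → ℂ) (Φ : MvPolynomial ι ℂ) :
    derivative (slice z v Φ) = -∑ i, C (v i) * slice z v (MvPolynomial.pderiv i Φ) := by
  classical
  induction Φ using MvPolynomial.induction_on with
  | C a => simp [slice]
  | add p q hp hq => simp only [map_add, hp, hq, mul_add, Finset.sum_add_distrib]; ring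
  | mul_X p i hp =>
    have hX : slice z v (MvPolynomial.X i) = C (v i) * (C (z i) - X) := by simp [slice]
    have hX' (j : ι) : C (v j) * (slice z v p * slice z v (Pi.single (M := fun _ => _) j 1 i)) =
        if j = i then C (v i) * slice z v p else 0 := by
      split_ifs with h
      · subst h; simp [mul_comm]
      · simp [Pi.single_eq_of_ne' h]
    simp only [map_mul, derivative_mul, hp, Derivation.leibniz, MvPolynomial.pderiv_X, smul_eq_mul,
      map_add, mul_add, Finset.sum_add_distrib, hX', Finset.sum_ite_eq', Finset.mem_univ, if_true]
    have hder : derivative (C (v i) * (C (z i) - X)) = -C (v i) := by simp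
    rw [hX, hder]
    simp only [neg_add, ← Finset.sum_neg_distrib, Finset.sum_mul]
    rw [add_comm]
    congr 1
    · ring
    · exact Finset.sum_congr rfl fun j _ => by ring

lemma sum_gaudin_symbol (m z u v w : ι → ℂ) (d₁ : ι → ℂ) (d₂ : ι → ι → ℂ)
    (hz : Function.Injective z) (hd : ∀ i j, d₂ i j = d₂ j i) (hv : ∑ i, v i = 0)
    (hu : ∀ i j, u i - u j = u i * u j * (z i - z j)) (hw : ∀ i, u i * w i = -v i) :
    ∑ i, u i * ∑ j, (z i - z j)⁻¹ * (-(w i * w j * (d₂ i i - d₂ i j - (d₂ j i - d₂ j j))) +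
      (m i * w j - m j * w i) * (d₁ i - d₁ j)) =
    ∑ i, ∑ j, v i * v j * d₂ i j + (∑ i, m i * u i) * ∑ j, v j * d₁ j := by
  set K : ι → ι → ℂ := fun i j => -(w i * w j * (d₂ i i - d₂ i j - (d₂ j i - d₂ j j))) +
      (m i * w j - m j * w i) * (d₁ i - d₁ j) with hK
  have hKsymm (i j : ι) : K i j = K j i := by
    simp only [hK]
    rw [hd j i]
    ring
  have h1 : ∑ i, u i * ∑ j, (z i - z j)⁻¹ * K i j = ∑ i, ∑ j, u i * ((z i - z j)⁻¹ * K i j) :=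
    Finset.sum_congr rfl fun i _ => Finset.mul_sum _ _ _
  have h2 : 2 * ∑ i, ∑ j, u i * ((z i - z j)⁻¹ * K i j) = ∑ i, ∑ j, u i * u j * K i j := by
    rw [two_mul]
    nth_rewrite 2 [Finset.sum_comm]
    rw [← Finset.sum_add_distrib]
    refine Finset.sum_congr rfl fun i _ => ?_
    rw [← Finset.sum_add_distrib]
    refine Finset.sum_congr rfl fun j _ => ?_
    rcases eq_or_ne i j with rfl | hij
    · simp [hK]
    have hne := sub_ne_zero.mpr (hz.ne hij)
    rw [hKsymm j i, ← neg_sub (z i), inv_neg]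
    have : u i * u j = (u i - u j) * (z i - z j)⁻¹ := by
      rw [hu]
      field_simp
    rw [this]
    ring
  have h3 : ∑ i, ∑ j, u i * u j * K i j = 2 * (∑ i, ∑ j, v i * v j * d₂ i j) -
      (∑ i, v i * d₂ i i) * (∑ j, v j) - (∑ i, v i) * (∑ j, v j * d₂ j j)
      + (∑ i, v i * d₁ i) * (∑ j, m j * u j) - (∑ i, v i) * (∑ j, m j * u j * d₁ j)
      - (∑ i, m i * u i * d₁ i) * (∑ j, v j) + (∑ i, m i * u i) * (∑ j, v j * d₁ j) := by
    simp only [Finset.sum_mul_sum, Finset.mul_sum (a := (2 : ℂ)), ← Finset.sum_add_distrib,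
      ← Finset.sum_sub_distrib]
    refine Finset.sum_congr rfl fun i _ => Finset.sum_congr rfl fun j _ => ?_
    have hi := hw i
    have hj := hw j
    simp only [hK]
    rw [hd j i]
    linear_combination (-(u j * w j) * (d₂ i i - 2 * d₂ i j + d₂ j j) - m j * u j * (d₁ i - d₁ j)) * hi
      + (v i * (d₂ i i - 2 * d₂ i j + d₂ j j) + m i * u i * (d₁ i - d₁ j)) * hj
  rw [hv] at h3
  rw [h1]
  linear_combination (h2 + h3) / 2

/-- Restricting a joint eigenvector of the Gaudin Hamiltonians to a line `∑ v i = 0` gives a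
solution of the Fuchsian equation. -/
lemma isBetheSolution_slice {m : ι → ℕ} {z v κ : ι → ℂ} (hz : Function.Injective z)
    (hv : ∑ i, v i = 0) {Φ : MvPolynomial ι ℂ}
    (hΦ : ∀ i, gaudinHamiltonian m z i Φ =
      (∑ j, (z i - z j)⁻¹ * (m i * m j / 2) + κ i) • Φ) :
    IsBetheSolution m z κ (slice z v Φ) := by
  intro x hx
  set w : ι → ℂ := fun i => v i * (z i - x) with hw
  have hx' (i : ι) := sub_ne_zero.mpr (hx i)
  have hκ (i : ι) : ∑ j, (z i - z j)⁻¹ * (-(w i * w j * (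
      MvPolynomial.eval w (MvPolynomial.pderiv i (MvPolynomial.pderiv i Φ)) - MvPolynomial.eval w (MvPolynomial.pderiv i (MvPolynomial.pderiv j Φ)) -
      (MvPolynomial.eval w (MvPolynomial.pderiv j (MvPolynomial.pderiv i Φ)) - MvPolynomial.eval w (MvPolynomial.pderiv j (MvPolynomial.pderiv j Φ)))))
      + (m i * w j - m j * w i) * (MvPolynomial.eval w (MvPolynomial.pderiv i Φ) -
        MvPolynomial.eval w (MvPolynomial.pderiv j Φ))) = κ i * MvPolynomial.eval w Φ := by
    have h := congrArg (MvPolynomial.eval w) (hΦ i)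
    rw [gaudinHamiltonian, LinearMap.sum_apply, map_sum, MvPolynomial.smul_eval, add_mul,
      Finset.sum_mul, ← sub_eq_iff_eq_add', ← Finset.sum_sub_distrib] at h
    rw [← h]
    refine Finset.sum_congr rfl fun j _ => ?_
    rcases eq_or_ne i j with rfl | hij
    · simp
    rw [LinearMap.smul_apply, MvPolynomial.smul_eval, gaudinOmega_apply m hij]
    simp only [pderivSub_apply, map_sub, map_add, map_mul, MvPolynomial.eval_C,
      MvPolynomial.eval_X]
    ring
  have hsum := sum_gaudin_symbol (fun i => (m i : ℂ)) z (fun i => (x - z i)⁻¹) v w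
    (fun i => MvPolynomial.eval w (MvPolynomial.pderiv i Φ))
    (fun i j => MvPolynomial.eval w (MvPolynomial.pderiv i (MvPolynomial.pderiv j Φ))) hz
    (fun i j => by rw [pderiv_comm]) hv
    (fun i j => by
      have := hx' i
      have := hx' j
      field_simp
      ring)
    (fun i => by
      have := hx' i
      simp only [hw]
      field_simp
      ring)
  simp only [hκ] at hsum
  have hd1 : (derivative (slice z v Φ)).eval x =
      -∑ i, v i * MvPolynomial.eval w (MvPolynomial.pderiv i Φ) := by
    simp [derivative_slice, eval_slice, eval_finsetSum, hw]
  have hd2 : (derivative (derivative (slice z v Φ))).eval x =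
      ∑ i, ∑ j, v i * v j * MvPolynomial.eval w (MvPolynomial.pderiv i (MvPolynomial.pderiv j Φ)) := by
    rw [Finset.sum_comm]
    simp [derivative_slice, eval_slice, eval_finsetSum, hw, Finset.mul_sum, mul_assoc,
      mul_left_comm]
  rw [hd1, hd2, eval_slice, ← hw, mul_neg, sub_neg_eq_add, ← hsum, Finset.sum_mul]
  exact Finset.sum_congr rfl fun i _ => by ring

end Slice

section RealBetheRoots

variable {ι : Type*} [Fintype ι]

lemma exists_line_through {z w : ι → ℂ} [Nontrivial ι] (hz : Function.Injective z)
    (hw : ∀ i, w i ≠ 0) (hsum : ∑ i, w i ≠ 0) :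
    ∃ (x : ℂ) (v : ι → ℂ), ∑ i, v i = 0 ∧ ∀ i, w i = v i * (z i - x) := by
  classical
  set P : ℂ[X] := ∑ i, C (w i) * ∏ j ∈ Finset.univ.erase i, (X - C (z j)) with hP
  have hcard (i : ι) : (Finset.univ.erase i).card = Fintype.card ι - 1 := by
    rw [Finset.card_erase_of_mem (Finset.mem_univ i), Finset.card_univ]
  have hcoeff : P.coeff (Fintype.card ι - 1) = ∑ i, w i := by
    rw [hP, finsetSum_coeff]
    refine Finset.sum_congr rfl fun i _ => ?_
    have h1 : (∏ j ∈ Finset.univ.erase i, (X - C (z j))).coeff (Fintype.card ι - 1) = 1 := by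
      have h2 := (monic_prod_X_sub_C z (Finset.univ.erase i)).coeff_natDegree
      rwa [natDegree_finsetProd_X_sub_C_eq_card, hcard] at h2
    rw [coeff_C_mul, h1, mul_one]
  have hdeg : P.degree ≠ 0 := by
    intro h
    have h1 : 1 < Fintype.card ι := Fintype.one_lt_card
    rw [eq_C_of_degree_eq_zero h, coeff_C_of_ne_zero (by omega)] at hcoeff
    exact hsum hcoeff.symm
  obtain ⟨x, hx⟩ := IsAlgClosed.exists_root P hdeg
  rw [IsRoot, hP, eval_finsetSum] at hx
  simp only [eval_mul, eval_C, eval_prod, eval_sub, eval_X] at hx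
  have hxz (i : ι) : x ≠ z i := by
    rintro rfl
    rw [Finset.sum_eq_single i] at hx
    · rcases mul_eq_zero.mp hx with h | h
      · exact hw i h
      · obtain ⟨j, hj, h0⟩ := Finset.prod_eq_zero_iff.mp h
        exact (Finset.ne_of_mem_erase hj) (hz (sub_eq_zero.mp h0)).symm
    · intro j _ hji
      rw [Finset.prod_eq_zero (Finset.mem_erase.mpr ⟨hji.symm, Finset.mem_univ i⟩) (sub_self _),
        mul_zero]
    · simp
  have hne (i : ι) : z i - x ≠ 0 := sub_ne_zero.mpr (hxz i).symm
  refine ⟨x, fun i => w i / (z i - x), ?_, fun i => (div_mul_cancel₀ _ (hne i)).symm⟩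
  have hprod : ∏ j, (x - z j) ≠ 0 := Finset.prod_ne_zero_iff.mpr fun j _ =>
    sub_ne_zero.mpr (hxz j)
  refine (mul_eq_zero.mp (?_ : (-∏ j, (x - z j)) * _ = 0)).resolve_left (neg_ne_zero.mpr hprod)
  rw [Finset.mul_sum, ← hx]
  refine Finset.sum_congr rfl fun i _ => ?_
  rw [← Finset.mul_prod_erase _ _ (Finset.mem_univ i)]
  have := hne i
  field_simp
  ring

lemma eval_eq_zero_of_mem_siteIdeal {m : ι → ℕ} {k : ℕ} {l : ι} {Φ : MvPolynomial ι ℂ}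
    (hΦ : Φ ∈ siteIdeal m k l) {w : ι → ℂ} (hw : w l = 0) : MvPolynomial.eval w Φ = 0 := by
  rw [MvPolynomial.eval_eq']
  refine Finset.sum_eq_zero fun α hα => ?_
  have h := (mem_siteIdeal.mp hΦ α (MvPolynomial.mem_support_iff.mp hα)).2
  rw [Finset.prod_eq_zero (Finset.mem_univ l), mul_zero]
  rw [hw, zero_pow (by omega)]

variable {m : ι → ℕ} {z : ι → ℂ} {T : Finset ℂ}

lemma eq_zero_of_mem_siteIdeal (hz : Function.Injective z)
    (hT : ∀ t ∈ T, ∀ i, t ≠ z i)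
    (hbethe : ∀ t ∈ T, ∑ j, m j * (t - z j)⁻¹ = 2 * ∑ c ∈ T.erase t, (t - c)⁻¹)
    (hdeg : 2 * T.card ≤ ∑ i, m i) {l : ι} {Φ : MvPolynomial ι ℂ} (hmem : Φ ∈ siteIdeal m T.card l)
    (hΦ : ∀ i, gaudinHamiltonian m z i Φ =
      (∑ j, (z i - z j)⁻¹ * (m i * m j / 2) + m i * ∑ t ∈ T, (t - z i)⁻¹) • Φ) :
    Φ = 0 := by
  have hcoeff := mem_siteIdeal.mp hmem
  rcases subsingleton_or_nontrivial ι with hι | hι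
  · ext α
    by_contra hα
    obtain ⟨h1, h2⟩ := hcoeff α hα
    rw [Finsupp.degree_eq_sum, Fintype.sum_subsingleton _ l] at h1
    rw [Fintype.sum_subsingleton _ l] at hdeg
    omega
  have hy := isBetheSolution_prod_X_sub_C hT hbethe
  have hmonic : (∏ t ∈ T, (X - C t)).Monic := monic_prod_X_sub_C id T
  have hydeg : (∏ t ∈ T, (X - C t)).natDegree = T.card :=
    natDegree_finsetProd_X_sub_C_eq_card T id
  have htot : Φ.totalDegree ≤ T.card := Finset.sup_le fun α hα => by
    rw [← (hcoeff α (MvPolynomial.mem_support_iff.mp hα)).1]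
    exact le_rfl
  have hvan (v : ι → ℂ) (hv : ∑ i, v i = 0) : slice z v Φ = 0 := by
    have hFdeg := natDegree_slice_le (z := z) (v := v) htot
    obtain ⟨c, hc⟩ := (isBetheSolution_slice hz hv hΦ).eq_C_mul hy hmonic.ne_zero (by omega)
    have h0 : (slice z v Φ).eval (z l) = 0 := by
      rw [eval_slice]
      exact eval_eq_zero_of_mem_siteIdeal hmem (by simp)
    have hyl : (∏ t ∈ T, (X - C t)).eval (z l) ≠ 0 := by
      rw [eval_prod]
      refine Finset.prod_ne_zero_iff.mpr fun t ht => ?_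
      simpa [sub_eq_zero] using (hT t ht l).symm
    rw [hc, eval_mul, eval_C] at h0
    rw [hc, (mul_eq_zero.mp h0).resolve_right hyl, C_0, zero_mul]
  have hzero : Φ * ((∏ i, MvPolynomial.X i) * ∑ i, MvPolynomial.X i) = 0 := by
    refine MvPolynomial.funext fun w => ?_
    simp only [map_mul, map_prod, map_sum, MvPolynomial.eval_X, map_zero]
    by_cases hw : ∀ i, w i ≠ 0
    · by_cases hs : ∑ i, w i = 0
      · rw [hs, mul_zero, mul_zero]
      · obtain ⟨x, v, hv, hwv⟩ := exists_line_through hz hw hs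
        rw [funext hwv, ← eval_slice, hvan v hv, eval_zero, zero_mul]
    · push Not at hw
      obtain ⟨i, hi⟩ := hw
      rw [Finset.prod_eq_zero (Finset.mem_univ i) hi, zero_mul, mul_zero]
  refine (mul_eq_zero.mp hzero).resolve_right (mul_ne_zero ?_ ?_)
  · exact Finset.prod_ne_zero_iff.mpr fun i _ => MvPolynomial.X_ne_zero i
  · intro h
    have := congrArg (MvPolynomial.pderiv l) h
    classical
    simp [MvPolynomial.pderiv_X, Pi.single_apply] at this

/-- The eigenvalues of a Bethe vector with real sites are real. -/
lemma conj_betheEigenvalue (hz : Function.Injective z)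
    (hreal : ∀ i, starRingEnd ℂ (z i) = z i) (hT : ∀ t ∈ T, ∀ i, t ≠ z i)
    (hbethe : ∀ t ∈ T, ∑ j, m j * (t - z j)⁻¹ = 2 * ∑ c ∈ T.erase t, (t - c)⁻¹)
    (hdeg : 2 * T.card ≤ ∑ i, m i) (i : ι) :
    starRingEnd ℂ (m i * ∑ t ∈ T, (t - z i)⁻¹) = m i * ∑ t ∈ T, (t - z i)⁻¹ := by
  by_contra hne
  have : Nonempty ι := ⟨i⟩
  have hΨ := gaudinHamiltonian_betheVector m hz hT hbethe
  have hmem := mem_iSup_siteIdeal_of_nonreal_eigenvalue hreal (isHomogeneous_betheVector z T)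
    (i := i) (fun h => hne (by
      have h2 : starRingEnd ℂ 2 = 2 := Complex.conj_ofNat 2
      rw [map_add, show starRingEnd ℂ (∑ j, (z i - z j)⁻¹ * (m i * m j / 2)) =
        ∑ j, (z i - z j)⁻¹ * (m i * m j / 2) by simp [hreal, h2]] at h
      exact add_left_cancel h)) (hΨ i)
  exact betheVector_ne_zero hT (eq_zero_of_mem_iSup_of_joint_eigenvector
    (commute_gaudinHamiltonian m hz) hΨ (siteIdeal m T.card)
    (fun l i v hv => gaudinHamiltonian_mem_siteIdeal z i hv)
    (fun l v hv h => eq_zero_of_mem_siteIdeal hz hT hbethe hdeg hv h) hmem)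

/-- A dominant solution of the Bethe equations with real sites is invariant under complex
conjugation. -/
theorem map_conj_prod_X_sub_C (hz : Function.Injective z)
    (hreal : ∀ i, starRingEnd ℂ (z i) = z i) (hT : ∀ t ∈ T, ∀ i, t ≠ z i)
    (hbethe : ∀ t ∈ T, ∑ j, m j * (t - z j)⁻¹ = 2 * ∑ c ∈ T.erase t, (t - c)⁻¹)
    (hdeg : 2 * T.card ≤ ∑ i, m i) :
    (∏ t ∈ T, (X - C t)).map (starRingEnd ℂ) = ∏ t ∈ T, (X - C t) := by
  have hy := isBetheSolution_prod_X_sub_C hT hbethe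
  have hmonic : (∏ t ∈ T, (X - C t)).Monic := monic_prod_X_sub_C id T
  have hydeg : (∏ t ∈ T, (X - C t)).natDegree = T.card :=
    natDegree_finsetProd_X_sub_C_eq_card T id
  obtain ⟨c, hc⟩ := (hy.map_conj hreal (conj_betheEigenvalue hz hreal hT hbethe hdeg)).eq_C_mul hy
    hmonic.ne_zero (by rw [natDegree_map, hydeg]; omega)
  have hlead := congrArg leadingCoeff hc
  rw [(hmonic.map _).leadingCoeff, leadingCoeff_mul, hmonic.leadingCoeff, leadingCoeff_C,
    mul_one] at hlead
  rw [hc, ← hlead, C_1, one_mul]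

end RealBetheRoots

section RealPair

lemma exists_eq_C_mul_of_isRoot_real {p : ℂ[X]} (h : ∀ x, p.IsRoot x → starRingEnd ℂ x = x) :
    ∃ R : ℂ[X], R.map (starRingEnd ℂ) = R ∧ p = C p.leadingCoeff * R := by
  refine ⟨(p.roots.map fun a => X - C a).prod, ?_, (IsAlgClosed.splits p).eq_prod_roots⟩
  rw [Polynomial.map_multiset_prod, Multiset.map_map]
  congr 1
  refine Multiset.map_congr rfl fun x hx => ?_
  simp [h x (isRoot_of_mem_roots hx)]

lemma map_conj_map_conj (p : ℂ[X]) : (p.map (starRingEnd ℂ)).map (starRingEnd ℂ) = p := by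
  ext
  simp

lemma map_wronskian {R S : Type*} [CommRing R] [CommRing S] (f : R →+* S) (a b : R[X]) :
    (wronskian a b).map f = wronskian (a.map f) (b.map f) := by
  simp [wronskian, derivative_map]

lemma eval_wronskian {R : Type*} [CommRing R] (a b : R[X]) (x : R) :
    (wronskian a b).eval x =
      a.eval x * (derivative b).eval x - (derivative a).eval x * b.eval x := by
  simp [wronskian]

variable {y q : ℂ[X]}

/-- The roots of the lower-degree member of a pair solve the Bethe equations of the Wronskian. -/
lemma bethe_equation_of_isRoot (hyW : ∀ x, (wronskian y q).IsRoot x → y.eval x ≠ 0) {t : ℂ}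
    {h : ℂ[X]} (hyt : y = (X - C t) * h) :
    ∑ j ∈ (wronskian y q).roots.toFinset, (wronskian y q).rootMultiplicity j * (t - j)⁻¹ =
      2 * (h.roots.map fun c => (t - c)⁻¹).sum := by
  classical
  have hyt0 : y.eval t = 0 := by simp [hyt]
  have hd1 : (derivative y).eval t = h.eval t := by simp [hyt]
  have hd2 : (derivative (derivative y)).eval t = 2 * (derivative h).eval t := by
    simp [hyt]
    ring
  have hW : (wronskian y q).eval t = -(h.eval t * q.eval t) := by
    rw [eval_wronskian, hyt0, hd1]
    ring
  have hW' : (derivative (wronskian y q)).eval t = -(2 * (derivative h).eval t * q.eval t) := by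
    simp only [wronskian, derivative_sub, derivative_mul, eval_sub, eval_add, eval_mul, hyt0, hd1,
      hd2]
    ring
  have hWt : (wronskian y q).eval t ≠ 0 := fun h0 => hyW t h0 hyt0
  have hht : h.eval t ≠ 0 := fun h0 => hWt (by rw [hW, h0, zero_mul, neg_zero])
  have hqt : q.eval t ≠ 0 := fun h0 => hWt (by rw [hW, h0, mul_zero, neg_zero])
  have e1 := (IsAlgClosed.splits (wronskian y q)).eval_derivative_div_eval_of_ne_zero hWt
  have e2 := (IsAlgClosed.splits h).eval_derivative_div_eval_of_ne_zero hht
  rw [Finset.sum_multiset_map_count] at e1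
  simp only [one_div, count_roots, nsmul_eq_mul] at e1 e2
  rw [← e1, ← e2, hW, hW']
  field_simp

lemma nodup_roots_of_eval_wronskian_ne_zero (hy0 : y ≠ 0)
    (hyW : ∀ x, (wronskian y q).IsRoot x → y.eval x ≠ 0) : y.roots.Nodup := by
  classical
  refine Multiset.nodup_iff_count_le_one.mpr fun t => ?_
  rw [count_roots]
  by_contra! h
  obtain ⟨h1, h2⟩ := (one_lt_rootMultiplicity_iff_isRoot hy0).mp h
  refine hyW t ?_ h1
  rw [IsRoot, eval_wronskian, h1.eq_zero, h2.eq_zero, zero_mul, zero_mul, sub_zero]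

/-- If the Wronskian of a pair of different degrees has real roots, which are not roots of the
lower-degree member, then this member is proportional to a real polynomial. -/
lemma exists_eq_C_mul_of_wronskian_real (hlt : y.natDegree < q.natDegree) (hy0 : y ≠ 0)
    (hreal : ∀ x, (wronskian y q).IsRoot x → starRingEnd ℂ x = x)
    (hyW : ∀ x, (wronskian y q).IsRoot x → y.eval x ≠ 0) :
    ∃ P : ℂ[X], P.map (starRingEnd ℂ) = P ∧ y = C y.leadingCoeff * P := by
  classical
  set W := wronskian y q with hWdef
  have hq0 : q ≠ 0 := by
    rintro rfl
    simp at hlt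
  have hcoeff := coeff_wronskian y (b := q) (by omega)
  have hne : (q.natDegree : ℂ) - y.natDegree ≠ 0 := sub_ne_zero.mpr (by exact_mod_cast hlt.ne')
  have hdegW : 2 * y.natDegree ≤ W.natDegree := by
    have := le_natDegree_of_ne_zero (p := W) (n := y.natDegree + (q.natDegree - 1)) (by
      rw [hcoeff]
      exact mul_ne_zero (mul_ne_zero (leadingCoeff_ne_zero.mpr hy0)
        (leadingCoeff_ne_zero.mpr hq0)) hne)
    omega
  have hnodup := nodup_roots_of_eval_wronskian_ne_zero hy0 hyW
  have hprod (p : ℂ[X]) (hp : p.roots.Nodup) :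
      p = C p.leadingCoeff * ∏ t ∈ p.roots.toFinset, (X - C t) := by
    conv_lhs => rw [(IsAlgClosed.splits p).eq_prod_roots]
    rw [Finset.prod_eq_multiset_prod, Multiset.toFinset_val, hp.dedup]
  refine ⟨∏ t ∈ y.roots.toFinset, (X - C t), ?_, hprod y hnodup⟩
  refine map_conj_prod_X_sub_C (ι := W.roots.toFinset) (m := fun i => W.rootMultiplicity (i : ℂ))
    (z := fun i => (i : ℂ)) Subtype.val_injective
    (fun i => hreal i (isRoot_of_mem_roots (Multiset.mem_toFinset.mp i.2))) ?_ ?_ ?_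
  · rintro t ht i rfl
    exact hyW i (isRoot_of_mem_roots (Multiset.mem_toFinset.mp i.2))
      (isRoot_of_mem_roots (Multiset.mem_toFinset.mp ht))
  · intro t ht
    have hsplit : y = (X - C t) *
        (C y.leadingCoeff * ∏ c ∈ y.roots.toFinset.erase t, (X - C c)) := by
      conv_lhs => rw [hprod y hnodup, ← Finset.mul_prod_erase _ _ ht]
      ring
    have hb := bethe_equation_of_isRoot hyW hsplit
    rw [roots_C_mul _ (leadingCoeff_ne_zero.mpr hy0), roots_prod_X_sub_C] at hb
    rw [Finset.sum_coe_sort W.roots.toFinset (fun j => (W.rootMultiplicity j : ℂ) * (t - j)⁻¹)]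
    exact hb
  · rw [Finset.sum_coe_sort W.roots.toFinset (fun j => W.rootMultiplicity j),
      Multiset.toFinset_card_of_nodup hnodup, ← (IsAlgClosed.splits y).natDegree_eq_card_roots]
    refine hdegW.trans_eq ?_
    rw [(IsAlgClosed.splits W).natDegree_eq_card_roots, ← Multiset.toFinset_sum_count_eq]
    exact Finset.sum_congr rfl fun j _ => count_roots W

lemma exists_real_pair_of_natDegree_lt (hlt : y.natDegree < q.natDegree) (hy0 : y ≠ 0)
    (hreal : ∀ x, (wronskian y q).IsRoot x → starRingEnd ℂ x = x)
    (hyW : ∀ x, (wronskian y q).IsRoot x → y.eval x ≠ 0) :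
    ∃ a c d : ℂ, a ≠ 0 ∧ d ≠ 0 ∧ (C a * y).map (starRingEnd ℂ) = C a * y ∧
      (C c * y + C d * q).map (starRingEnd ℂ) = C c * y + C d * q := by
  obtain ⟨P, hP, hyP⟩ := exists_eq_C_mul_of_wronskian_real hlt hy0 hreal hyW
  set μ := y.leadingCoeff with hμ
  have hμ0 : μ ≠ 0 := leadingCoeff_ne_zero.mpr hy0
  have hPy : P = C μ⁻¹ * y := by
    rw [hyP, ← mul_assoc, ← C_mul, inv_mul_cancel₀ hμ0, C_1, one_mul]
  have hP0 : P ≠ 0 := by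
    rintro rfl
    exact hy0 (by rw [hyP, mul_zero])
  have hq0 : q ≠ 0 := by
    rintro rfl
    simp at hlt
  have hW0 : wronskian y q ≠ 0 := fun h =>
    hlt.ne (natDegree_eq_of_wronskian_eq_zero_s2 hy0 hq0 h)
  obtain ⟨R, hR, hWR⟩ := exists_eq_C_mul_of_isRoot_real hreal
  set ν := (wronskian y q).leadingCoeff
  have hν0 : ν ≠ 0 := leadingCoeff_ne_zero.mpr hW0
  set q₀ := C (μ * ν⁻¹) * q with hq₀
  have hPq : wronskian P q₀ = R := by
    have : wronskian P q₀ = C μ⁻¹ * C (μ * ν⁻¹) * wronskian y q := by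
      rw [hPy, hq₀]
      simp only [wronskian, derivative_C_mul]
      ring
    rw [this, hWR, ← mul_assoc, ← C_mul, ← C_mul]
    field_simp
    simp
  have hconj : wronskian P (q₀.map (starRingEnd ℂ) - q₀) = 0 := by
    have h1 : wronskian P (q₀.map (starRingEnd ℂ)) = R := by
      conv_lhs => rw [← hP]
      rw [← map_wronskian, hPq, hR]
    rw [sub_eq_add_neg, wronskian_add_right, wronskian_neg_right, h1, hPq, add_neg_cancel]
  obtain ⟨e, he⟩ := eq_C_mul_of_wronskian_eq_zero hP0 hconj
  refine ⟨μ⁻¹, e * μ⁻¹, 2 * (μ * ν⁻¹), inv_ne_zero hμ0,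
    mul_ne_zero two_ne_zero (mul_ne_zero hμ0 (inv_ne_zero hν0)), by rw [← hPy, hP], ?_⟩
  have hsum : C (e * μ⁻¹) * y + C (2 * (μ * ν⁻¹)) * q = q₀.map (starRingEnd ℂ) + q₀ := by
    have h2 : (C 2 : ℂ[X]) = 2 := map_ofNat C 2
    rw [sub_eq_iff_eq_add.mp he, C_mul, mul_assoc, ← hPy, C_mul, mul_assoc, ← hq₀, h2]
    ring
  rw [hsum, Polynomial.map_add, map_conj_map_conj, add_comm]

end RealPair

section Moebius

lemma eval_reflect {K : Type*} [Field K] {p : K[X]} {N : ℕ} (hp : p.natDegree ≤ N) {x : K}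
    (hx : x ≠ 0) : (reflect N p).eval x = x ^ N * p.eval x⁻¹ := by
  let := invertibleOfNonzero (inv_ne_zero hx)
  have h := eval₂_reflect_mul_pow (RingHom.id K) x⁻¹ N p hp
  simp only [invOf_eq_inv, inv_inv] at h
  rw [eval₂_id, eval₂_id] at h
  rw [← h, inv_pow, mul_left_comm, mul_inv_cancel₀ (pow_ne_zero N hx), mul_one]

lemma X_mul_derivative_reflect {R : Type*} [CommRing R] {p : R[X]} {N : ℕ}
    (hp : p.natDegree ≤ N) :
    X * derivative (reflect N p) = (N : R[X]) * reflect N p - reflect N (X * derivative p) := by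
  have coeff_X_mul_derivative (f : R[X]) (i : ℕ) :
      (X * derivative f).coeff i = (i : R) * f.coeff i := by
    cases i with
    | zero => simp
    | succ i => rw [coeff_X_mul, coeff_derivative, mul_comm, Nat.cast_succ]
  ext i
  rw [coeff_X_mul_derivative, coeff_sub, coeff_natCast_mul, coeff_reflect, coeff_reflect,
    coeff_X_mul_derivative]
  rcases le_or_gt i N with hi | hi
  · rw [revAt_le hi, Nat.cast_sub hi]
    ring
  · rw [revAt_eq_self_of_lt hi, coeff_eq_zero_of_natDegree_lt (hp.trans_lt hi)]
    simp

lemma eval_wronskian_reflect {K : Type*} [Field K] {a b : K[X]} {N : ℕ} (ha : a.natDegree ≤ N)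
    (hb : b.natDegree ≤ N) {x : K} (hx : x ≠ 0) :
    x * (wronskian (reflect N a) (reflect N b)).eval x =
      -(x ^ N * x ^ N * x⁻¹) * (wronskian a b).eval x⁻¹ := by
  have key {p : K[X]} (hp : p.natDegree ≤ N) : x * (derivative (reflect N p)).eval x =
      (N : K) * (x ^ N * p.eval x⁻¹) - x ^ N * (x⁻¹ * (derivative p).eval x⁻¹) := by
    have hp' : (X * derivative p).natDegree ≤ N := by
      by_cases h0 : p.natDegree = 0
      · simp [derivative_of_natDegree_zero h0]
      · refine natDegree_mul_le.trans ?_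
        have := natDegree_derivative_lt h0
        have := natDegree_X_le (R := K)
        omega
    have h := congrArg (eval x) (X_mul_derivative_reflect hp)
    simpa [eval_reflect hp hx, eval_reflect hp' hx] using h
  rw [eval_wronskian, eval_wronskian, mul_sub, mul_left_comm, key hb, ← mul_assoc x, key ha,
    eval_reflect ha hx, eval_reflect hb hx]
  ring

lemma exists_real_pair_of_eval_zero {y q : ℂ[X]} {N : ℕ} (hyN : y.natDegree ≤ N)
    (hqN : q.natDegree ≤ N) (hcoeff : y.coeff N ≠ 0) (hy : y.eval 0 = 0) (hq : q.eval 0 ≠ 0)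
    (hreal : ∀ x, (wronskian y q).IsRoot x → starRingEnd ℂ x = x)
    (hyW : ∀ x, (wronskian y q).IsRoot x → y.eval x ≠ 0) :
    ∃ a c d : ℂ, a ≠ 0 ∧ d ≠ 0 ∧ (C a * y).map (starRingEnd ℂ) = C a * y ∧
      (C c * y + C d * q).map (starRingEnd ℂ) = C c * y + C d * q := by
  rw [← coeff_zero_eq_eval_zero] at hy hq
  have hy0 : reflect N y ≠ 0 := by
    rw [Ne, reflect_eq_zero_iff]
    rintro rfl
    simp at hcoeff
  have hNy : (reflect N y).coeff N = 0 := by simpa [coeff_reflect, revAt_le] using hy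
  have hNq : (reflect N q).coeff N ≠ 0 := by simpa [coeff_reflect, revAt_le] using hq
  have hlt : (reflect N y).natDegree < (reflect N q).natDegree := by
    refine lt_of_lt_of_le ?_ (le_natDegree_of_ne_zero hNq)
    refine lt_of_le_of_ne (natDegree_reflect_le.trans (by simpa using hyN)) fun h => hy0 ?_
    rwa [← leadingCoeff_eq_zero, leadingCoeff, h]
  have hroot {x : ℂ} (hx : x ≠ 0) (h : (wronskian (reflect N y) (reflect N q)).IsRoot x) :
      (wronskian y q).IsRoot x⁻¹ := by
    have h1 := eval_wronskian_reflect hyN hqN hx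
    rw [h.eq_zero, mul_zero, eq_comm] at h1
    simpa [hx] using h1
  have hpair := exists_real_pair_of_natDegree_lt hlt hy0 ?_ ?_
  · obtain ⟨a, c, d, ha, hd, h1, h2⟩ := hpair
    rw [← reflect_C_mul, ← reflect_map] at h1
    rw [← reflect_C_mul, ← reflect_C_mul, ← reflect_add, ← reflect_map] at h2
    have hinj : Function.Injective (reflect N : ℂ[X] → ℂ[X]) :=
      Function.LeftInverse.injective (g := reflect N) fun _ => reflect_reflect
    exact ⟨a, c, d, ha, hd, hinj h1, hinj h2⟩
  · intro x h
    by_cases hx : x = 0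
    · simp [hx]
    · simpa using hreal _ (hroot hx h)
  · intro x h
    by_cases hx : x = 0
    · rw [hx, ← coeff_zero_eq_eval_zero]
      simpa [coeff_reflect] using hcoeff
    · rw [eval_reflect hyN hx]
      exact mul_ne_zero (pow_ne_zero _ hx) (hyW _ (hroot hx h))

lemma exists_real_pair_of_eval_eq_zero {y q : ℂ[X]} {N : ℕ} (s : ℝ) (hyN : y.natDegree ≤ N)
    (hqN : q.natDegree ≤ N) (hcoeff : y.coeff N ≠ 0) (hy : y.eval (s : ℂ) = 0)
    (hq : q.eval (s : ℂ) ≠ 0)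
    (hreal : ∀ x, (wronskian y q).IsRoot x → starRingEnd ℂ x = x)
    (hyW : ∀ x, (wronskian y q).IsRoot x → y.eval x ≠ 0) :
    ∃ a c d : ℂ, a ≠ 0 ∧ d ≠ 0 ∧ (C a * y).map (starRingEnd ℂ) = C a * y ∧
      (C c * y + C d * q).map (starRingEnd ℂ) = C c * y + C d * q := by
  have hW : wronskian (taylor (s : ℂ) y) (taylor (s : ℂ) q) =
      taylor (s : ℂ) (wronskian y q) := by
    simp [wronskian, taylor_apply, derivative_comp]
  have hcoeffN : y.natDegree = N := le_antisymm hyN (le_natDegree_of_ne_zero hcoeff)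
  have hmap (p : ℂ[X]) : (taylor (s : ℂ) p).map (starRingEnd ℂ) =
      taylor (s : ℂ) (p.map (starRingEnd ℂ)) := by
    simp [taylor_apply, Polynomial.map_comp]
  have hC (e : ℂ) (p : ℂ[X]) : C e * taylor (s : ℂ) p = taylor (s : ℂ) (C e * p) := by
    simp [taylor_mul]
  have htaylor (p : ℂ[X]) (x : ℂ) : (taylor (s : ℂ) p).eval x = p.eval (x + s) := by
    simp [taylor_apply]
  have hpair := exists_real_pair_of_eval_zero
    (y := taylor (s : ℂ) y) (q := taylor (s : ℂ) q) (N := N)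
    (by simpa using hyN) (by simpa using hqN) ?_ (by simpa [htaylor] using hy)
    (by simpa [htaylor] using hq) ?_ ?_
  · obtain ⟨a, c, d, ha, hd, h1, h2⟩ := hpair
    refine ⟨a, c, d, ha, hd, taylor_injective (s : ℂ) ?_, taylor_injective (s : ℂ) ?_⟩
    · rw [← hmap, ← hC, h1]
    · rw [← hmap, map_add, ← hC, ← hC, h2]
  · have hlead : (taylor (s : ℂ) y).natDegree = N := by rw [natDegree_taylor, hcoeffN]
    rw [← hlead, coeff_natDegree, Ne, leadingCoeff_eq_zero, taylor_eq_zero]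
    rintro rfl
    simp at hcoeff
  · intro x h
    rw [hW, IsRoot, htaylor] at h
    simpa using hreal _ h
  · intro x h
    rw [hW, IsRoot, htaylor] at h
    rw [htaylor]
    exact hyW _ h

lemma exists_real_eval_ne_zero {p : ℂ[X]} (hp : p ≠ 0) : ∃ s : ℝ, p.eval (s : ℂ) ≠ 0 := by
  by_contra! h
  refine hp (eq_zero_of_infinite_isRoot p ((Set.infinite_range_of_injective
    Complex.ofReal_injective).mono ?_))
  rintro _ ⟨s, rfl⟩
  exact h s

lemma C_mul_sub_C_mul_ne_zero {K : Type*} [Field K] {f₀ f₁ : K[X]} (hW : wronskian f₀ f₁ ≠ 0)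
    {u v : K} (huv : u ≠ 0 ∨ v ≠ 0) : C u * f₀ - C v * f₁ ≠ 0 := by
  intro h
  have h0 : C v * wronskian f₀ f₁ = 0 := by
    have : C v * wronskian f₀ f₁ = -wronskian f₀ (C u * f₀ - C v * f₁) := by
      simp only [wronskian, derivative_sub, derivative_C_mul]
      ring
    rw [this, h]
    simp
  have h1 : C u * wronskian f₀ f₁ = 0 := by
    have : C u * wronskian f₀ f₁ = wronskian (C u * f₀ - C v * f₁) f₁ := by
      simp only [wronskian, derivative_sub, derivative_C_mul]
      ring
    rw [this, h]
    simp
  simp only [mul_eq_zero, hW, or_false, C_eq_zero] at h0 h1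
  tauto

lemma exists_real_pair_of_isCoprime {f₀ f₁ : ℂ[X]} (hco : IsCoprime f₀ f₁)
    (hW : wronskian f₀ f₁ ≠ 0)
    (hreal : ∀ x, (wronskian f₀ f₁).IsRoot x → starRingEnd ℂ x = x) :
    ∃ a b c d : ℂ, a * d - b * c ≠ 0 ∧
      (C a * f₀ + C b * f₁).map (starRingEnd ℂ) = C a * f₀ + C b * f₁ ∧
      (C c * f₀ + C d * f₁).map (starRingEnd ℂ) = C c * f₀ + C d * f₁ := by
  have hf₀ : f₀ ≠ 0 := by
    rintro rfl
    simp at hW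
  have hf₁ : f₁ ≠ 0 := by
    rintro rfl
    simp at hW
  set N := max f₀.natDegree f₁.natDegree
  set W := wronskian f₀ f₁
  have hcoeff : f₁.coeff N ≠ 0 ∨ f₀.coeff N ≠ 0 := by
    rcases max_choice f₀.natDegree f₁.natDegree with h | h
    · right
      simpa [N, h] using hf₀
    · left
      simpa [N, h] using hf₁
  have hev (z : ℂ) : f₁.eval z ≠ 0 ∨ f₀.eval z ≠ 0 := by
    by_contra! h
    obtain ⟨u, v, huv⟩ := hco
    simpa [h] using congrArg (eval z) huv
  obtain ⟨s, hs⟩ := exists_real_eval_ne_zero (p := f₀ *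
    (C (f₁.coeff N) * f₀ - C (f₀.coeff N) * f₁) *
      ∏ z ∈ W.roots.toFinset, (C (f₁.eval z) * f₀ - C (f₀.eval z) * f₁))
    (mul_ne_zero (mul_ne_zero hf₀ (C_mul_sub_C_mul_ne_zero hW hcoeff))
      (Finset.prod_ne_zero_iff.mpr fun z _ => C_mul_sub_C_mul_ne_zero hW (hev z)))
  simp only [eval_mul, eval_prod, mul_ne_zero_iff, Finset.prod_ne_zero_iff, eval_sub, eval_C] at hs
  obtain ⟨⟨hs₀, hsN⟩, hsW⟩ := hs
  set y := C (f₁.eval (s : ℂ)) * f₀ - C (f₀.eval (s : ℂ)) * f₁ with hy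
  have hyW : wronskian y f₀ = C (f₀.eval (s : ℂ)) * W := by
    simp only [hy, W, wronskian, derivative_sub, derivative_C_mul]
    ring
  have hroot {x : ℂ} (h : (wronskian y f₀).IsRoot x) : W.IsRoot x := by
    simpa [hyW, IsRoot, hs₀] using h
  have hpair := exists_real_pair_of_eval_eq_zero (y := y) (q := f₀)
    (N := N) s ?_ (le_max_left _ _) ?_ ?_ hs₀ (fun x h => hreal x (hroot h)) ?_
  · obtain ⟨a, c, d, ha, hd, h1, h2⟩ := hpair
    have e1 : C (a * f₁.eval (s : ℂ)) * f₀ + C (-(a * f₀.eval (s : ℂ))) * f₁ = C a * y := by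
      simp only [hy, C_mul, C_neg]
      ring
    have e2 : C (c * f₁.eval (s : ℂ) + d) * f₀ + C (-(c * f₀.eval (s : ℂ))) * f₁ =
        C c * y + C d * f₀ := by
      simp only [hy, C_mul, C_neg, C_add]
      ring
    refine ⟨_, _, _, _, ?_, by rw [e1, h1], by rw [e2, h2]⟩
    convert mul_ne_zero (mul_ne_zero ha hd) hs₀ using 1
    ring
  · exact (natDegree_sub_le _ _).trans
      (max_le_max (natDegree_C_mul_le _ _) (natDegree_C_mul_le _ _))
  · rw [hy, coeff_sub, coeff_C_mul, coeff_C_mul]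
    contrapose! hsN
    linear_combination -hsN
  · simp only [hy, eval_sub, eval_mul, eval_C]
    ring
  · intro x h
    have h3 := hsW x (Multiset.mem_toFinset.mpr ((mem_roots hW).mpr (hroot h)))
    simp only [hy, eval_sub, eval_mul, eval_C]
    contrapose! h3
    linear_combination -h3

lemma exists_real_pair_of_wronskian_ne_zero {f₀ f₁ : ℂ[X]} (hW : wronskian f₀ f₁ ≠ 0)
    (hreal : ∀ x, (wronskian f₀ f₁).IsRoot x → starRingEnd ℂ x = x) :
    ∃ a b c d : ℂ, a * d - b * c ≠ 0 ∧
      (C a * f₀ + C b * f₁).map (starRingEnd ℂ) = C a * f₀ + C b * f₁ ∧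
      (C c * f₀ + C d * f₁).map (starRingEnd ℂ) = C c * f₀ + C d * f₁ := by
  have hf₀ : f₀ ≠ 0 := by
    rintro rfl
    simp at hW
  set G := EuclideanDomain.gcd f₀ f₁
  obtain ⟨g₀, h₀⟩ : G ∣ f₀ := EuclideanDomain.gcd_dvd_left f₀ f₁
  obtain ⟨g₁, h₁⟩ : G ∣ f₁ := EuclideanDomain.gcd_dvd_right f₀ f₁
  have hG : wronskian f₀ f₁ = G * G * wronskian g₀ g₁ := by
    conv_lhs => rw [h₀, h₁]
    simp only [wronskian, derivative_mul]
    ring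
  have hG0 : G ≠ 0 := by
    rintro h
    simp [hG, h] at hW
  have hco : IsCoprime g₀ g₁ := by
    refine ⟨EuclideanDomain.gcdA f₀ f₁, EuclideanDomain.gcdB f₀ f₁, mul_left_cancel₀ hG0 ?_⟩
    have h : G = f₀ * EuclideanDomain.gcdA f₀ f₁ + f₁ * EuclideanDomain.gcdB f₀ f₁ :=
      EuclideanDomain.gcd_eq_gcd_ab f₀ f₁
    linear_combination -h - EuclideanDomain.gcdA f₀ f₁ * h₀ - EuclideanDomain.gcdB f₀ f₁ * h₁
  have hg : wronskian g₀ g₁ ≠ 0 := by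
    rintro h
    simp [hG, h] at hW
  obtain ⟨R, hR, hGR⟩ := exists_eq_C_mul_of_isRoot_real (p := G) fun x hx =>
    hreal x (by rw [hG, IsRoot, eval_mul, eval_mul, hx.eq_zero, zero_mul, zero_mul])
  obtain ⟨a, b, c, d, hdet, h1, h2⟩ := exists_real_pair_of_isCoprime hco hg fun x hx =>
    hreal x (by rw [hG, IsRoot, eval_mul, hx.eq_zero, mul_zero])
  set μ := G.leadingCoeff
  have hμ : μ ≠ 0 := leadingCoeff_ne_zero.mpr hG0
  have key (u v : ℂ) : C (u * μ⁻¹) * f₀ + C (v * μ⁻¹) * f₁ = R * (C u * g₀ + C v * g₁) := by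
    have hμC : C μ⁻¹ * C μ = (1 : ℂ[X]) := by rw [← C_mul, inv_mul_cancel₀ hμ, C_1]
    rw [h₀, h₁, hGR, C_mul, C_mul]
    linear_combination (R * (C u * g₀ + C v * g₁)) * hμC
  refine ⟨a * μ⁻¹, b * μ⁻¹, c * μ⁻¹, d * μ⁻¹, ?_, ?_, ?_⟩
  · convert mul_ne_zero hdet (mul_ne_zero (inv_ne_zero hμ) (inv_ne_zero hμ)) using 1
    ring
  · rw [key, Polynomial.map_mul, hR, h1]
  · rw [key, Polynomial.map_mul, hR, h2]

lemma exists_eq_map_algebraMap_of_map_conj {p : ℂ[X]} (hp : p.map (starRingEnd ℂ) = p) :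
    ∃ g : ℝ[X], p = g.map (algebraMap ℝ ℂ) := by
  have : p ∈ lifts (algebraMap ℝ ℂ) := by
    refine (lifts_iff_coeff_lifts p).mpr fun n => ?_
    have h := congrArg (fun f => f.coeff n) hp
    simp only [coeff_map] at h
    obtain ⟨r, hr⟩ := Complex.conj_eq_iff_real.mp h
    exact ⟨r, hr.symm⟩
  obtain ⟨g, hg⟩ := (mem_lifts p).mp this
  exact ⟨g, hg.symm⟩

end Moebius

/-- **Theorem 1 (Wronskian form).** If `f₀, f₁` are linearly independent complex
polynomials and every complex root of the Wronskian `W(f₀,f₁) = f₀·f₁′ − f₀′·f₁` is real,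
then the pair `(f₀, f₁)` can be made real by an invertible constant linear transformation:
there are `a b c d : ℂ` with `a*d - b*c ≠ 0` such that `a•f₀ + b•f₁` and `c•f₀ + d•f₁`
both have real coefficients. -/
theorem wronskian_real_roots_implies_real_pair
    (f₀ f₁ : ℂ[X])
    (hind : LinearIndependent ℂ ![f₀, f₁])
    (hreal : ∀ z : ℂ, (f₀ * derivative f₁ - derivative f₀ * f₁).eval z = 0 →
      ∃ x : ℝ, z = (x : ℂ)) :
    ∃ a b c d : ℂ, a * d - b * c ≠ 0 ∧
      (∃ g : ℝ[X], a • f₀ + b • f₁ = g.map (algebraMap ℝ ℂ)) ∧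
      (∃ h : ℝ[X], c • f₀ + d • f₁ = h.map (algebraMap ℝ ℂ)) := by
  have hW : wronskian f₀ f₁ ≠ 0 := by
    intro h
    obtain ⟨c, hc⟩ := eq_C_mul_of_wronskian_eq_zero (hind.ne_zero 0) h
    have := (LinearIndependent.pair_iff.mp hind c (-1) (by
      rw [neg_one_smul, smul_eq_C_mul]
      exact add_neg_eq_zero.mpr hc.symm)).2
    simp at this
  obtain ⟨a, b, c, d, hdet, h₀, h₁⟩ := exists_real_pair_of_wronskian_ne_zero hW fun x hx => by
    obtain ⟨r, rfl⟩ := hreal x hx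
    exact Complex.conj_ofReal r
  simp only [smul_eq_C_mul]
  exact ⟨a, b, c, d, hdet, exists_eq_map_algebraMap_of_map_conj h₀,
    exists_eq_map_algebraMap_of_map_conj h₁⟩
end
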